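/- Let X ⊆ ℝⁿ be a compact semialgebraic set with 0 ∈ X, let f : X → ℝ be a continuous semialgebraic function with f(0) = 0, and for i ∈ {1,2} let d_i : X → ℝ be a nonnegative continuous semialgebraic function whose zero set is exactly {0}. Set N_i(a,r) = {x ∈ X : d_i(x) ≤ r, f(x) = a}. Then for 0 < a ≪ r ≪ 1, the sets N₁(a,r) and N₂(a,r) are semialgebraically homeomorphic. -/

import Mathlib

noncomputable section
open Classical Filter Topology

namespace RealMilnor

/-- Semialgebraic subsets of `ℝ^ι`: the Boolean algebra generated by the sets
`{x | P(x) > 0}` for real polynomials `P`. -/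
inductive IsRSA (ι : Type) : Set (ι → ℝ) → Prop
  | basic (P : MvPolynomial ι ℝ) : IsRSA ι {x | 0 < MvPolynomial.eval x P}
  | compl {s : Set (ι → ℝ)} : IsRSA ι s → IsRSA ι sᶜ
  | union {s t : Set (ι → ℝ)} : IsRSA ι s → IsRSA ι t → IsRSA ι (s ∪ t)

/-- The Euclidean norm on `ℝⁿ`. -/
def enorm {n : ℕ} (x : Fin n → ℝ) : ℝ := Real.sqrt (∑ i, x i ^ 2)

/-- An arc in `ℝⁿ`: (a representative of) the germ at `0⁺` of a continuous
semialgebraic map `(0,ε) → ℝⁿ`. -/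
def IsArc {n : ℕ} (γ : ℝ → (Fin n → ℝ)) : Prop :=
  ∃ ε : ℝ, 0 < ε ∧ ContinuousOn γ (Set.Ioo 0 ε) ∧
    IsRSA (Option (Fin n))
      {z | z none ∈ Set.Ioo 0 ε ∧ (fun i => z (some i)) = γ (z none)}

/-- The set `𝒻_f` of arcs `γ` with `lim_{t→0⁺} γ(t) = 0` and `f(γ(t)) = t` for all
sufficiently small `t > 0`. -/
def ArcFib {n : ℕ} (f : (Fin n → ℝ) → ℝ) : Set (ℝ → (Fin n → ℝ)) :=
  {γ | IsArc γ ∧ Filter.Tendsto γ (nhdsWithin 0 (Set.Ioi 0)) (nhds 0) ∧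
       ∀ᶠ t in nhdsWithin (0 : ℝ) (Set.Ioi 0), f (γ t) = t}

/-- The positive Milnor fibre `F_f(r,a) = {x ∈ ℝⁿ : |x| ≤ r, f(x) = a}`. -/
def Fib {n : ℕ} (f : (Fin n → ℝ) → ℝ) (r a : ℝ) : Set (Fin n → ℝ) :=
  {x | enorm x ≤ r ∧ f x = a}

/-- The graph of the restriction of `f : ℝⁿ → ℝ` to `A`. -/
def graphFunOn {n : ℕ} (f : (Fin n → ℝ) → ℝ) (A : Set (Fin n → ℝ)) :
    Set (Option (Fin n) → ℝ) :=
  {z | (fun i => z (some i)) ∈ A ∧ z none = f (fun i => z (some i))}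

/-- The graph of the restriction of `φ : ℝⁿ → ℝᵐ` to `A`. -/
def graphMapOn {n m : ℕ} (φ : (Fin n → ℝ) → (Fin m → ℝ)) (A : Set (Fin n → ℝ)) :
    Set (Fin n ⊕ Fin m → ℝ) :=
  {z | (fun i => z (Sum.inl i)) ∈ A ∧
       (fun j => z (Sum.inr j)) = φ (fun i => z (Sum.inl i))}

/-- `A` and `B` are semialgebraically homeomorphic: there is a semialgebraic
bijection between them, continuous with continuous inverse. -/
def IsSemialgHomeo {n : ℕ} (A B : Set (Fin n → ℝ)) : Prop :=
  ∃ φ ψ : (Fin n → ℝ) → (Fin n → ℝ),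
    Set.MapsTo φ A B ∧ Set.MapsTo ψ B A ∧
    (∀ x ∈ A, ψ (φ x) = x) ∧ (∀ y ∈ B, φ (ψ y) = y) ∧
    ContinuousOn φ A ∧ ContinuousOn ψ B ∧
    IsRSA (Fin n ⊕ Fin n) (graphMapOn φ A) ∧ IsRSA (Fin n ⊕ Fin n) (graphMapOn ψ B)


section
open Polynomial

lemma sign_eq_of_no_root {q : ℝ → ℝ} (hq : Continuous q) {s t : ℝ}
    (h : ∀ c ∈ Set.uIcc s t, q c ≠ 0) : SignType.sign (q s) = SignType.sign (q t) := by
  have key : ∀ y, y ∈ Set.uIcc (q s) (q t) → ∃ c ∈ Set.uIcc s t, q c = y := by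
    intro y hy
    exact intermediate_value_uIcc hq.continuousOn hy
  have hs := h s Set.left_mem_uIcc
  have ht := h t Set.right_mem_uIcc
  rcases lt_or_gt_of_ne hs with h1 | h1 <;> rcases lt_or_gt_of_ne ht with h2 | h2
  · rw [sign_neg h1, sign_neg h2]
  · obtain ⟨c, hc, h0⟩ := key 0 (by rw [Set.mem_uIcc]; left; exact ⟨h1.le, h2.le⟩)
    exact absurd h0 (h c hc)
  · obtain ⟨c, hc, h0⟩ := key 0 (by rw [Set.mem_uIcc]; right; exact ⟨h2.le, h1.le⟩)
    exact absurd h0 (h c hc)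
  · rw [sign_pos h1, sign_pos h2]

/-- order isomorphism of the line supported in `(p,q)` moving `s` to `s'`. -/
lemma exists_move {p q s s' : ℝ} (h1 : p < s) (h2 : s < q) (h3 : p < s') (h4 : s' < q) :
    ∃ κ : ℝ ≃o ℝ, (∀ t, ¬ (p < t ∧ t < q) → κ t = t) ∧ κ s = s' := by
  let f : ℝ → ℝ := fun t => if t ≤ p then t else if t ≤ s then p + (t - p) * ((s' - p) / (s - p))
    else if t ≤ q then q - (q - t) * ((q - s') / (q - s)) else t
  have a1 : 0 < (s' - p) / (s - p) := div_pos (by linarith) (by linarith)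
  have a2 : 0 < (q - s') / (q - s) := div_pos (by linarith) (by linarith)
  have e1 : (s - p) * ((s' - p) / (s - p)) = s' - p := by
    field_simp [sub_ne_zero.mpr h1.ne']
  have e2 : (q - s) * ((q - s') / (q - s)) = q - s' := by
    field_simp [sub_ne_zero.mpr h2.ne']
  set A := (s' - p) / (s - p)
  set B := (q - s') / (q - s)
  have hmono : StrictMono f := by
    intro x y hxy
    simp only [f]
    split_ifs <;> nlinarith
  have hsurj : Function.Surjective f := by
    intro y
    by_cases c1 : y ≤ p
    · exact ⟨y, by simp [f, c1]⟩
    by_cases c2 : y ≤ s'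
    · refine ⟨p + (y - p) / A, ?_⟩
      have b1 : 0 < (y - p) / A := div_pos (by linarith) a1
      have b2 : (y - p) / A ≤ s - p := by rw [div_le_iff₀ a1]; linarith
      simp only [f]
      rw [if_neg (by linarith), if_pos (by linarith)]
      field_simp; ring
    by_cases c3 : y ≤ q
    · refine ⟨q - (q - y) / B, ?_⟩
      have b1 : 0 ≤ (q - y) / B := div_nonneg (by linarith) a2.le
      have b2 : (q - y) / B < q - s := by rw [div_lt_iff₀ a2]; linarith
      simp only [f]
      rw [if_neg (by linarith), if_neg (by linarith), if_pos (by linarith)]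
      field_simp; ring
    · refine ⟨y, ?_⟩
      simp only [f]
      rw [if_neg c1, if_neg (by linarith), if_neg c3]
  refine ⟨hmono.orderIsoOfSurjective f hsurj, ?_, ?_⟩
  · intro t ht
    simp only [StrictMono.coe_orderIsoOfSurjective, f]
    by_cases c : t ≤ p
    · rw [if_pos c]
    · have : q ≤ t := by by_contra h; exact ht ⟨by linarith, by linarith⟩
      rw [if_neg c, if_neg (by linarith)]
      split_ifs with h5
      · have : t = q := le_antisymm h5 this
        subst this; simp
      · rfl
  · simp only [StrictMono.coe_orderIsoOfSurjective, f]
    rw [if_neg (by linarith), if_pos le_rfl, e1]; ring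

/-- the gap sign lemma -/
lemma gap_sign {u v : ℝ → ℝ} (hu : Continuous u) {θ : ℝ ≃o ℝ} {p q : ℝ}
    (hm : StrictMonoOn u (Set.Icc p q)) (hm' : StrictMonoOn v (Set.Icc (θ p) (θ q)))
    (hp : SignType.sign (u p) = SignType.sign (v (θ p)))
    (hq : SignType.sign (u q) = SignType.sign (v (θ q)))
    (hz : ∀ z, p < z → z < q → u z = 0 → v (θ z) = 0) {t : ℝ} (h1 : p < t) (h2 : t < q) :
    SignType.sign (u t) = SignType.sign (v (θ t)) := by
  have mem : ∀ {c}, p ≤ c → c ≤ q → c ∈ Set.Icc p q := fun a b => ⟨a, b⟩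
  have mem' : ∀ {c}, p ≤ c → c ≤ q → θ c ∈ Set.Icc (θ p) (θ q) :=
    fun a b => ⟨θ.monotone a, θ.monotone b⟩
  have hpq : p ≤ q := by linarith
  by_cases hr : ∃ z, p < z ∧ z < q ∧ u z = 0
  · obtain ⟨z, z1, z2, z0⟩ := hr
    have vz := hz z z1 z2 z0
    rcases lt_trichotomy t z with h | h | h
    · have e1 := hm (mem h1.le h2.le) (mem z1.le z2.le) h
      have e2 := hm' (mem' h1.le h2.le) (mem' z1.le z2.le) (θ.strictMono h)
      rw [sign_neg (by linarith), sign_neg (by linarith)]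
    · subst h; rw [z0, vz]
    · have e1 := hm (mem z1.le z2.le) (mem h1.le h2.le) h
      have e2 := hm' (mem' z1.le z2.le) (mem' h1.le h2.le) (θ.strictMono h)
      rw [sign_pos (by linarith), sign_pos (by linarith)]
  · have e1 := hm (mem le_rfl hpq) (mem h1.le h2.le) h1
    have e2 := hm' (mem' le_rfl hpq) (mem' h1.le h2.le) (θ.strictMono h1)
    have e3 := hm (mem h1.le h2.le) (mem hpq le_rfl) h2
    have e4 := hm' (mem' h1.le h2.le) (mem' hpq le_rfl) (θ.strictMono h2)
    by_cases c : 0 ≤ u p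
    · have : 0 ≤ v (θ p) := by
        rw [← sign_nonneg_iff, ← hp, sign_nonneg_iff]; exact c
      rw [sign_pos (by linarith), sign_pos (by linarith)]
    · push Not at c
      have c2 : u q ≤ 0 := by
        by_contra hh
        push Not at hh
        obtain ⟨z, hz1, hz2⟩ := intermediate_value_Ioo hpq hu.continuousOn ⟨c, hh⟩
        exact hr ⟨z, hz1.1, hz1.2, hz2⟩
      have : v (θ q) ≤ 0 := by
        rw [← sign_nonpos_iff, ← hq, sign_nonpos_iff]; exact c2
      rw [sign_neg (by linarith), sign_neg (by linarith)]

lemma exists_gap (B : Finset ℝ) {t lo hi : ℝ} (hlo : lo ∈ B) (hhi : hi ∈ B) (h1 : lo < t)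
    (h2 : t < hi) (ht : t ∉ B) : ∃ p ∈ B, ∃ q ∈ B, p < t ∧ t < q ∧ ∀ b ∈ B, ¬ (p < b ∧ b < q) := by
  have n1 : (B.filter (· < t)).Nonempty := ⟨lo, by simp [hlo, h1]⟩
  have n2 : (B.filter (t < ·)).Nonempty := ⟨hi, by simp [hhi, h2]⟩
  have m1 := Finset.max'_mem _ n1
  have m2 := Finset.min'_mem _ n2
  rw [Finset.mem_filter] at m1 m2
  refine ⟨_, m1.1, _, m2.1, m1.2, m2.2, ?_⟩
  rintro b hb ⟨b1, b2⟩
  rcases lt_trichotomy b t with h | h | h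
  · exact absurd (Finset.le_max' (B.filter (· < t)) b (by simp [hb, h])) (not_le.mpr b1)
  · exact ht (h ▸ hb)
  · exact absurd (Finset.min'_le (B.filter (t < ·)) b (by simp [hb, h])) (not_le.mpr b2)

lemma modify {u v : ℝ → ℝ} (hu : Continuous u) (hv : Continuous v) (hfin : {z | u z = 0}.Finite)
    (θ : ℝ ≃o ℝ) (B : Finset ℝ)
    (H1 : ∀ b ∈ B, SignType.sign (u b) = SignType.sign (v (θ b)))
    (H2 : ∀ p q, p < q → (∀ b ∈ B, ¬ (p < b ∧ b < q)) →
      (StrictMonoOn u (Set.Icc p q) ∧ StrictMonoOn v (Set.Icc (θ p) (θ q))) ∨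
      (StrictAntiOn u (Set.Icc p q) ∧ StrictAntiOn v (Set.Icc (θ p) (θ q))))
    (H3 : ∃ N, ∀ t s, N ≤ t → N ≤ s → SignType.sign (u t) = SignType.sign (v s))
    (H4 : ∃ N, ∀ t s, t ≤ N → s ≤ N → SignType.sign (u t) = SignType.sign (v s)) :
    ∃ θ' : ℝ ≃o ℝ, (∀ b ∈ B, θ' b = θ b) ∧
      ∀ t, SignType.sign (u t) = SignType.sign (v (θ' t)) := by
  obtain ⟨N, hN⟩ := H3
  obtain ⟨N', hN'⟩ := H4
  obtain ⟨hi, hi1⟩ : ∃ hi, N ≤ hi ∧ N ≤ θ hi ∧ 1 ≤ hi :=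
    ⟨max (max N (θ.symm N)) 1, by simp, by rw [← θ.symm_apply_le]; simp, by simp⟩
  obtain ⟨lo, lo1⟩ : ∃ lo, lo ≤ N' ∧ θ lo ≤ N' ∧ lo ≤ 0 :=
    ⟨min (min N' (θ.symm N')) 0, by simp, by rw [← θ.le_symm_apply]; simp, by simp⟩
  have sgn_hi : ∀ t s, hi ≤ t → θ hi ≤ s → SignType.sign (u t) = SignType.sign (v s) :=
    fun t s a b => hN t s (by linarith) (by linarith)
  have sgn_lo : ∀ t s, t ≤ lo → s ≤ θ lo → SignType.sign (u t) = SignType.sign (v s) :=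
    fun t s a b => hN' t s (by linarith) (by linarith)
  set B1 : Finset ℝ := insert lo (insert hi B) with hB1
  have hlo : lo ∈ B1 := by simp [hB1]
  have hhi : hi ∈ B1 := by simp [hB1]
  have H1' : ∀ b ∈ B1, SignType.sign (u b) = SignType.sign (v (θ b)) := by
    intro b hb
    simp only [hB1, Finset.mem_insert] at hb
    rcases hb with rfl | rfl | hb
    · exact sgn_lo _ _ le_rfl le_rfl
    · exact sgn_hi _ _ le_rfl le_rfl
    · exact H1 b hb
  have H2' : ∀ p q, p < q → (∀ b ∈ B1, ¬ (p < b ∧ b < q)) →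
      (StrictMonoOn u (Set.Icc p q) ∧ StrictMonoOn v (Set.Icc (θ p) (θ q))) ∨
      (StrictAntiOn u (Set.Icc p q) ∧ StrictAntiOn v (Set.Icc (θ p) (θ q))) :=
    fun p q hpq h => H2 p q hpq (fun b hb => h b (by simp [hB1, hb]))
  have main : ∀ W : Finset ℝ, (∀ z ∈ W, u z = 0 ∧ z ∉ B1 ∧ lo < z ∧ z < hi) →
      ∃ θ' : ℝ ≃o ℝ, (∀ b ∈ B1, θ' b = θ b) ∧ ∀ z ∈ W, v (θ' z) = 0 := by
    intro W
    induction W using Finset.induction with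
    | empty => intro _; exact ⟨θ, fun _ _ => rfl, by simp⟩
    | insert z W hzW ih =>
      intro hW
      obtain ⟨θ', t1, t2⟩ := ih (fun z hz => hW z (Finset.mem_insert_of_mem hz))
      obtain ⟨z0, zB, zl, zh⟩ := hW z (Finset.mem_insert_self _ _)
      obtain ⟨p, hp, q, hq, pz, zq, hgap⟩ := exists_gap B1 hlo hhi zl zh zB
      have hpq : p < q := pz.trans zq
      have inj : Set.InjOn u (Set.Icc p q) := by
        rcases H2' p q hpq hgap with h | h
        · exact h.1.injOn
        · exact h.1.injOn
      have hroot : ∃ s' ∈ Set.Ioo (θ p) (θ q), v s' = 0 := by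
        have mp : p ∈ Set.Icc p q := ⟨le_rfl, hpq.le⟩
        have mq : q ∈ Set.Icc p q := ⟨hpq.le, le_rfl⟩
        have mz : z ∈ Set.Icc p q := ⟨pz.le, zq.le⟩
        have tpq : θ p ≤ θ q := θ.monotone hpq.le
        rcases H2' p q hpq hgap with h | h
        · have b1 := h.1 mp mz pz
          have b2 := h.1 mz mq zq
          rw [z0] at b1 b2
          have c1 : v (θ p) < 0 := by
            rw [← sign_eq_neg_one_iff, ← H1' p hp, sign_eq_neg_one_iff]; exact b1
          have c2 : 0 < v (θ q) := by
            rw [← sign_eq_one_iff, ← H1' q hq, sign_eq_one_iff]; exact b2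
          exact intermediate_value_Ioo tpq hv.continuousOn ⟨c1, c2⟩
        · have b1 := h.1 mp mz pz
          have b2 := h.1 mz mq zq
          rw [z0] at b1 b2
          have c1 : v (θ q) < 0 := by
            rw [← sign_eq_neg_one_iff, ← H1' q hq, sign_eq_neg_one_iff]; exact b2
          have c2 : 0 < v (θ p) := by
            rw [← sign_eq_one_iff, ← H1' p hp, sign_eq_one_iff]; exact b1
          exact intermediate_value_Ioo' tpq hv.continuousOn ⟨c1, c2⟩
      obtain ⟨s', hs', vs'⟩ := hroot
      have k1 : θ p < θ' z := by rw [← t1 p hp]; exact θ'.strictMono pz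
      have k2 : θ' z < θ q := by rw [← t1 q hq]; exact θ'.strictMono zq
      obtain ⟨κ, κ1, κ2⟩ := exists_move k1 k2 hs'.1 hs'.2
      refine ⟨θ'.trans κ, ?_, ?_⟩
      · intro b hb
        rw [OrderIso.trans_apply, t1 b hb]
        apply κ1
        rintro ⟨a1, a2⟩
        exact hgap b hb ⟨θ.lt_iff_lt.mp a1, θ.lt_iff_lt.mp a2⟩
      · intro y hy
        rw [OrderIso.trans_apply]
        rcases Finset.mem_insert.mp hy with rfl | hy
        · rw [κ2, vs']
        · rw [κ1, t2 y hy]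
          rw [← t1 p hp, ← t1 q hq]
          rintro ⟨a1, a2⟩
          have y1 := θ'.lt_iff_lt.mp a1
          have y2 := θ'.lt_iff_lt.mp a2
          have : y = z := inj ⟨y1.le, y2.le⟩ ⟨pz.le, zq.le⟩
            (by rw [z0, (hW y (Finset.mem_insert_of_mem hy)).1])
          exact hzW (this ▸ hy)
  obtain ⟨θ', t1, t2⟩ := main (hfin.toFinset.filter (fun z => z ∉ B1 ∧ lo < z ∧ z < hi)) (by
    intro z hz
    simp only [Finset.mem_filter, Set.Finite.mem_toFinset, Set.mem_ofPred_eq] at hz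
    exact hz)
  refine ⟨θ', fun b hb => t1 b (by simp [hB1, hb]), ?_⟩
  intro t
  by_cases htB : t ∈ B1
  · rw [t1 t htB]; exact H1' t htB
  rcases le_or_gt hi t with c | c
  · exact sgn_hi _ _ c (by rw [← t1 hi hhi]; exact θ'.monotone c)
  rcases le_or_gt t lo with c' | c'
  · exact sgn_lo _ _ c' (by rw [← t1 lo hlo]; exact θ'.monotone c')
  obtain ⟨p, hp, q, hq, pz, zq, hgap⟩ := exists_gap B1 hlo hhi c' c htB
  have hpq := pz.trans zq
  have hz : ∀ z, p < z → z < q → u z = 0 → v (θ' z) = 0 := by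
    intro z z1 z2 z0
    have zB : z ∉ B1 := fun h => hgap z h ⟨z1, z2⟩
    have l1 : lo ≤ p := by
      by_contra h; push Not at h
      exact hgap lo hlo ⟨h, c'.trans zq⟩
    have l2 : q ≤ hi := by
      by_contra h; push Not at h
      exact hgap hi hhi ⟨pz.trans c, h⟩
    apply t2
    simp only [Finset.mem_filter, Set.Finite.mem_toFinset, Set.mem_ofPred_eq]
    exact ⟨z0, zB, by linarith, by linarith⟩
  have sp := H1' p hp
  have sq := H1' q hq
  have hm := H2' p q hpq hgap
  rw [← t1 p hp, ← t1 q hq] at hm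
  rw [← t1 p hp] at sp
  rw [← t1 q hq] at sq
  rcases hm with h | h
  · exact gap_sign hu h.1 h.2 sp sq hz pz zq
  · have := gap_sign (u := fun x => - u x) (v := fun x => - v x) hu.neg (θ := θ') (p := p) (q := q)
      h.1.neg h.2.neg
      (by rw [Left.sign_neg, Left.sign_neg, sp]) (by rw [Left.sign_neg, Left.sign_neg, sq])
      (fun z a b c => by rw [hz z a b (by simpa using c)]; simp) pz zq
    rw [Left.sign_neg, Left.sign_neg] at this
    exact neg_injective this
end

section
open Polynomial

/-- simultaneous sign matching of one polynomial along an order isomorphism -/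
def PM {R : Type*} [CommRing R] (φ ψ : R →+* ℝ) (θ : ℝ ≃o ℝ) (p : R[X]) : Prop :=
  ∀ t, SignType.sign (eval₂ φ t p) = SignType.sign (eval₂ ψ (θ t) p)

lemma pseudo_rem {R : Type*} [CommRing R] (f : R[X]) (hf : 0 < f.natDegree) (n : ℕ) :
    ∀ p : R[X], p.natDegree ≤ n → ∃ (e : ℕ) (q r : R[X]), C (f.leadingCoeff) ^ e * p = q * f + r ∧
      r.natDegree < f.natDegree := by
  induction n with
  | zero => intro p hp; exact ⟨0, 0, p, by simp, by omega⟩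
  | succ n ih =>
    intro p hp
    by_cases h : p.natDegree < f.natDegree
    · exact ⟨0, 0, p, by simp, h⟩
    · push Not at h
      have h1 := natDegree_cancelLeads_lt_of_natDegree_le_natDegree h (by omega)
      obtain ⟨e, q, r, h2, h3⟩ := ih (f.cancelLeads p) (by omega)
      refine ⟨e + 1, C f.leadingCoeff ^ e * (C p.leadingCoeff * X ^ (p.natDegree - f.natDegree)) + q,
        r, ?_, h3⟩
      have : C f.leadingCoeff * p = f.cancelLeads p +
          (C p.leadingCoeff * X ^ (p.natDegree - f.natDegree)) * f := by
        rw [cancelLeads]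
        have : f.natDegree - p.natDegree = 0 := by omega
        rw [this]; ring
      rw [pow_succ, mul_assoc, this, mul_add, h2]; ring

lemma chain_lemma {R : Type*} [CommRing R] (p : R[X]) (m : ℕ) (k : ℕ) :
    ∀ f : R[X], f.natDegree ≤ m → f.support.card ≤ k → ∃ (G : Finset R) (L : Finset R[X]),
      (∀ r ∈ L, r.natDegree < m) ∧ ∀ (φ ψ : R →+* ℝ) (θ : ℝ ≃o ℝ),
        (∀ g ∈ G, SignType.sign (φ g) = SignType.sign (ψ g)) → (∀ r ∈ L, PM φ ψ θ r) →
        PM φ ψ θ f → ∀ c, f.map φ ≠ 0 → eval₂ φ c f = 0 →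
        SignType.sign (eval₂ φ c p) = SignType.sign (eval₂ ψ (θ c) p) := by
  induction k with
  | zero =>
    intro f _ hk
    refine ⟨∅, ∅, by simp, ?_⟩
    intro φ ψ θ _ _ _ c h
    exfalso; apply h
    have : f = 0 := by simpa using hk
    simp [this]
  | succ k ih =>
    intro f hfm hk
    by_cases hf0 : f = 0
    · exact ⟨∅, ∅, by simp, fun φ ψ θ _ _ _ c h => absurd (by simp [hf0]) h⟩
    have hlt := eraseLead_support_card_lt hf0
    obtain ⟨G, L, hL, H⟩ := ih f.eraseLead ((eraseLead_natDegree_le_aux).trans hfm) (by omega)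
    by_cases hd : 0 < f.natDegree
    · obtain ⟨e, q, r, h1, h2⟩ := pseudo_rem f hd _ p le_rfl
      refine ⟨insert f.leadingCoeff G, insert (C (f.leadingCoeff) ^ e * r) L, ?_, ?_⟩
      · intro r' hr'
        rcases Finset.mem_insert.mp hr' with rfl | h
        · rw [← C_pow]
          exact lt_of_le_of_lt (natDegree_C_mul_le _ _) (by omega)
        · exact hL _ h
      · intro φ ψ θ hG hLm hPf c hne hc
        have hs := hG f.leadingCoeff (by simp)
        by_cases hz : φ f.leadingCoeff = 0
        · have hz' : ψ f.leadingCoeff = 0 := by rw [hz, sign_zero] at hs; exact sign_eq_zero_iff.mp hs.symm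
          have ee : ∀ (χ : R →+* ℝ), χ f.leadingCoeff = 0 → f.map χ = f.eraseLead.map χ := by
            intro χ hχ
            have := congrArg (Polynomial.map χ) (eraseLead_add_C_mul_X_pow f)
            rw [Polynomial.map_add, Polynomial.map_mul, map_C, hχ, C_0, zero_mul, add_zero] at this
            exact this.symm
          have e1 := ee φ hz
          have e2 := ee ψ hz'
          have e1' : ∀ t, eval₂ φ t f = eval₂ φ t f.eraseLead := fun t => by
            rw [← eval_map, ← eval_map, e1]
          have e2' : ∀ t, eval₂ ψ t f = eval₂ ψ t f.eraseLead := fun t => by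
            rw [← eval_map, ← eval_map, e2]
          refine H φ ψ θ (fun g hg => hG g (by simp [hg])) (fun r hr => hLm r (by simp [hr])) ?_ c
            (e1 ▸ hne) (by rw [← e1', hc])
          intro t; rw [← e1', ← e2']; exact hPf t
        · have hz' : ψ f.leadingCoeff ≠ 0 := by
            intro h; rw [h, sign_zero] at hs; exact hz (sign_eq_zero_iff.mp hs)
          have hc' : eval₂ ψ (θ c) f = 0 := by
            have := hPf c; rw [hc, sign_zero] at this; exact sign_eq_zero_iff.mp this.symm
          have hr := hLm _ (Finset.mem_insert_self _ _) c
          have key : ∀ (χ : R →+* ℝ) s, eval₂ χ s f = 0 → χ f.leadingCoeff ≠ 0 →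
              SignType.sign (eval₂ χ s p) = SignType.sign (eval₂ χ s (C (f.leadingCoeff) ^ e * r)) := by
            intro χ s h0 hne
            have := congrArg (eval₂ χ s) h1
            rw [eval₂_add, eval₂_mul, eval₂_mul, h0, mul_zero, zero_add] at this
            rw [eval₂_mul, ← this, ← mul_assoc, eval₂_pow, eval₂_C, sign_mul,
              sign_pos (mul_self_pos.mpr (pow_ne_zero e hne)), one_mul]
          rw [key φ c hc hz, key ψ _ hc' hz', hr]
    · refine ⟨∅, ∅, by simp, ?_⟩
      intro φ ψ θ _ _ _ c hne hc
      exfalso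
      rw [eq_C_of_natDegree_eq_zero (by omega : f.natDegree = 0)] at hne hc
      simp at hne hc
      exact hne hc

lemma top_sign0 (P : ℝ[X]) (h : P.leadingCoeff ≠ 0) (hd : 0 < P.natDegree) : ∃ N, ∀ t, N ≤ t →
      SignType.sign (P.eval t) = SignType.sign P.leadingCoeff := by
  have hdeg : 0 < P.degree := natDegree_pos_iff_degree_pos.mp hd
  rcases lt_or_gt_of_ne h with h' | h'
  · have := P.tendsto_atBot_of_leadingCoeff_nonpos hdeg h'.le
    obtain ⟨N, hN⟩ := (this.eventually (eventually_lt_atBot 0)).exists_forall_of_atTop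
    exact ⟨N, fun t ht => by rw [sign_neg (hN t ht), sign_neg h']⟩
  · have := P.tendsto_atTop_of_leadingCoeff_nonneg hdeg h'.le
    obtain ⟨N, hN⟩ := (this.eventually (eventually_gt_atTop 0)).exists_forall_of_atTop
    exact ⟨N, fun t ht => by rw [sign_pos (hN t ht), sign_pos h']⟩

lemma bot_sign0 (P : ℝ[X]) (h : P.leadingCoeff ≠ 0) (hd : 0 < P.natDegree) : ∃ N, ∀ t, t ≤ N →
      SignType.sign (P.eval t) = SignType.sign ((-1) ^ P.natDegree * P.leadingCoeff) := by
  have hX : (-X : ℝ[X]).natDegree = 1 := by simp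
  have e1 : (P.comp (-X)).leadingCoeff = (-1) ^ P.natDegree * P.leadingCoeff := by
    rw [leadingCoeff_comp (by rw [hX]; norm_num)]; simp [mul_comm]
  have e2 : (P.comp (-X)).natDegree = P.natDegree := by rw [natDegree_comp, hX, mul_one]
  obtain ⟨N, hN⟩ := top_sign0 (P.comp (-X)) (by rw [e1]; simpa using h) (by omega)
  refine ⟨-N, fun t ht => ?_⟩
  have := hN (-t) (by linarith)
  rw [e1] at this; simpa using this

lemma end_signs {R : Type*} [CommRing R] (p : R[X]) (φ ψ : R →+* ℝ)
    (hs : SignType.sign (φ p.leadingCoeff) = SignType.sign (ψ p.leadingCoeff))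
    (hz : φ p.leadingCoeff ≠ 0) (hd : 0 < p.natDegree) :
    (∃ N, ∀ t s, N ≤ t → N ≤ s → SignType.sign (eval₂ φ t p) = SignType.sign (eval₂ ψ s p)) ∧
    (∃ N, ∀ t s, t ≤ N → s ≤ N → SignType.sign (eval₂ φ t p) = SignType.sign (eval₂ ψ s p)) := by
  have hz' : ψ p.leadingCoeff ≠ 0 := by
    intro h; rw [h, sign_zero] at hs; exact hz (sign_eq_zero_iff.mp hs)
  have l1 : (p.map φ).leadingCoeff = φ p.leadingCoeff := leadingCoeff_map_of_leadingCoeff_ne_zero _ hz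
  have l2 : (p.map ψ).leadingCoeff = ψ p.leadingCoeff := leadingCoeff_map_of_leadingCoeff_ne_zero _ hz'
  have d1 : (p.map φ).natDegree = p.natDegree := natDegree_map_of_leadingCoeff_ne_zero _ hz
  have d2 : (p.map ψ).natDegree = p.natDegree := natDegree_map_of_leadingCoeff_ne_zero _ hz'
  constructor
  · obtain ⟨N1, h1⟩ := top_sign0 (p.map φ) (l1 ▸ hz) (by omega)
    obtain ⟨N2, h2⟩ := top_sign0 (p.map ψ) (l2 ▸ hz') (by omega)
    exact ⟨max N1 N2, fun t s ht hs' => by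
      rw [← eval_map, ← eval_map, h1 t (le_trans (le_max_left _ _) ht),
        h2 s (le_trans (le_max_right _ _) hs'), l1, l2, hs]⟩
  · obtain ⟨N1, h1⟩ := bot_sign0 (p.map φ) (l1 ▸ hz) (by omega)
    obtain ⟨N2, h2⟩ := bot_sign0 (p.map ψ) (l2 ▸ hz') (by omega)
    exact ⟨min N1 N2, fun t s ht hs' => by
      rw [← eval_map, ← eval_map, h1 t (le_trans ht (min_le_left _ _)),
        h2 s (le_trans hs' (min_le_right _ _)), l1, l2, d1, d2, sign_mul, sign_mul, hs]⟩

/-- The main combinatorial step. -/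
lemma step_core {R : Type*} [CommRing R] (p : R[X]) (φ ψ : R →+* ℝ) (hd : 0 < p.natDegree)
    (hs : SignType.sign (φ p.leadingCoeff) = SignType.sign (ψ p.leadingCoeff))
    (hz : φ p.leadingCoeff ≠ 0) (A : Finset R[X]) (hA : derivative p ∈ A) (θ : ℝ ≃o ℝ)
    (hθ : ∀ f ∈ A, PM φ ψ θ f)
    (hroot : ∀ f ∈ A, ∀ c, f.map φ ≠ 0 → eval₂ φ c f = 0 →
        SignType.sign (eval₂ φ c p) = SignType.sign (eval₂ ψ (θ c) p)) :
    ∃ θ' : ℝ ≃o ℝ, PM φ ψ θ' p ∧ ∀ f ∈ A, PM φ ψ θ' f := by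
  have hcont : ∀ (χ : R →+* ℝ) (f : R[X]), Continuous fun t => eval₂ χ t f := by
    intro χ f; simp only [← eval_map]; exact (f.map χ).continuous
  let B : Finset ℝ := A.biUnion fun f => (f.map φ).roots.toFinset
  have hB : ∀ f ∈ A, f.map φ ≠ 0 → ∀ c, eval₂ φ c f = 0 → c ∈ B := by
    intro f hf hne c hc
    refine Finset.mem_biUnion.mpr ⟨f, hf, ?_⟩
    rw [Multiset.mem_toFinset, mem_roots hne, IsRoot, eval_map, hc]
  have hB' : ∀ b ∈ B, ∃ f ∈ A, f.map φ ≠ 0 ∧ eval₂ φ b f = 0 := by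
    intro b hb
    obtain ⟨f, hf, hb⟩ := Finset.mem_biUnion.mp hb
    rw [Multiset.mem_toFinset, mem_roots'] at hb
    exact ⟨f, hf, hb.1, by rw [← eval_map]; exact hb.2⟩
  have hp0 : p.map φ ≠ 0 := by
    intro h
    have := congrArg (fun q => coeff q p.natDegree) h
    simp only [coeff_map, coeff_zero] at this
    exact hz this
  have hp' : (derivative p).map φ ≠ 0 := by
    rw [← derivative_map]
    intro h
    have := derivative_eq_zero.mp h
    rw [natDegree_map_of_leadingCoeff_ne_zero _ hz] at this
    omega
  have hzero : ∀ f ∈ A, f.map φ = 0 → ∀ t, eval₂ ψ t f = 0 := by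
    intro f hf h0 t
    have := hθ f hf (θ.symm t)
    rw [← eval_map, h0, eval_zero, sign_zero, θ.apply_symm_apply] at this
    exact sign_eq_zero_iff.mp this.symm
  obtain ⟨e1, e2⟩ := end_signs p φ ψ hs hz hd
  have hder : ∀ (χ : R →+* ℝ) t, deriv (fun t => eval₂ χ t p) t = eval₂ χ t (derivative p) := by
    intro χ t
    simp only [← eval_map, ← derivative_map]
    exact (p.map χ).deriv
  obtain ⟨θ', h1, h2⟩ := modify (hcont φ p) (hcont ψ p)
    (by
      have := (p.map φ).roots.toFinset.finite_toSet
      refine this.subset ?_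
      intro z hz
      simp only [Finset.mem_coe, Multiset.mem_toFinset, mem_roots hp0, IsRoot, eval_map]
      exact hz) θ B
    (by
      intro b hb
      obtain ⟨f, hf, h1, h2⟩ := hB' b hb
      exact hroot f hf b h1 h2)
    (by
      intro s q hsq hnb
      have nr : ∀ c, s < c → c < q → eval₂ φ c (derivative p) ≠ 0 := fun c h1 h2 h0 =>
        hnb c (hB _ hA hp' c h0) ⟨h1, h2⟩
      set mid := (s + q) / 2
      have sg : ∀ c, s < c → c < q → SignType.sign (eval₂ φ c (derivative p)) =
          SignType.sign (eval₂ φ mid (derivative p)) := by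
        intro c h1 h2
        apply sign_eq_of_no_root (hcont φ (derivative p))
        intro d hd
        have hm1 : s < mid := by simp only [mid]; linarith
        have hm2 : mid < q := by simp only [mid]; linarith
        have := Set.uIcc_subset_Icc (a₂ := min c mid) (b₂ := max c mid)
          ⟨min_le_left c mid, le_max_left _ _⟩ ⟨min_le_right _ _, le_max_right _ _⟩ hd
        exact nr d (lt_of_lt_of_le (lt_min h1 hm1) this.1) (lt_of_le_of_lt this.2 (max_lt h2 hm2))
      have sg' : ∀ c, θ s < c → c < θ q → SignType.sign (eval₂ ψ c (derivative p)) =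
          SignType.sign (eval₂ φ mid (derivative p)) := by
        intro c h1 h2
        have := hθ _ hA (θ.symm c)
        rw [θ.apply_symm_apply] at this
        rw [← this]
        exact sg _ (by rwa [OrderIso.lt_symm_apply]) (by rwa [OrderIso.symm_apply_lt])
      have hmid := nr mid (by simp only [mid]; linarith) (by simp only [mid]; linarith)
      rcases lt_or_gt_of_ne hmid with hm | hm
      · right
        constructor
        · refine strictAntiOn_of_deriv_neg (convex_Icc _ _) (hcont φ p).continuousOn ?_
          intro c hc; rw [interior_Icc] at hc
          rw [hder, ← sign_eq_neg_one_iff, sg c hc.1 hc.2, sign_neg hm]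
        · refine strictAntiOn_of_deriv_neg (convex_Icc _ _) (hcont ψ p).continuousOn ?_
          intro c hc; rw [interior_Icc] at hc
          rw [hder, ← sign_eq_neg_one_iff, sg' c hc.1 hc.2, sign_neg hm]
      · left
        constructor
        · refine strictMonoOn_of_deriv_pos (convex_Icc _ _) (hcont φ p).continuousOn ?_
          intro c hc; rw [interior_Icc] at hc
          rw [hder, ← sign_eq_one_iff, sg c hc.1 hc.2, sign_pos hm]
        · refine strictMonoOn_of_deriv_pos (convex_Icc _ _) (hcont ψ p).continuousOn ?_
          intro c hc; rw [interior_Icc] at hc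
          rw [hder, ← sign_eq_one_iff, sg' c hc.1 hc.2, sign_pos hm]) e1 e2
  refine ⟨θ', h2, ?_⟩
  intro f hf t
  by_cases hf0 : f.map φ = 0
  · rw [← eval_map, hf0, eval_zero, hzero f hf hf0]
  by_cases ht : t ∈ B
  · rw [h1 t ht]; exact hθ f hf t
  rw [hθ f hf t]
  apply sign_eq_of_no_root (hcont ψ f)
  intro c hc h0
  have hr : eval₂ φ (θ.symm c) f = 0 := by
    have := hθ f hf (θ.symm c)
    rw [θ.apply_symm_apply, h0, sign_zero] at this
    exact sign_eq_zero_iff.mp this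
  have hb := hB f hf hf0 _ hr
  have hb1 := h1 _ hb
  rw [θ.apply_symm_apply] at hb1
  rcases lt_trichotomy t (θ.symm c) with h | h | h
  · have a1 : θ t < c := by rwa [OrderIso.lt_symm_apply] at h
    have a2 : θ' t < c := by rw [← hb1]; exact θ'.strictMono h
    rw [Set.mem_uIcc] at hc
    rcases hc with hc | hc <;> linarith [hc.1, hc.2]
  · exact ht (h ▸ hb)
  · have a1 : c < θ t := by rwa [OrderIso.symm_apply_lt] at h
    have a2 : c < θ' t := by rw [← hb1]; exact θ'.strictMono h
    rw [Set.mem_uIcc] at hc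
    rcases hc with hc | hc <;> linarith [hc.1, hc.2]

def Good {R : Type*} [CommRing R] (F : Finset R[X]) : Prop :=
  ∃ G : Finset R, ∀ φ ψ : R →+* ℝ, (∀ g ∈ G, SignType.sign (φ g) = SignType.sign (ψ g)) →
    ∃ θ : ℝ ≃o ℝ, ∀ p ∈ F, PM φ ψ θ p

lemma Good.mono {R : Type*} [CommRing R] {F F' : Finset R[X]} (h : Good F) (hs : F' ⊆ F) : Good F' := by
  obtain ⟨G, hG⟩ := h
  exact ⟨G, fun φ ψ h => (hG φ ψ h).imp fun θ h p hp => h p (hs hp)⟩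

lemma good_step {R : Type*} [CommRing R] (m : ℕ)
    (ih : ∀ F : Finset R[X], (∀ p ∈ F, p.natDegree < m) → Good F) (T : Finset R[X]) :
    ∀ L : Finset R[X], (∀ p ∈ L, p.natDegree < m) → (∀ p ∈ T, p.natDegree ≤ m) → Good (L ∪ T) := by
  induction T using Finset.induction_on with
  | empty => intro L hL _; exact (ih L hL).mono (by simp)
  | insert p T' hp IH =>
    intro L hL hT
    have hT' : ∀ q ∈ T', q.natDegree ≤ m := fun q hq => hT q (Finset.mem_insert_of_mem hq)
    have hpm := hT p (Finset.mem_insert_self _ _)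
    by_cases hlt : p.natDegree < m
    · refine (IH (insert p L) ?_ hT').mono ?_
      · intro q hq; rcases Finset.mem_insert.mp hq with rfl | h
        · exact hlt
        · exact hL _ h
      · intro q; simp
    have hpm' : p.natDegree = m := by omega
    by_cases hm : m = 0
    · obtain ⟨G, hG⟩ := IH L hL hT'
      refine ⟨insert (p.coeff 0) G, fun φ ψ h => ?_⟩
      obtain ⟨θ, hθ⟩ := hG φ ψ fun g hg => h g (Finset.mem_insert_of_mem hg)
      refine ⟨θ, fun q hq => ?_⟩
      have hq' : q = p ∨ q ∈ L ∪ T' := by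
        simp only [Finset.mem_union, Finset.mem_insert] at hq ⊢; tauto
      rcases hq' with rfl | hq'
      · intro t
        rw [eq_C_of_natDegree_eq_zero (by omega : q.natDegree = 0), eval₂_C, eval₂_C]
        exact h _ (Finset.mem_insert_self _ _)
      · exact hθ q hq'
    have hd : 0 < p.natDegree := by omega
    have hderd : (derivative p).natDegree < m := by
      rw [← hpm']; exact natDegree_derivative_lt (by omega)
    let A : Finset R[X] := insert (derivative p) (L ∪ T')
    have hAm : ∀ f ∈ A, f.natDegree ≤ m := by
      intro f hf
      simp only [A, Finset.mem_insert, Finset.mem_union] at hf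
      rcases hf with rfl | hf | hf
      · exact hderd.le
      · exact (hL f hf).le
      · exact hT' f hf
    have ch : ∀ f : R[X], ∃ (G : Finset R) (L : Finset R[X]),
      (∀ r ∈ L, r.natDegree < m) ∧ (f.natDegree ≤ m → ∀ (φ ψ : R →+* ℝ) (θ : ℝ ≃o ℝ),
        (∀ g ∈ G, SignType.sign (φ g) = SignType.sign (ψ g)) → (∀ r ∈ L, PM φ ψ θ r) →
        PM φ ψ θ f → ∀ c, f.map φ ≠ 0 → eval₂ φ c f = 0 →
        SignType.sign (eval₂ φ c p) = SignType.sign (eval₂ ψ (θ c) p)) := by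
      intro f
      by_cases hf : f.natDegree ≤ m
      · obtain ⟨G, L, h1, h2⟩ := chain_lemma p m _ f hf le_rfl
        exact ⟨G, L, h1, fun _ => h2⟩
      · exact ⟨∅, ∅, by simp, fun h => absurd h hf⟩
    choose Gc Lc hLc hch using ch
    let L' : Finset R[X] := insert (derivative p) (L ∪ A.biUnion Lc) ∪
      (if p.eraseLead.natDegree < m then {p.eraseLead} else ∅)
    have hL' : ∀ q ∈ L', q.natDegree < m := by
      intro q hq
      simp only [L', Finset.mem_insert, Finset.mem_union, Finset.mem_biUnion] at hq
      rcases hq with (rfl | hq | ⟨f, _, hq⟩) | hq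
      · exact hderd
      · exact hL q hq
      · exact hLc f q hq
      · split_ifs at hq with h
        · rw [Finset.mem_singleton] at hq; exact hq ▸ h
        · simp at hq
    have her : p.eraseLead.natDegree < m := by
      rcases eraseLead_natDegree_lt_or_eraseLead_eq_zero p with h | h
      · omega
      · rw [h, natDegree_zero]; omega
    obtain ⟨G, hG⟩ := IH L' hL' hT'
    refine ⟨insert p.leadingCoeff (G ∪ A.biUnion Gc), fun φ ψ h => ?_⟩
    obtain ⟨θ, hθ⟩ := hG φ ψ fun g hg => h g (by simp [hg])
    have hθA : ∀ f ∈ A, PM φ ψ θ f := by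
      intro f hf
      apply hθ
      simp only [A, L', Finset.mem_insert, Finset.mem_union] at hf ⊢
      tauto
    have hlc := h p.leadingCoeff (by simp)
    by_cases hz : φ p.leadingCoeff = 0
    · have hz' : ψ p.leadingCoeff = 0 := by rw [hz, sign_zero] at hlc; exact sign_eq_zero_iff.mp hlc.symm
      have ee : ∀ (χ : R →+* ℝ), χ p.leadingCoeff = 0 → ∀ t, eval₂ χ t p = eval₂ χ t p.eraseLead := by
        intro χ hχ t
        have := congrArg (eval₂ χ t) (eraseLead_add_C_mul_X_pow p)
        rw [eval₂_add, eval₂_mul, eval₂_C, hχ, zero_mul, add_zero] at this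
        exact this.symm
      refine ⟨θ, fun q hq => ?_⟩
      by_cases hqp : q = p
      · intro t; rw [hqp, ee φ hz, ee ψ hz']
        exact hθ _ (by simp [L', her]) t
      · apply hθA
        simp only [A, Finset.mem_insert, Finset.mem_union] at hq ⊢
        tauto
    · obtain ⟨θ', h1, h2⟩ := step_core p φ ψ hd hlc hz A (by simp [A]) θ hθA (by
        intro f hf
        refine hch f (hAm f hf) φ ψ θ (fun g hg => h g ?_) (fun r hr => hθ r ?_) (hθA f hf)
        · simp only [Finset.mem_insert, Finset.mem_union, Finset.mem_biUnion]
          exact Or.inr (Or.inr ⟨f, hf, hg⟩)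
        · simp only [L', Finset.mem_insert, Finset.mem_union, Finset.mem_biUnion]
          exact Or.inl (Or.inl (Or.inr (Or.inr ⟨f, hf, hr⟩))))
      refine ⟨θ', fun q hq => ?_⟩
      by_cases hqp : q = p
      · exact hqp ▸ h1
      · apply h2
        simp only [A, Finset.mem_insert, Finset.mem_union] at hq ⊢
        tauto

theorem TS_core {R : Type*} [CommRing R] (F : Finset R[X]) : Good F := by
  have key : ∀ m, ∀ F : Finset R[X], (∀ p ∈ F, p.natDegree < m) → Good F := by
    intro m
    induction m with
    | zero =>
      intro F hF
      exact ⟨∅, fun φ ψ _ => ⟨OrderIso.refl ℝ, fun p hp => absurd (hF p hp) (by omega)⟩⟩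
    | succ m ih =>
      intro F hF
      exact (good_step m ih F ∅ (by simp) (fun p hp => by have := hF p hp; omega)).mono (by simp)
  exact key (F.sup natDegree + 1) F fun p hp => Nat.lt_succ_of_le (Finset.le_sup (f := natDegree) hp)
end

section
/-- definable predicate -/
abbrev Dfn {ι : Type} (p : (ι → ℝ) → Prop) : Prop := IsRSA ι {x | p x}

def SSign {ι : Type} (G : Finset (MvPolynomial ι ℝ)) (x y : ι → ℝ) : Prop :=
  ∀ g ∈ G, SignType.sign (MvPolynomial.eval x g) = SignType.sign (MvPolynomial.eval y g)

lemma rsa_det {ι : Type} {S : Set (ι → ℝ)} (h : IsRSA ι S) :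
    ∃ G : Finset (MvPolynomial ι ℝ), ∀ x y, SSign G x y → (x ∈ S ↔ y ∈ S) := by
  induction h with
  | basic P =>
    refine ⟨{P}, fun x y h => ?_⟩
    have := h P (by simp)
    simp only [Set.mem_ofPred_eq]
    rw [← sign_eq_one_iff, ← sign_eq_one_iff, this]
  | compl _ ih =>
    obtain ⟨G, hG⟩ := ih
    exact ⟨G, fun x y h => not_congr (hG x y h)⟩
  | union _ _ ih1 ih2 =>
    obtain ⟨G, hG⟩ := ih1
    obtain ⟨G', hG'⟩ := ih2
    exact ⟨G ∪ G', fun x y h => or_congr (hG x y fun g hg => h g (by simp [hg]))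
      (hG' x y fun g hg => h g (by simp [hg]))⟩

section
variable {ι κ : Type}

lemma Dfn.not {p : (ι → ℝ) → Prop} (h : Dfn p) : Dfn fun x => ¬ p x := IsRSA.compl h
lemma Dfn.or {p q : (ι → ℝ) → Prop} (h : Dfn p) (h' : Dfn q) : Dfn fun x => p x ∨ q x :=
  IsRSA.union h h'
lemma Dfn.congr {p q : (ι → ℝ) → Prop} (h : Dfn p) (h' : ∀ x, q x ↔ p x) : Dfn q := by
  have : q = p := funext fun x => propext (h' x)
  rw [this]; exact h
lemma Dfn.and {p q : (ι → ℝ) → Prop} (h : Dfn p) (h' : Dfn q) : Dfn fun x => p x ∧ q x :=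
  (h.not.or h'.not).not.congr fun x => by tauto
lemma Dfn.imp {p q : (ι → ℝ) → Prop} (h : Dfn p) (h' : Dfn q) : Dfn fun x => p x → q x :=
  (h.not.or h').congr fun x => by tauto
lemma Dfn.iff {p q : (ι → ℝ) → Prop} (h : Dfn p) (h' : Dfn q) : Dfn fun x => (p x ↔ q x) :=
  ((h.imp h').and (h'.imp h)).congr fun x => by tauto
lemma Dfn.const (P : Prop) : Dfn fun _ : ι → ℝ => P := by
  have h1 : Dfn fun _ : ι → ℝ => False :=
    Dfn.congr (IsRSA.basic (0 : MvPolynomial ι ℝ)) (by simp)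
  by_cases h : P
  · exact h1.not.congr (by simp [h])
  · exact h1.congr (by simp [h])
lemma Dfn.allFin {α : Type*} {p : α → (ι → ℝ) → Prop} (s : Finset α) (h : ∀ a ∈ s, Dfn (p a)) :
    Dfn fun x => ∀ a ∈ s, p a x := by
  induction s using Finset.induction_on with
  | empty => exact (Dfn.const True).congr (by simp)
  | insert a s _ ih =>
    exact ((h a (by simp)).and (ih fun b hb => h b (by simp [hb]))).congr (by simp)
lemma Dfn.exFin {α : Type*} {p : α → (ι → ℝ) → Prop} (s : Finset α) (h : ∀ a ∈ s, Dfn (p a)) :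
    Dfn fun x => ∃ a ∈ s, p a x :=
  (Dfn.allFin s fun a ha => (h a ha).not).not.congr fun x => by push Not; rfl
lemma Dfn.allF {α : Type*} [Finite α] {p : α → (ι → ℝ) → Prop} (h : ∀ a, Dfn (p a)) :
    Dfn fun x => ∀ a, p a x := by
  cases nonempty_fintype α
  exact (Dfn.allFin Finset.univ fun a _ => h a).congr (by simp)
lemma Dfn.exF {α : Type*} [Finite α] {p : α → (ι → ℝ) → Prop} (h : ∀ a, Dfn (p a)) :
    Dfn fun x => ∃ a, p a x := by
  cases nonempty_fintype α
  exact (Dfn.exFin Finset.univ fun a _ => h a).congr (by simp)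

lemma Dfn.sgn (P : MvPolynomial ι ℝ) (s : SignType) :
    Dfn fun x => SignType.sign (MvPolynomial.eval x P) = s := by
  have hp : ∀ P : MvPolynomial ι ℝ, Dfn fun x => 0 < MvPolynomial.eval x P := IsRSA.basic
  have hn : Dfn fun x => MvPolynomial.eval x P < 0 := (hp (-P)).congr (by simp)
  cases s
  · refine ((hp P).or hn).not.congr fun x => ?_
    show _ = 0 ↔ _
    rw [sign_eq_zero_iff]
    constructor
    · intro h; simp [h]
    · intro h; push Not at h; exact le_antisymm h.1 h.2
  · exact hn.congr fun x => sign_eq_neg_one_iff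
  · exact (hp P).congr fun x => sign_eq_one_iff

lemma rsa_of_det {S : Set (ι → ℝ)} (h : ∃ G : Finset (MvPolynomial ι ℝ), ∀ x y, SSign G x y →
    (x ∈ S ↔ y ∈ S)) : IsRSA ι S := by
  obtain ⟨G, hG⟩ := h
  have : Dfn fun x => ∃ τ : G → SignType, (∃ y ∈ S, ∀ g : G, SignType.sign (MvPolynomial.eval y g.1) = τ g) ∧
      ∀ g : G, SignType.sign (MvPolynomial.eval x g.1) = τ g :=
    Dfn.exF fun τ => (Dfn.const _).and (Dfn.allF fun g => Dfn.sgn _ _)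
  refine Dfn.congr this fun x => ?_
  constructor
  · intro hx; exact ⟨_, ⟨x, hx, fun g => rfl⟩, fun g => rfl⟩
  · rintro ⟨τ, ⟨y, hy, h1⟩, h2⟩
    exact (hG x y fun g hg => (h2 ⟨g, hg⟩).trans (h1 ⟨g, hg⟩).symm).mpr hy

lemma Dfn.poly {S : Set (κ → ℝ)} (hS : IsRSA κ S) (u : κ → MvPolynomial ι ℝ) :
    Dfn fun x : ι → ℝ => (fun j => MvPolynomial.eval x (u j)) ∈ S := by
  induction hS with
  | basic P =>
    refine Dfn.congr (IsRSA.basic (MvPolynomial.bind₁ u P)) fun x => ?_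
    rw [Set.mem_ofPred_eq]
    have : MvPolynomial.eval x (MvPolynomial.bind₁ u P) =
        MvPolynomial.eval (fun j => MvPolynomial.eval x (u j)) P := by
      simp only [← MvPolynomial.coe_aeval_eq_eval]
      erw [MvPolynomial.aeval_bind₁]; rfl
    rw [this]
  | compl _ ih => exact Dfn.not ih
  | union _ _ ih1 ih2 => exact Dfn.or ih1 ih2

lemma Dfn.ren {S : Set (κ → ℝ)} (hS : IsRSA κ S) (e : κ → ι) :
    Dfn fun x : ι → ℝ => (fun j => x (e j)) ∈ S :=
  (Dfn.poly hS fun j => MvPolynomial.X (e j)).congr fun x => by simp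

lemma eval_option (P : MvPolynomial (Option ι) ℝ) (z : Option ι → ℝ) :
    MvPolynomial.eval z P = Polynomial.eval₂ (MvPolynomial.eval fun i => z (some i)) (z none)
      (MvPolynomial.optionEquivLeft ℝ ι P) := by
  induction P using MvPolynomial.induction_on with
  | C a => simp [MvPolynomial.optionEquivLeft_C]
  | add p q hp hq => simp [hp, hq, Polynomial.eval₂_add]
  | mul_X p i hp =>
    rw [map_mul, map_mul, Polynomial.eval₂_mul, hp]
    congr 1
    cases i <;> simp

lemma Dfn.ex {q : (ι → ℝ) → ℝ → Prop}
    (h : Dfn fun z : Option ι → ℝ => q (fun i => z (some i)) (z none)) :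
    Dfn fun x => ∃ t, q x t := by
  obtain ⟨G, hG⟩ := rsa_det h
  obtain ⟨G', hG'⟩ := TS_core (G.image fun P => MvPolynomial.optionEquivLeft ℝ ι P)
  apply rsa_of_det
  refine ⟨G', ?_⟩
  have key : ∀ x y, SSign G' x y → (∃ t, q x t) → ∃ t, q y t := by
    rintro x y hxy ⟨t, ht⟩
    obtain ⟨θ, hθ⟩ := hG' (MvPolynomial.eval x) (MvPolynomial.eval y) hxy
    refine ⟨θ t, ?_⟩
    have := (hG (fun o => o.elim t x) (fun o => o.elim (θ t) y) ?_).mp ht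
    · exact this
    · intro g hg
      rw [eval_option, eval_option]
      exact hθ _ (Finset.mem_image_of_mem _ hg) t
  intro x y hxy
  exact ⟨key x y hxy, key y x fun g hg => (hxy g hg).symm⟩

lemma Dfn.all {q : (ι → ℝ) → ℝ → Prop}
    (h : Dfn fun z : Option ι → ℝ => q (fun i => z (some i)) (z none)) :
    Dfn fun x => ∀ t, q x t :=
  (Dfn.ex (q := fun x t => ¬ q x t) h.not).not.congr fun x => by push Not; rfl

lemma Dfn.exs {κ : Type} [hκ : Finite κ] : ∀ {ι : Type} {q : (ι → ℝ) → (κ → ℝ) → Prop}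
    (_ : Dfn fun z : ι ⊕ κ → ℝ => q (fun i => z (Sum.inl i)) (fun i => z (Sum.inr i))),
    Dfn fun x => ∃ y, q x y := by
  induction κ using Finite.induction_empty_option with
  | of_equiv e ih =>
    intro ι q h
    have h2 := Dfn.ren h (Sum.map id e.symm)
    refine (ih (q := fun x y => q x (fun i => y (e.symm i))) h2).congr fun x => ?_
    constructor
    · rintro ⟨y, hy⟩; exact ⟨fun i => y (e i), by simpa using hy⟩
    · rintro ⟨y, hy⟩; exact ⟨_, hy⟩
  | h_empty =>
    intro ι q h
    have h2 := Dfn.ren h (fun j : ι ⊕ PEmpty => Sum.elim id PEmpty.elim j)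
    refine Dfn.congr h2 fun x => ?_
    constructor
    · rintro ⟨y, hy⟩
      have : y = fun i => x (Sum.elim id PEmpty.elim (Sum.inr i : ι ⊕ PEmpty)) := funext fun i => i.elim
      rw [this] at hy; exact hy
    · intro h; exact ⟨_, h⟩
  | h_option ih =>
    rename_i α _
    intro ι q h
    let e : ι ⊕ Option α → Option ι ⊕ α :=
      Sum.elim (fun i => Sum.inl (some i)) (fun o => o.elim (Sum.inl none) Sum.inr)
    have h2 := Dfn.ren h e
    have h3 := ih (q := fun (x : Option ι → ℝ) y => q (fun i => x (some i)) (fun o => o.elim (x none) y))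
      (Dfn.congr h2 fun z => by
        show q _ _ ↔ q _ _
        apply Iff.of_eq; congr 1; funext o; cases o <;> rfl)
    refine (Dfn.ex (q := fun x t => ∃ y, q x (fun o => o.elim t y)) h3).congr fun x => ?_
    constructor
    · rintro ⟨y, hy⟩
      refine ⟨y none, fun i => y (some i), ?_⟩
      convert hy using 1; funext o; cases o <;> rfl
    · rintro ⟨t, y, hy⟩; exact ⟨_, hy⟩

/-- definable functions -/
def SF (u : (ι → ℝ) → ℝ) : Prop := Dfn fun z : Option ι → ℝ => z none = u fun i => z (some i)

lemma SF.of_iff {u : (ι → ℝ) → ℝ} {T : (ι → ℝ) → ℝ → Prop}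
    (h : Dfn fun z : Option ι → ℝ => T (fun i => z (some i)) (z none))
    (h' : ∀ x t, t = u x ↔ T x t) : SF u := Dfn.congr h fun z => h' _ _

lemma SF.subst [Finite κ] {S : Set (κ → ℝ)} (hS : IsRSA κ S) {u : κ → (ι → ℝ) → ℝ}
    (hu : ∀ j, SF (u j)) : Dfn fun x : ι → ℝ => (fun j => u j x) ∈ S := by
  have := Dfn.exs (q := fun x y => (∀ j, y j = u j x) ∧ y ∈ S)
    ((Dfn.allF fun j => Dfn.congr (Dfn.ren (hu j) (fun o : Option ι => o.elim (Sum.inr j : ι ⊕ κ) Sum.inl))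
      (fun z => Iff.rfl)).and (Dfn.ren hS Sum.inr))
  refine this.congr fun x => ?_
  constructor
  · intro h; exact ⟨_, fun j => rfl, h⟩
  · rintro ⟨y, h1, h2⟩
    rwa [← show y = fun j => u j x from funext h1]

lemma SF.poly (P : MvPolynomial ι ℝ) : SF fun x => MvPolynomial.eval x P := by
  have := Dfn.sgn (MvPolynomial.X none - MvPolynomial.rename some P : MvPolynomial (Option ι) ℝ) 0
  refine this.congr fun z => ?_
  rw [sign_eq_zero_iff, map_sub, MvPolynomial.eval_X, MvPolynomial.eval_rename, sub_eq_zero]; rfl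
lemma SF.coord (i : ι) : SF fun x => x i := by simpa using SF.poly (MvPolynomial.X i)
lemma SF.const (c : ℝ) : SF fun _ : ι → ℝ => c := by simpa using SF.poly (ι := ι) (MvPolynomial.C c)
lemma SF.comp [Finite κ] {v : (κ → ℝ) → ℝ} (hv : SF v) {u : κ → (ι → ℝ) → ℝ}
    (hu : ∀ j, SF (u j)) : SF fun x => v fun j => u j x := by
  have hu' : ∀ j, SF fun z : Option ι → ℝ => u j fun i => z (some i) := by
    intro j
    exact Dfn.ren (hu j) fun o : Option ι => o.elim none fun i => some (some i)
  have := SF.subst hv (u := fun o : Option κ => o.elim (fun z : Option ι → ℝ => z none)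
    fun j z => u j fun i => z (some i)) (by
      intro j; cases j
      · exact SF.coord none
      · exact hu' _)
  exact this
lemma SF.ren {v : (κ → ℝ) → ℝ} (hv : SF v) (e : κ → ι) : SF fun x => v fun j => x (e j) :=
  Dfn.ren hv fun o : Option κ => o.elim none fun i => some (e i)
lemma SF.congr {u v : (ι → ℝ) → ℝ} (h : SF u) (h' : ∀ x, v x = u x) : SF v := by
  have : v = u := funext h'
  rw [this]; exact h
lemma Dfn.subst [Finite κ] {p : (κ → ℝ) → Prop} (hS : Dfn p) {u : κ → (ι → ℝ) → ℝ}
    (hu : ∀ j, SF (u j)) : Dfn fun x : ι → ℝ => p fun j => u j x := SF.subst hS hu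
lemma SF.pol2 {u v : (ι → ℝ) → ℝ} (hu : SF u) (hv : SF v) (P : MvPolynomial (Fin 2) ℝ) :
    SF fun x => MvPolynomial.eval ![u x, v x] P := by
  have := (SF.poly P).comp (u := ![u, v]) (by intro j; fin_cases j <;> assumption)
  refine this.congr fun x => ?_
  congr 2; funext j; fin_cases j <;> rfl
variable {u v : (ι → ℝ) → ℝ}
lemma SF.add (hu : SF u) (hv : SF v) : SF fun x => u x + v x := by
  exact (hu.pol2 hv (MvPolynomial.X 0 + MvPolynomial.X 1)).congr fun x => by simp
lemma SF.mul (hu : SF u) (hv : SF v) : SF fun x => u x * v x := by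
  exact (hu.pol2 hv (MvPolynomial.X 0 * MvPolynomial.X 1)).congr fun x => by simp
lemma SF.sub (hu : SF u) (hv : SF v) : SF fun x => u x - v x := by
  exact (hu.pol2 hv (MvPolynomial.X 0 - MvPolynomial.X 1)).congr fun x => by simp
lemma Dfn.lt (hu : SF u) (hv : SF v) : Dfn fun x => u x < v x := by
  have := SF.subst (IsRSA.basic (MvPolynomial.X () : MvPolynomial Unit ℝ)) (u := fun _ x => v x - u x)
    (fun _ => hv.sub hu)
  exact Dfn.congr this fun x => by simp
lemma Dfn.le (hu : SF u) (hv : SF v) : Dfn fun x => u x ≤ v x :=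
  (Dfn.lt hv hu).not.congr fun x => by simp
lemma Dfn.eq (hu : SF u) (hv : SF v) : Dfn fun x => u x = v x :=
  ((Dfn.le hu hv).and (Dfn.le hv hu)).congr fun x => le_antisymm_iff
lemma SF.some' (hu : SF u) : SF fun z : Option ι → ℝ => u fun i => z (some i) := hu.ren some
lemma Dfn.some' {p : (ι → ℝ) → Prop} (h : Dfn p) : Dfn fun z : Option ι → ℝ => p fun i => z (some i) :=
  Dfn.ren h some
lemma SF.ite {p : (ι → ℝ) → Prop} (hp : Dfn p) (hu : SF u) (hv : SF v) :
    SF fun x => if p x then u x else v x := by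
  refine SF.of_iff (T := fun x t => (p x ∧ t = u x) ∨ (¬ p x ∧ t = v x)) ?_ ?_
  · exact (hp.some'.and (Dfn.eq (SF.coord none) hu.some')).or
      (hp.some'.not.and (Dfn.eq (SF.coord none) hv.some'))
  · intro x t; by_cases h : p x <;> simp [h]
lemma SF.div (hu : SF u) (hv : SF v) : SF fun x => u x / v x := by
  refine SF.of_iff (T := fun x t => (v x = 0 ∧ t = 0) ∨ (¬ v x = 0 ∧ t * v x = u x)) ?_ ?_
  · exact ((Dfn.eq hv.some' (SF.const 0)).and (Dfn.eq (SF.coord none) (SF.const 0))).or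
      ((Dfn.eq hv.some' (SF.const 0)).not.and (Dfn.eq ((SF.coord none).mul hv.some') hu.some'))
  · intro x t; by_cases h : v x = 0
    · simp [h]
    · simp [h, eq_div_iff]
lemma SF.max (hu : SF u) (hv : SF v) : SF fun x => max (u x) (v x) :=
  (SF.ite (Dfn.le hu hv) hv hu).congr fun x => by rw [max_def]
lemma SF.min (hu : SF u) (hv : SF v) : SF fun x => min (u x) (v x) :=
  (SF.ite (Dfn.le hu hv) hu hv).congr fun x => by rw [min_def]
lemma SF.abs (hu : SF u) : SF fun x => |u x| :=
  (hu.max ((SF.const 0).sub hu)).congr fun x => by rw [zero_sub]; rfl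
lemma SF.sum {α : Type*} (s : Finset α) {w : α → (ι → ℝ) → ℝ} (h : ∀ a ∈ s, SF (w a)) :
    SF fun x => ∑ a ∈ s, w a x := by
  induction s using Finset.induction_on with
  | empty => simpa using SF.const 0
  | insert a s ha ih =>
    exact ((h a (by simp)).add (ih fun b hb => h b (by simp [hb]))).congr fun x => by
      rw [Finset.sum_insert ha]

/-- dichotomy to the right of a point along polynomial curves -/
lemma right_dich {S : Set (ι → ℝ)} (hS : IsRSA ι S) (p : ι → Polynomial ℝ) (s₀ : ℝ) :
    (∀ᶠ s in 𝓝[>] s₀, (fun i => (p i).eval s) ∈ S) ∨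
    (∀ᶠ s in 𝓝[>] s₀, (fun i => (p i).eval s) ∉ S) := by
  induction hS with
  | basic P =>
    let Q : Polynomial ℝ := MvPolynomial.aeval p P
    have hQ : ∀ s, Q.eval s = MvPolynomial.eval (fun i => (p i).eval s) P := by
      intro s
      simp only [Q]
      rw [← Polynomial.coe_evalRingHom, ← MvPolynomial.coe_aeval_eq_eval, MvPolynomial.aeval_def,
        MvPolynomial.hom_eval₂]
      simp
      congr 1
      ext; simp
    simp only [Set.mem_ofPred_eq, ← hQ]
    by_cases h0 : Q = 0
    · right; simp [h0]
    have hne : ∀ᶠ s in 𝓝[>] s₀, s ∉ (Q.roots.toFinset : Set ℝ) \ {s₀} := by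
      have : IsOpen ((Q.roots.toFinset : Set ℝ) \ {s₀})ᶜ :=
        (Q.roots.toFinset.finite_toSet.sdiff).isClosed.isOpen_compl
      exact mem_nhdsWithin_of_mem_nhds (this.mem_nhds (by simp))
    obtain ⟨b, hb, hbs⟩ := (mem_nhdsGT_iff_exists_Ioo_subset).mp hne
    have nr : ∀ s ∈ Set.Ioo s₀ b, Q.eval s ≠ 0 := by
      intro s hs h
      apply hbs hs
      refine ⟨by simp [h0, h], ?_⟩
      simp [hs.1.ne']
    have sg : ∀ s ∈ Set.Ioo s₀ b, SignType.sign (Q.eval s) = SignType.sign (Q.eval ((s₀ + b) / 2)) := by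
      intro s hs
      apply sign_eq_of_no_root Q.continuous
      intro c hc
      apply nr
      have hb' : s₀ < b := hb
      have m : (s₀ + b) / 2 ∈ Set.Ioo s₀ b := ⟨by linarith, by linarith⟩
      exact (Set.ordConnected_Ioo.uIcc_subset hs m) hc
    have hmem : Set.Ioo s₀ b ∈ 𝓝[>] s₀ := Ioo_mem_nhdsGT hb
    by_cases hm : 0 < Q.eval ((s₀ + b) / 2)
    · left
      filter_upwards [hmem] with s hs
      rw [← sign_eq_one_iff, sg s hs, sign_pos hm]
    · right
      filter_upwards [hmem] with s hs
      rw [← sign_eq_one_iff, sg s hs, sign_eq_one_iff]; exact hm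
  | compl _ ih => rcases ih with h | h
                  · right; simpa using h
                  · left; simpa using h
  | union _ _ ih1 ih2 =>
    rcases ih1 with h | h
    · left; exact h.mono fun s hs => Or.inl hs
    rcases ih2 with h' | h'
    · left; exact h'.mono fun s hs => Or.inr hs
    right
    filter_upwards [h, h'] with s h1 h2
    rintro (h | h)
    · exact h1 h
    · exact h2 h
end
end

section
/-- holds for `0 < a ≪ ρ₁ < ρ₂ ≪ 1` -/
def Ev (Q : ℝ → ℝ → ℝ → Prop) : Prop := ∃ r0 > 0, ∀ ρ₁ ρ₂, 0 < ρ₁ → ρ₁ < ρ₂ → ρ₂ ≤ r0 →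
  ∃ a0 > 0, ∀ a, 0 < a → a ≤ a0 → Q a ρ₁ ρ₂

lemma Ev.and {Q Q' : ℝ → ℝ → ℝ → Prop} (h : Ev Q) (h' : Ev Q') : Ev fun a b c => Q a b c ∧ Q' a b c := by
  obtain ⟨r, hr, H⟩ := h
  obtain ⟨r', hr', H'⟩ := h'
  refine ⟨min r r', lt_min hr hr', fun ρ₁ ρ₂ h1 h2 h3 => ?_⟩
  obtain ⟨a, ha, K⟩ := H ρ₁ ρ₂ h1 h2 (h3.trans (min_le_left _ _))
  obtain ⟨a', ha', K'⟩ := H' ρ₁ ρ₂ h1 h2 (h3.trans (min_le_right _ _))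
  exact ⟨min a a', lt_min ha ha', fun b hb hb' => ⟨K b hb (hb'.trans (min_le_left _ _)),
    K' b hb (hb'.trans (min_le_right _ _))⟩⟩

lemma Ev.mono {Q Q' : ℝ → ℝ → ℝ → Prop} (h : Ev Q) (H : ∀ a b c, 0 < a → 0 < b → b < c →
    Q a b c → Q' a b c) : Ev Q' := by
  obtain ⟨r, hr, h⟩ := h
  refine ⟨r, hr, fun ρ₁ ρ₂ h1 h2 h3 => ?_⟩
  obtain ⟨a, ha, K⟩ := h ρ₁ ρ₂ h1 h2 h3
  exact ⟨a, ha, fun b hb hb' => H _ _ _ hb h1 h2 (K b hb hb')⟩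

lemma Ev.true : Ev fun _ _ _ => True := ⟨1, one_pos, fun _ _ _ _ _ => ⟨1, one_pos, fun _ _ _ => trivial⟩⟩

lemma Ev.all {α : Type*} (s : Finset α) {Q : α → ℝ → ℝ → ℝ → Prop} (h : ∀ i ∈ s, Ev (Q i)) :
    Ev fun a b c => ∀ i ∈ s, Q i a b c := by
  induction s using Finset.induction_on with
  | empty => exact Ev.true.mono (by simp)
  | insert i s _ ih =>
    refine ((h i (by simp)).and (ih fun j hj => h j (by simp [hj]))).mono ?_
    intro a b c _ _ _ h
    simpa using h

lemma Ev.allF {α : Type*} [Finite α] {Q : α → ℝ → ℝ → ℝ → Prop} (h : ∀ i, Ev (Q i)) :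
    Ev fun a b c => ∀ i, Q i a b c := by
  cases nonempty_fintype α
  exact (Ev.all Finset.univ fun i _ => h i).mono fun a b c _ _ _ h i => h i (Finset.mem_univ _)

lemma ev_ne (c : MvPolynomial (Fin 2) ℝ) (hc : c ≠ 0) :
    Ev fun a ρ₁ ρ₂ => ∀ ρ ∈ Set.Icc ρ₁ ρ₂, MvPolynomial.eval ![a, ρ] c ≠ 0 := by
  let E := MvPolynomial.finSuccEquiv ℝ 1
  have hE : E c ≠ 0 := by simpa using hc
  obtain ⟨q, hq, hq0⟩ := Polynomial.exists_eq_pow_rootMultiplicity_mul_and_not_dvd (E c) hE 0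
  set k := Polynomial.rootMultiplicity 0 (E c)
  rw [Polynomial.C_0, sub_zero] at hq hq0
  rw [Polynomial.X_dvd_iff] at hq0
  let g := q.coeff 0
  have hev : ∀ a ρ, MvPolynomial.eval ![a, ρ] c = a ^ k * MvPolynomial.eval ![a, ρ] (E.symm q) := by
    intro a ρ
    have : c = MvPolynomial.X 0 ^ k * E.symm q := by
      apply E.injective
      rw [map_mul, map_pow, E.apply_symm_apply, hq]
      congr 2
      exact (MvPolynomial.finSuccEquiv_X_zero).symm
    conv_lhs => rw [this]
    simp
  have hev0 : ∀ ρ, MvPolynomial.eval ![0, ρ] (E.symm q) = MvPolynomial.eval (fun _ => ρ) g := by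
    intro ρ
    have h1 : (![0, ρ] : Fin 2 → ℝ) = Fin.cons 0 (fun _ => ρ) := by
      funext i; refine Fin.cases rfl (fun j => ?_) i
      fin_cases j; rfl
    rw [h1, MvPolynomial.eval_eq_eval_mv_eval']
    rw [show MvPolynomial.finSuccEquiv ℝ 1 (E.symm q) = q from E.apply_symm_apply q,
      ← Polynomial.coeff_zero_eq_eval_zero, Polynomial.coeff_map]
  obtain ⟨r0, hr0, hg⟩ : ∃ r0 > 0, ∀ ρ, 0 < ρ → ρ ≤ r0 → MvPolynomial.eval (fun _ => ρ) g ≠ 0 := by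
    rcases right_dich (Dfn.sgn g 0) (fun _ => Polynomial.X) 0 with h | h
    · exfalso
      obtain ⟨b, hb, hbs⟩ := (mem_nhdsGT_iff_exists_Ioo_subset).mp h
      apply hq0
      refine MvPolynomial.funext_set (s := fun _ => Set.Ioo (0 : ℝ) b) (fun _ => Set.Ioo_infinite hb) ?_
      intro x hx
      have := hbs (hx 0 (Set.mem_univ _))
      simp only [Set.mem_ofPred_eq, Polynomial.eval_X, sign_eq_zero_iff] at this
      rw [map_zero, show x = fun _ => x 0 from funext fun i => by fin_cases i; rfl]
      exact this
    · obtain ⟨b, hb, hbs⟩ := (mem_nhdsGT_iff_exists_Ioo_subset).mp h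
      have hb' : 0 < b := hb
      refine ⟨b / 2, by linarith, fun ρ h1 h2 => ?_⟩
      have := hbs (⟨h1, by linarith⟩ : ρ ∈ Set.Ioo 0 b)
      simp only [Set.mem_ofPred_eq, Polynomial.eval_X, sign_eq_zero_iff] at this
      simpa using this
  refine ⟨r0, hr0, fun ρ₁ ρ₂ h1 h2 h3 => ?_⟩
  have hcont : Continuous fun z : ℝ × ℝ => MvPolynomial.eval ![z.1, z.2] (E.symm q) := by
    apply (MvPolynomial.continuous_eval _).comp
    apply continuous_pi; intro i; fin_cases i <;> simp <;> fun_prop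
  have := (isCompact_Icc (a := ρ₁) (b := ρ₂)).eventually_forall_of_forall_eventually (x₀ := (0 : ℝ))
    (P := fun a ρ => MvPolynomial.eval ![a, ρ] (E.symm q) ≠ 0) (by
      intro ρ hρ
      refine hcont.continuousAt.eventually_ne ?_
      simp only [hev0]
      exact hg ρ (by linarith [hρ.1]) (by linarith [hρ.2]))
  obtain ⟨δ, hδ, H⟩ := Metric.eventually_nhds_iff.mp this
  refine ⟨δ / 2, by linarith, fun a ha ha' ρ hρ => ?_⟩
  rw [hev]
  refine mul_ne_zero (pow_ne_zero _ ha.ne') (H ?_ ρ hρ)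
  rw [Real.dist_eq, sub_zero, abs_of_pos ha]; linarith

lemma ev_dich {S : Set (Fin 2 → ℝ)} (hS : IsRSA (Fin 2) S) :
    Ev fun a ρ₁ ρ₂ => (∀ ρ ∈ Set.Icc ρ₁ ρ₂, ![a, ρ] ∈ S) ∨ (∀ ρ ∈ Set.Icc ρ₁ ρ₂, ![a, ρ] ∉ S) := by
  induction hS with
  | basic P =>
    by_cases hP : P = 0
    · refine Ev.true.mono fun a b c _ _ _ _ => Or.inr ?_
      simp [hP]
    refine (ev_ne P hP).mono fun a ρ₁ ρ₂ _ _ h12 h => ?_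
    have hcont : Continuous fun ρ : ℝ => MvPolynomial.eval ![a, ρ] P := by
      apply (MvPolynomial.continuous_eval _).comp
      apply continuous_pi; intro i; fin_cases i <;> simp <;> fun_prop
    have sg : ∀ ρ ∈ Set.Icc ρ₁ ρ₂, SignType.sign (MvPolynomial.eval ![a, ρ] P) =
        SignType.sign (MvPolynomial.eval ![a, ρ₁] P) := by
      intro ρ hρ
      apply sign_eq_of_no_root hcont
      intro c hc
      exact h c ((Set.ordConnected_Icc.uIcc_subset hρ (Set.left_mem_Icc.mpr h12.le)) hc)
    by_cases h0 : 0 < MvPolynomial.eval ![a, ρ₁] P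
    · left; intro ρ hρ
      rw [Set.mem_ofPred_eq, ← sign_eq_one_iff, sg ρ hρ, sign_pos h0]
    · right; intro ρ hρ
      rw [Set.mem_ofPred_eq, ← sign_eq_one_iff, sg ρ hρ, sign_eq_one_iff]; exact h0
  | compl _ ih =>
    refine ih.mono fun a b c _ _ _ h => ?_
    rcases h with h | h
    · right; intro ρ hρ h'; exact h' (h ρ hρ)
    · left; exact h
  | union _ _ ih1 ih2 =>
    refine (ih1.and ih2).mono fun a b c _ _ _ h => ?_
    rcases h with ⟨h | h, h'⟩
    · left; intro ρ hρ; exact Or.inl (h ρ hρ)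
    rcases h' with h' | h'
    · left; intro ρ hρ; exact Or.inr (h' ρ hρ)
    right; rintro ρ hρ (k | k)
    · exact h ρ hρ k
    · exact h' ρ hρ k
end

section
open Polynomial

lemma tendsto_of_ultra {T : Type*} {l : Filter T} {f : T → ℝ} {A B b : ℝ}
    (hK : ∀ᶠ x in l, f x ∈ Set.Icc A B)
    (h : ∀ 𝒰 : Ultrafilter T, (𝒰 : Filter T) ≤ l → ∀ y, Tendsto f 𝒰 (𝓝 y) → y = b) :
    Tendsto f l (𝓝 b) := by
  rw [tendsto_iff_ultrafilter]
  intro 𝒰 h𝒰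
  have hm : ((𝒰.map f : Ultrafilter ℝ) : Filter ℝ) ≤ 𝓟 (Set.Icc A B) := by
    rw [le_principal_iff]; exact h𝒰 hK
  obtain ⟨y, _, hy⟩ := (isCompact_Icc (a := A) (b := B)).ultrafilter_le_nhds _ hm
  have : Tendsto f 𝒰 (𝓝 y) := hy
  rw [← h 𝒰 h𝒰 y this]; exact this

def ArgMin (F : ℝ → ℝ) (a b t : ℝ) : Prop := (a ≤ t ∧ t ≤ b) ∧ ∀ s, a ≤ s → s ≤ b → |F t| ≤ |F s|

def amin (F : ℝ → ℝ) (a b : ℝ) : ℝ := sInf {t | ArgMin F a b t}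

lemma amin_spec {F : ℝ → ℝ} (hF : Continuous F) {a b : ℝ} (h : a ≤ b) : ArgMin F a b (amin F a b) := by
  have hc : IsClosed {t | ArgMin F a b t} := by
    have : {t | ArgMin F a b t} = Set.Icc a b ∩ ⋂ s ∈ Set.Icc a b, {t | |F t| ≤ |F s|} := by
      ext t; simp [ArgMin]
    rw [this]
    exact isClosed_Icc.inter (isClosed_biInter fun s _ => isClosed_le (by fun_prop) continuous_const)
  have hn : {t | ArgMin F a b t}.Nonempty := by
    obtain ⟨t, ht, hm⟩ := isCompact_Icc.exists_isMinOn (Set.nonempty_Icc.mpr h)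
      (f := fun t => |F t|) (by fun_prop)
    exact ⟨t, ht, fun s h1 h2 => hm ⟨h1, h2⟩⟩
  exact hc.csInf_mem hn ⟨a, fun t ht => ht.1.1⟩

lemma amin_le {F : ℝ → ℝ} {a b t : ℝ} (h : ArgMin F a b t) : amin F a b ≤ t :=
  csInf_le ⟨a, fun t ht => ht.1.1⟩ h

lemma argMin_unique {F : ℝ → ℝ} (hF : Continuous F) {a b s t : ℝ} (hi : Set.InjOn F (Set.Icc a b))
    (hs : ArgMin F a b s) (ht : ArgMin F a b t) : s = t := by
  have key : ∀ s t, ArgMin F a b s → ArgMin F a b t → s ≤ t → s = t := by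
    intro s t hs ht hst
    have e : |F s| = |F t| := le_antisymm (hs.2 t ht.1.1 ht.1.2) (ht.2 s hs.1.1 hs.1.2)
    rcases abs_eq_abs.mp e with h | h
    · exact hi ⟨hs.1.1, hs.1.2⟩ ⟨ht.1.1, ht.1.2⟩ h
    · have : (0 : ℝ) ∈ Set.uIcc (F s) (F t) := by
        rw [h, Set.mem_uIcc]; rcases le_total (F t) 0 with h | h
        · right; exact ⟨h, by linarith⟩
        · left; exact ⟨by linarith, h⟩
      obtain ⟨c, hc, h0⟩ := intermediate_value_uIcc hF.continuousOn this
      rw [Set.uIcc_of_le hst] at hc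
      have c1 := hs.2 c (hs.1.1.trans hc.1) (hc.2.trans ht.1.2)
      have c2 := ht.2 c (hs.1.1.trans hc.1) (hc.2.trans ht.1.2)
      simp only [h0, abs_zero, abs_nonpos_iff] at c1 c2
      exact hi ⟨hs.1.1, hs.1.2⟩ ⟨ht.1.1, ht.1.2⟩ (c1.trans c2.symm)
  rcases le_total s t with h | h
  · exact key s t hs ht h
  · exact (key t s ht hs h).symm

lemma SF.amin' {ι : Type} {α β : (ι → ℝ) → ℝ} {F : (ι → ℝ) → ℝ → ℝ} (hα : SF α) (hβ : SF β)
    (hF : SF fun z : Option ι → ℝ => F (fun i => z (some i)) (z none)) (hFc : ∀ x, Continuous (F x)) :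
    SF fun x => amin (F x) (α x) (β x) := by
  have hA : Dfn fun z : Option ι → ℝ => ArgMin (F fun i => z (some i)) (α fun i => z (some i))
      (β fun i => z (some i)) (z none) := by
    refine ((Dfn.le hα.some' (SF.coord none)).and (Dfn.le (SF.coord none) hβ.some')).and
      (Dfn.all (q := fun z s => _ → _ → _) ?_)
    refine (Dfn.le hα.some'.some' (SF.coord none)).imp ((Dfn.le (SF.coord none) hβ.some'.some').imp
      (Dfn.le hF.some'.abs (SF.abs ?_)))
    exact hF.ren fun o : Option ι => o.elim none fun i => some (some i)
  refine SF.of_iff (T := fun x t => (α x ≤ β x ∧ ArgMin (F x) (α x) (β x) t ∧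
    ∀ t', ArgMin (F x) (α x) (β x) t' → t ≤ t') ∨ (¬ α x ≤ β x ∧ t = 0)) ?_ ?_
  · refine ((Dfn.le hα.some' hβ.some').and (hA.and (Dfn.all (q := fun (z : Option ι → ℝ) t' => _ → _) ?_))).or
      ((Dfn.le hα.some' hβ.some').not.and (Dfn.eq (SF.coord none) (SF.const 0)))
    refine Dfn.imp ?_ (Dfn.le (SF.coord (some none)) (SF.coord none))
    exact Dfn.ren hA fun o : Option ι => o.elim none fun i => some (some i)
  · intro x t
    by_cases h : α x ≤ β x
    · have sp := amin_spec (hFc x) h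
      simp only [h, true_and, not_true, false_and, or_false]
      constructor
      · rintro rfl; exact ⟨sp, fun t' h' => amin_le h'⟩
      · rintro ⟨h1, h2⟩; exact le_antisymm (h2 _ sp) (amin_le h1)
    · simp only [h, false_and, not_false_eq_true, true_and, false_or]
      have : {t | ArgMin (F x) (α x) (β x) t} = ∅ := by
        ext t; simp only [Set.mem_ofPred_eq, Set.mem_empty_iff_false, iff_false]
        rintro ⟨⟨h1, h2⟩, _⟩; exact h (h1.trans h2)
      rw [amin, this, Real.sInf_empty]

/-- virtual roots in `[-M, M]` -/
def vr (M : ℝ) : ℕ → ℝ[X] → ℕ → ℝ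
  | 0, _, 0 => -M
  | 0, _, _ + 1 => M
  | _ + 1, _, 0 => -M
  | d + 1, P, j + 1 => amin (fun t => P.eval t) (vr M d (derivative P) j) (vr M d (derivative P) (j + 1))

lemma vr_zero (M : ℝ) (d : ℕ) (P : ℝ[X]) : vr M d P 0 = -M := by cases d <;> rfl

lemma vr_mono_bd {M : ℝ} (hM : 0 < M) (d : ℕ) : ∀ P j, vr M d P j ≤ vr M d P (j + 1) ∧
    -M ≤ vr M d P j ∧ vr M d P j ≤ M := by
  induction d with
  | zero =>
    intro P j; cases j
    · simp only [vr]; refine ⟨by linarith, by linarith, by linarith⟩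
    · simp only [vr]; refine ⟨le_rfl, by linarith, by linarith⟩
  | succ d ih =>
    intro P j
    have sp := fun j => amin_spec (F := fun t => P.eval t) P.continuous (ih (derivative P) j).1
    cases j
    · simp only [vr]
      refine ⟨?_, le_rfl, by linarith⟩
      have := (sp 0).1.1
      rw [vr_zero] at this
      simpa [vr_zero] using this
    · rename_i j
      simp only [vr]
      exact ⟨(sp j).1.2.trans (sp (j+1)).1.1, (ih _ j).2.1.trans (sp j).1.1,
        (sp j).1.2.trans (ih _ (j+1)).2.2⟩

lemma vr_top {M : ℝ} (d : ℕ) : ∀ P j, d + 1 ≤ j → 0 < M → vr M d P j = M := by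
  induction d with
  | zero =>
    intro P j hj _
    obtain ⟨i, rfl⟩ : ∃ i, j = i + 1 := ⟨j - 1, by omega⟩
    rfl
  | succ d ih =>
    intro P j hj hM
    obtain ⟨i, rfl⟩ : ∃ i, j = i + 1 := ⟨j - 1, by omega⟩
    have sp := amin_spec (F := fun t => P.eval t) P.continuous (vr_mono_bd hM d (derivative P) i).1
    simp only [vr]
    have h1 := sp.1
    have e1 := ih (derivative P) i (by omega) hM
    have e2 := ih (derivative P) (i+1) (by omega) hM
    rw [e1, e2] at h1 ⊢
    exact le_antisymm h1.2 h1.1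

/-- locating a point between consecutive terms -/
lemma locate (σ : ℕ → ℝ) (N : ℕ) {t : ℝ} (h0 : σ 0 ≤ t) (hN : t ≤ σ N) :
    (∃ j < N, σ j ≤ t ∧ t ≤ σ (j + 1)) ∨ t = σ N := by
  induction N with
  | zero => right; exact le_antisymm hN h0
  | succ N ih =>
    rcases le_total t (σ N) with h | h
    · rcases ih h with ⟨j, hj, h1⟩ | rfl
      · exact Or.inl ⟨j, by omega, h1⟩
      · exact Or.inl ⟨N, by omega, le_rfl, hN⟩
    · exact Or.inl ⟨N, by omega, h, hN⟩

lemma inj_of_deriv (P : ℝ[X]) {a b : ℝ} (h : ∀ c, a < c → c < b → (derivative P).eval c ≠ 0) :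
    Set.InjOn (fun t => P.eval t) (Set.Icc a b) := by
  have key : ∀ s ∈ Set.Icc a b, ∀ t ∈ Set.Icc a b, s < t → P.eval s ≠ P.eval t := by
    intro s hs t ht hst he
    obtain ⟨c, hc, h0⟩ := exists_deriv_eq_zero (f := fun t => P.eval t) hst P.continuous.continuousOn he
    rw [Polynomial.deriv] at h0
    exact h c (lt_of_le_of_lt hs.1 hc.1) (lt_of_lt_of_le hc.2 ht.2) h0
  intro s hs t ht he
  rcases lt_trichotomy s t with h | h | h
  · exact absurd he (key s hs t ht h)
  · exact h
  · exact absurd he.symm (key t ht s hs h)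

lemma vr_root {M : ℝ} (hM : 0 < M) (d : ℕ) : ∀ P : ℝ[X], P ≠ 0 → P.natDegree = d → ∀ c, -M ≤ c →
    c ≤ M → P.eval c = 0 → ∃ j, vr M d P j = c := by
  induction d with
  | zero =>
    intro P hP hd c _ _ h0
    rw [eq_C_of_natDegree_eq_zero hd] at h0 hP
    simp at h0 hP; exact absurd h0 hP
  | succ d ih =>
    intro P hP hd c h1 h2 h0
    have hd' : (derivative P).natDegree = d := by rw [natDegree_derivative, hd]; rfl
    have hP' : derivative P ≠ 0 := by
      intro h; have := derivative_eq_zero.mp h; omega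
    obtain ⟨j, h3, h4⟩ : ∃ j, vr M d (derivative P) j ≤ c ∧ c ≤ vr M d (derivative P) (j+1) := by
      rcases locate (vr M d (derivative P)) (d + 1) (t := c) (by rw [vr_zero]; exact h1)
        (by rw [vr_top _ _ _ le_rfl hM]; exact h2) with ⟨j, _, h⟩ | h
      · exact ⟨j, h⟩
      · exact ⟨d + 1, h.ge, by rw [vr_top _ _ _ (by omega) hM]; exact h2⟩
    refine ⟨j + 1, ?_⟩
    have hmono : Monotone (vr M d (derivative P)) := monotone_nat_of_le_succ fun j => (vr_mono_bd hM d _ j).1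
    have hinj := inj_of_deriv P (a := vr M d (derivative P) j) (b := vr M d (derivative P) (j+1)) (by
      intro e he1 he2 he0
      obtain ⟨i, rfl⟩ := ih (derivative P) hP' hd' e ((vr_mono_bd hM d _ j).2.1.trans he1.le)
        (he2.le.trans (vr_mono_bd hM d _ (j+1)).2.2) he0
      rcases Nat.lt_or_ge j i with h | h
      · exact absurd (hmono (show j + 1 ≤ i from h)) (not_le.mpr he2)
      · exact absurd (hmono h) (not_le.mpr he1))
    have sp := amin_spec (F := fun t => P.eval t) P.continuous (vr_mono_bd hM d (derivative P) j).1
    simp only [vr]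
    have := sp.2 c h3 h4
    simp only [h0, abs_zero, abs_nonpos_iff] at this
    exact hinj sp.1 ⟨h3, h4⟩ (this.trans h0.symm)

lemma vr_inj {M : ℝ} (hM : 0 < M) (d : ℕ) (P : ℝ[X]) (hd : P.natDegree = d + 1) (j : ℕ) :
    Set.InjOn (fun t => P.eval t) (Set.Icc (vr M d (derivative P) j) (vr M d (derivative P) (j+1))) := by
  have hd' : (derivative P).natDegree = d := by rw [natDegree_derivative, hd]; rfl
  have hP' : derivative P ≠ 0 := by
    intro h; have := derivative_eq_zero.mp h; omega
  have hmono : Monotone (vr M d (derivative P)) := monotone_nat_of_le_succ fun j => (vr_mono_bd hM d _ j).1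
  apply inj_of_deriv
  intro e he1 he2 he0
  obtain ⟨i, rfl⟩ := vr_root hM d (derivative P) hP' hd' e ((vr_mono_bd hM d _ j).2.1.trans he1.le)
        (he2.le.trans (vr_mono_bd hM d _ (j+1)).2.2) he0
  rcases Nat.lt_or_ge j i with h | h
  · exact absurd (hmono (show j + 1 ≤ i from h)) (not_le.mpr he2)
  · exact absurd (hmono h) (not_le.mpr he1)

/-- specialization of a polynomial with polynomial coefficients -/
abbrev spc {τ : Type} (p : (MvPolynomial τ ℝ)[X]) (x : τ → ℝ) : ℝ[X] := p.map (MvPolynomial.eval x)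

lemma SF.spc {τ : Type} (p : (MvPolynomial τ ℝ)[X]) :
    SF fun z : Option τ → ℝ => (spc p fun i => z (some i)).eval (z none) := by
  refine (SF.poly ((MvPolynomial.optionEquivLeft ℝ τ).symm p)).congr fun z => ?_
  rw [eval_option, AlgEquiv.apply_symm_apply, eval_map]

lemma spc_cont {τ : Type} (p : (MvPolynomial τ ℝ)[X]) :
    Continuous fun z : (τ → ℝ) × ℝ => (spc p z.1).eval z.2 := by
  have : ∀ z : (τ → ℝ) × ℝ, (spc p z.1).eval z.2 = MvPolynomial.eval (fun o : Option τ => o.elim z.2 z.1)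
      ((MvPolynomial.optionEquivLeft ℝ τ).symm p) := by
    intro z; rw [eval_option, AlgEquiv.apply_symm_apply, eval_map]; rfl
  simp only [this]
  apply (MvPolynomial.continuous_eval _).comp
  apply continuous_pi; intro o; cases o
  · exact continuous_snd
  · exact (continuous_apply _).comp continuous_fst

lemma vr_SF {τ : Type} (M : ℝ) (d : ℕ) : ∀ (p : (MvPolynomial τ ℝ)[X]) (j : ℕ),
    SF fun x => vr M d (spc p x) j := by
  induction d with
  | zero => intro p j; cases j <;> exact SF.const _
  | succ d ih =>
    intro p j
    cases j
    · exact SF.const _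
    · rename_i j
      have h1 := fun j => (ih (derivative p) j)
      simp only [vr]
      simp only [spc, ← derivative_map] at h1 ⊢
      exact SF.amin' (F := fun x t => (p.map (MvPolynomial.eval x)).eval t) (h1 j) (h1 (j+1)) (SF.spc p)
        fun x => Polynomial.continuous _

lemma vr_cont {τ : Type} {M : ℝ} (hM : 0 < M) (d : ℕ) : ∀ (p : (MvPolynomial τ ℝ)[X])
    (U : Set (τ → ℝ)) (_ : ∀ x ∈ U, (spc p x).natDegree = d) (j : ℕ),
    ContinuousOn (fun x => vr M d (spc p x) j) U := by
  induction d with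
  | zero => intro p U _ j; cases j <;> exact continuousOn_const
  | succ d ih =>
    intro p U hU j
    cases j
    · exact continuousOn_const
    · rename_i j
      have h1 := fun j => ih (derivative p) U (fun x hx => by
        rw [spc, ← derivative_map, natDegree_derivative, hU x hx]; rfl) j
      simp only [vr]
      simp only [spc, ← derivative_map] at h1 ⊢
      intro x hx
      have bd := fun x => amin_spec (F := fun t => (spc p x).eval t) (spc p x).continuous
        (vr_mono_bd hM d (derivative (spc p x)) j).1
      apply tendsto_of_ultra (A := -M) (B := M)
      · refine Filter.Eventually.of_forall fun y => ?_
        exact ⟨(vr_mono_bd hM d _ j).2.1.trans (bd y).1.1, (bd y).1.2.trans (vr_mono_bd hM d _ (j+1)).2.2⟩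
      · intro 𝒰 h𝒰 y hy
        have l0 := (h1 j x hx).mono_left h𝒰
        have l1 := (h1 (j+1) x hx).mono_left h𝒰
        have lx : Tendsto (fun x : τ → ℝ => x) 𝒰 (𝓝 x) := h𝒰.trans nhdsWithin_le_nhds
        have ev : ∀ {s : (τ → ℝ) → ℝ} {s0}, Tendsto s 𝒰 (𝓝 s0) →
            Tendsto (fun x => |(spc p x).eval (s x)|) 𝒰 (𝓝 |(spc p x).eval s0|) := by
          intro s s0 hs
          exact ((spc_cont p).abs.tendsto (x, s0)).comp (lx.prodMk_nhds hs)
        refine argMin_unique (F := fun t => (spc p x).eval t) (spc p x).continuous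
          (vr_inj hM d (spc p x) (hU x hx) j) ⟨⟨?_, ?_⟩, ?_⟩ (bd x)
        · exact le_of_tendsto_of_tendsto' l0 hy fun z => (bd z).1.1
        · exact le_of_tendsto_of_tendsto' hy l1 fun z => (bd z).1.2
        · intro s hs1 hs2
          have ls : Tendsto (fun z => max (vr M d (derivative (spc p z)) j)
              (min s (vr M d (derivative (spc p z)) (j+1)))) 𝒰 (𝓝 s) := by
            have := l0.max ((tendsto_const_nhds (x := s)).min l1)
            rwa [min_eq_left hs2, max_eq_right hs1] at this
          refine le_of_tendsto_of_tendsto' (ev hy) (ev ls) fun z => (bd z).2 _ (le_max_left _ _) ?_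
          exact max_le (vr_mono_bd hM d _ j).1 (min_le_right _ _)
end

section
def plt (σ σ' : ℕ → ℝ) (t : ℝ) (j : ℕ) : ℝ :=
  (σ' (j+1) - σ' j) / (σ (j+1) - σ j) * max 0 (min (t - σ j) (σ (j+1) - σ j))

/-- piecewise linear interpolation -/
def PL (N : ℕ) (σ σ' : ℕ → ℝ) (t : ℝ) : ℝ := σ' 0 + ∑ j ∈ Finset.range N, plt σ σ' t j

/-- same coincidence pattern -/
def Coi (N : ℕ) (σ σ' : ℕ → ℝ) : Prop := ∀ j < N, σ j = σ (j+1) ↔ σ' j = σ' (j+1)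

lemma PL_succ (N : ℕ) (σ σ' : ℕ → ℝ) (t : ℝ) : PL (N+1) σ σ' t = PL N σ σ' t + plt σ σ' t N := by
  simp [PL, Finset.sum_range_succ, add_assoc]

section
variable {N : ℕ} {σ σ' σ'' : ℕ → ℝ} (hσ : Monotone σ)
include hσ

lemma PL_A (hc : Coi N σ σ') {t : ℝ} (k : ℕ) (hk : k ≤ N) (ht : σ k ≤ t) : PL k σ σ' t = σ' k := by
  induction k with
  | zero => simp [PL]
  | succ k ih =>
    rw [PL_succ, ih (by omega) ((hσ (Nat.le_succ k)).trans ht)]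
    have h1 := hσ (Nat.le_succ k)
    simp only [Nat.succ_eq_add_one] at h1
    rw [plt, min_eq_right (by linarith), max_eq_right (by linarith)]
    by_cases h0 : σ k = σ (k+1)
    · have := (hc k (by omega)).mp h0
      rw [h0, this]; ring
    · have : σ (k+1) - σ k ≠ 0 := fun h => h0 (by linarith)
      field_simp; ring

lemma PL_B {t : ℝ} {k m : ℕ} (hk : k ≤ m) (ht : t ≤ σ k) : PL m σ σ' t = PL k σ σ' t := by
  induction m, hk using Nat.le_induction with
  | base => rfl
  | succ m hm ih =>
    have h1 := hσ hm
    have h2 := hσ (Nat.le_succ m)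
    rw [PL_succ, ih, plt, max_eq_left ((min_le_left _ _).trans (by linarith)), mul_zero, add_zero]

lemma PL_gap (hc : Coi N σ σ') {t : ℝ} {j : ℕ} (hj : j < N) (h1 : σ j ≤ t) (h2 : t ≤ σ (j+1)) :
    PL N σ σ' t = σ' j + (σ' (j+1) - σ' j) / (σ (j+1) - σ j) * (t - σ j) := by
  rw [PL_B hσ (show j + 1 ≤ N from hj) h2, PL_succ, PL_A hσ hc j hj.le h1, plt,
    min_eq_left (by linarith), max_eq_right (by linarith)]

lemma PL_node (hc : Coi N σ σ') {j : ℕ} (hj : j ≤ N) : PL N σ σ' (σ j) = σ' j := by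
  rw [PL_B hσ hj le_rfl, PL_A hσ hc j hj le_rfl]

/-- description on a gap by a ratio -/
lemma PL_ratio (hc : Coi N σ σ') {t : ℝ} {j : ℕ} (hj : j < N) (h1 : σ j < t) (h2 : t < σ (j+1)) :
    ∃ l, 0 < l ∧ l < 1 ∧ t = σ j + l * (σ (j+1) - σ j) ∧
      PL N σ σ' t = σ' j + l * (σ' (j+1) - σ' j) := by
  have : 0 < σ (j+1) - σ j := by linarith
  refine ⟨(t - σ j) / (σ (j+1) - σ j), div_pos (by linarith) this, (div_lt_one this).mpr (by linarith),
    ?_, ?_⟩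
  · field_simp; ring
  · rw [PL_gap hσ hc hj h1.le h2.le]; ring

/-- each point is a node or lies in an open gap -/
lemma node_or_gap {t : ℝ} (h0 : σ 0 ≤ t) (hN : t ≤ σ N) :
    (∃ j ≤ N, t = σ j) ∨ ∃ j < N, σ j < t ∧ t < σ (j+1) := by
  rcases locate σ N h0 hN with ⟨j, hj, h1, h2⟩ | h
  · rcases h1.eq_or_lt with h | h
    · exact Or.inl ⟨j, hj.le, h.symm⟩
    rcases h2.eq_or_lt with h' | h'
    · exact Or.inl ⟨j+1, hj, h'⟩
    · exact Or.inr ⟨j, hj, h, h'⟩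
  · exact Or.inl ⟨N, le_rfl, h⟩

lemma PL_mem (hσ' : Monotone σ') (hc : Coi N σ σ') {t : ℝ} (h0 : σ 0 ≤ t) (hN : t ≤ σ N) :
    σ' 0 ≤ PL N σ σ' t ∧ PL N σ σ' t ≤ σ' N := by
  rcases node_or_gap hσ h0 hN with ⟨j, hj, rfl⟩ | ⟨j, hj, h1, h2⟩
  · rw [PL_node hσ hc hj]; exact ⟨hσ' (Nat.zero_le _), hσ' hj⟩
  · obtain ⟨l, l0, l1, _, e⟩ := PL_ratio hσ hc hj h1 h2
    have a := hσ' (Nat.zero_le j)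
    have b := hσ' (show j + 1 ≤ N from hj)
    have c := hσ' (Nat.le_succ j)
    simp only [Nat.succ_eq_add_one] at c
    rw [e]; constructor <;> nlinarith

lemma PL_cocycle (hσ' : Monotone σ') (hc : Coi N σ σ') (hc' : Coi N σ' σ'') {t : ℝ} (h0 : σ 0 ≤ t)
    (hN : t ≤ σ N) : PL N σ' σ'' (PL N σ σ' t) = PL N σ σ'' t := by
  have hcc : Coi N σ σ'' := fun j hj => (hc j hj).trans (hc' j hj)
  rcases node_or_gap hσ h0 hN with ⟨j, hj, rfl⟩ | ⟨j, hj, h1, h2⟩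
  · rw [PL_node hσ hc hj, PL_node hσ' hc' hj, PL_node hσ hcc hj]
  · rw [PL_gap hσ hcc hj h1.le h2.le]
    obtain ⟨l, l0, l1, et, e⟩ := PL_ratio hσ hc hj h1 h2
    have hne : σ j ≠ σ (j+1) := by linarith
    have hne' : σ' j ≠ σ' (j+1) := fun h => hne ((hc j hj).mpr h)
    have c := hσ' (Nat.le_succ j)
    simp only [Nat.succ_eq_add_one] at c
    have hlt : σ' j < σ' (j+1) := lt_of_le_of_ne c hne'
    rw [PL_gap hσ' hc' hj (by rw [e]; nlinarith) (by rw [e]; nlinarith), e, et]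
    have n1 : σ (j+1) - σ j ≠ 0 := fun h => hne (by linarith)
    have n2 : σ' (j+1) - σ' j ≠ 0 := fun h => hne' (by linarith)
    field_simp; ring

lemma PL_id {t : ℝ} (h0 : σ 0 ≤ t) (hN : t ≤ σ N) : PL N σ σ t = t := by
  have hc : Coi N σ σ := fun _ _ => Iff.rfl
  rcases node_or_gap hσ h0 hN with ⟨j, hj, rfl⟩ | ⟨j, hj, h1, h2⟩
  · rw [PL_node hσ hc hj]
  · obtain ⟨l, l0, l1, et, e⟩ := PL_ratio hσ hc hj h1 h2
    rw [e, ← et]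
end

lemma PL_cont {T : Type*} [TopologicalSpace T] {N : ℕ} {σ σ' : T → ℕ → ℝ} {t : T → ℝ} {U : Set T}
    (h1 : ∀ j, ContinuousOn (fun x => σ x j) U) (h2 : ∀ j, ContinuousOn (fun x => σ' x j) U)
    (ht : ContinuousOn t U) (m1 : ∀ x ∈ U, Monotone (σ x)) (m2 : ∀ x ∈ U, Monotone (σ' x))
    (hc : ∀ x ∈ U, Coi N (σ x) (σ' x)) :
    ContinuousOn (fun x => PL N (σ x) (σ' x) (t x)) U := by
  apply (h2 0).add
  apply continuousOn_finsetSum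
  intro j hj
  rw [Finset.mem_range] at hj
  intro x hx
  simp only [plt]
  have c1 : ContinuousWithinAt (fun x => σ' x (j+1) - σ' x j) U x := (h2 (j+1) x hx).sub (h2 j x hx)
  have c2 : ContinuousWithinAt (fun x => σ x (j+1) - σ x j) U x := (h1 (j+1) x hx).sub (h1 j x hx)
  by_cases h0 : σ x j = σ x (j+1)
  · have h0' := (hc x hx j hj).mp h0
    have e0 : σ' x (j+1) - σ' x j = 0 := by linarith
    have c1' : Tendsto (fun x => σ' x (j+1) - σ' x j) (𝓝[U] x) (𝓝 0) := by
      have := c1.tendsto; simpa only [e0] using this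
    rw [ContinuousWithinAt]
    simp only [e0, zero_div, zero_mul]
    refine squeeze_zero' ?_ ?_ c1'
    · filter_upwards [self_mem_nhdsWithin] with y hy
      have a := m1 y hy (Nat.le_succ j)
      have b := m2 y hy (Nat.le_succ j)
      simp only [Nat.succ_eq_add_one] at a b
      exact mul_nonneg (div_nonneg (by linarith) (by linarith)) (le_max_left _ _)
    · filter_upwards [self_mem_nhdsWithin] with y hy
      have a := m1 y hy (Nat.le_succ j)
      have b := m2 y hy (Nat.le_succ j)
      simp only [Nat.succ_eq_add_one] at a b
      rcases a.eq_or_lt with a | a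
      · rw [a]; simp; linarith
      · rw [div_mul_eq_mul_div, div_le_iff₀ (by linarith)]
        exact mul_le_mul_of_nonneg_left (max_le (by linarith) (min_le_right _ _)) (by linarith)
  · have n : σ x (j+1) - σ x j ≠ 0 := fun h => h0 (by linarith)
    exact (c1.div c2 n).mul (continuousWithinAt_const.max (((ht x hx).sub (h1 j x hx)).min c2))

lemma PL_SF {ι : Type} {N : ℕ} {σ σ' : (ι → ℝ) → ℕ → ℝ} {t : (ι → ℝ) → ℝ}
    (h1 : ∀ j, SF (fun x => σ x j)) (h2 : ∀ j, SF (fun x => σ' x j)) (ht : SF t) :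
    SF fun x => PL N (σ x) (σ' x) (t x) := by
  apply (h2 0).add
  apply SF.sum
  intro j _
  exact (((h2 (j+1)).sub (h2 j)).div ((h1 (j+1)).sub (h1 j))).mul
    ((SF.const 0).max ((ht.sub (h1 j)).min ((h1 (j+1)).sub (h1 j))))
end

section
open Polynomial

abbrev pt {k : ℕ} (a ρ : ℝ) (z : Fin k → ℝ) : Fin 2 ⊕ Fin k → ℝ := Sum.elim ![a, ρ] z

def shear {k : ℕ} (e : Fin (k+1) → ℝ) (z : Fin k → ℝ) (t : ℝ) : Fin (k+1) → ℝ :=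
  fun i => (Fin.cons 0 z : Fin (k+1) → ℝ) i + e i * t

/-- pull back along the shear -/
def Phi {k : ℕ} (e : Fin (k+1) → ℝ) (P : MvPolynomial (Fin 2 ⊕ Fin (k+1)) ℝ) :
    (MvPolynomial (Fin 2 ⊕ Fin k) ℝ)[X] :=
  MvPolynomial.aeval (Sum.elim (fun i => C (MvPolynomial.X (Sum.inl i)))
    (fun i => (Fin.cons 0 (fun j => C (MvPolynomial.X (Sum.inr j))) : Fin (k+1) → (MvPolynomial (Fin 2 ⊕ Fin k) ℝ)[X]) i
      + C (MvPolynomial.C (e i)) * X)) P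

lemma spc_Phi {k : ℕ} (e : Fin (k+1) → ℝ) (P : MvPolynomial (Fin 2 ⊕ Fin (k+1)) ℝ)
    (x : Fin 2 ⊕ Fin k → ℝ) :
    spc (Phi e P) x = MvPolynomial.aeval (Sum.elim (fun i => C (x (Sum.inl i)))
      (fun i => C ((Fin.cons 0 (fun j => x (Sum.inr j)) : Fin (k+1) → ℝ) i) + C (e i) * X)) P := by
  rw [spc, Phi]
  induction P using MvPolynomial.induction_on with
  | C a => simp
  | add p q hp hq => simp only [map_add, Polynomial.map_add, hp, hq]
  | mul_X p i hp =>
    rw [map_mul, map_mul, Polynomial.map_mul, hp]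
    congr 1
    rcases i with i | i
    · simp
    · simp only [MvPolynomial.aeval_X, Sum.elim_inr, Polynomial.map_add, Polynomial.map_mul, map_C,
        MvPolynomial.eval_C, map_X]
      congr 1
      refine Fin.cases ?_ (fun j => ?_) i <;> simp

lemma spc_Phi_eval {k : ℕ} (e : Fin (k+1) → ℝ) (P : MvPolynomial (Fin 2 ⊕ Fin (k+1)) ℝ)
    (x : Fin 2 ⊕ Fin k → ℝ) (t : ℝ) :
    (spc (Phi e P) x).eval t =
      MvPolynomial.eval (Sum.elim (fun i => x (Sum.inl i)) (shear e (fun j => x (Sum.inr j)) t)) P := by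
  rw [spc_Phi]
  induction P using MvPolynomial.induction_on with
  | C a => simp
  | add p q hp hq => simp only [map_add, Polynomial.eval_add, hp, hq]
  | mul_X p i hp =>
    rw [map_mul, map_mul, Polynomial.eval_mul, hp]
    congr 1
    rcases i with i | i
    · simp
    · simp [shear]

lemma top_prod {k : ℕ} (z e : Fin k → ℝ) (m : Fin k → ℕ) (s : Finset (Fin k)) :
    (∏ i ∈ s, (C (z i) + C (e i) * X : ℝ[X]) ^ m i).natDegree ≤ ∑ i ∈ s, m i ∧
    (∏ i ∈ s, (C (z i) + C (e i) * X : ℝ[X]) ^ m i).coeff (∑ i ∈ s, m i) = ∏ i ∈ s, e i ^ m i := by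
  induction s using Finset.induction_on with
  | empty => simp
  | insert i s hi ih =>
    rw [Finset.prod_insert hi, Finset.sum_insert hi, Finset.prod_insert hi]
    have h1 : (C (z i) + C (e i) * X : ℝ[X]).natDegree ≤ 1 := by compute_degree
    have h2 : ((C (z i) + C (e i) * X : ℝ[X]) ^ m i).natDegree ≤ m i := by
      have := natDegree_pow_le_of_le (m i) h1; simpa using this
    have h3 : ((C (z i) + C (e i) * X : ℝ[X]) ^ m i).coeff (m i) = e i ^ m i := by
      have := coeff_pow_of_natDegree_le (m := m i) h1
      rw [mul_one] at this
      rw [this]; simp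
    exact ⟨natDegree_mul_le_of_le h2 ih.1, by rw [coeff_mul_add_eq_of_natDegree_le h2 ih.1, h3, ih.2]⟩

def wt {k : ℕ} (m : Fin 2 ⊕ Fin k →₀ ℕ) : ℕ := ∑ i, m (Sum.inr i)

def topP {k : ℕ} (P : MvPolynomial (Fin 2 ⊕ Fin k) ℝ) (D : ℕ) : MvPolynomial (Fin 2 ⊕ Fin k) ℝ :=
  ∑ m ∈ P.support with wt m = D, MvPolynomial.monomial m (P.coeff m)

lemma spc_top {k : ℕ} (e : Fin (k+1) → ℝ) (P : MvPolynomial (Fin 2 ⊕ Fin (k+1)) ℝ) (D : ℕ)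
    (hD : ∀ m ∈ P.support, wt m ≤ D) (x : Fin 2 ⊕ Fin k → ℝ) :
    (spc (Phi e P) x).natDegree ≤ D ∧ (spc (Phi e P) x).coeff D =
      MvPolynomial.eval (Sum.elim (fun i => x (Sum.inl i)) e) (topP P D) := by
  rw [spc_Phi]
  set g : Fin 2 ⊕ Fin (k+1) → ℝ[X] := (Sum.elim (fun i => C (x (Sum.inl i)))
      (fun i => C ((Fin.cons 0 (fun j => x (Sum.inr j)) : Fin (k+1) → ℝ) i) + C (e i) * X)) with hg
  have hmon : ∀ m : Fin 2 ⊕ Fin (k+1) →₀ ℕ, ∀ c : ℝ, MvPolynomial.aeval g (MvPolynomial.monomial m c) =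
      C (c * ∏ i, x (Sum.inl i) ^ m (Sum.inl i)) * ∏ i, (C ((Fin.cons 0 (fun j => x (Sum.inr j)) : Fin (k+1) → ℝ) i)
        + C (e i) * X) ^ m (Sum.inr i) := by
    intro m c
    rw [MvPolynomial.aeval_monomial, Finsupp.prod_fintype _ _ (fun i => pow_zero _), Fintype.prod_sum_type, hg]
    simp only [Sum.elim_inl, Sum.elim_inr, Polynomial.algebraMap_apply, C_mul, Algebra.algebraMap_self_apply,
      ← C_pow, ← map_prod, mul_assoc]
  have hdeg : ∀ (m : Fin 2 ⊕ Fin (k+1) →₀ ℕ) (c : ℝ), (MvPolynomial.aeval g (MvPolynomial.monomial m c)).natDegree ≤ wt m := by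
    intro m c
    rw [hmon]
    exact (natDegree_C_mul_le _ _).trans (top_prod _ e (fun i => m (Sum.inr i)) Finset.univ).1
  have hsum : MvPolynomial.aeval g P = ∑ m ∈ P.support, MvPolynomial.aeval g (MvPolynomial.monomial m (P.coeff m)) := by
    conv_lhs => rw [P.as_sum]
    rw [map_sum]
  rw [hsum]
  constructor
  · apply natDegree_sum_le_of_forall_le
    intro m hm
    exact (hdeg m _).trans (hD m hm)
  · rw [finsetSum_coeff, topP, map_sum, Finset.sum_filter]
    apply Finset.sum_congr rfl
    intro m hm
    split_ifs with h
    · rw [hmon, coeff_C_mul, ← h, wt, (top_prod _ e (fun i => m (Sum.inr i)) Finset.univ).2,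
        MvPolynomial.eval_monomial, Finsupp.prod_fintype _ _ (fun i => pow_zero _), Fintype.prod_sum_type]
      simp only [Sum.elim_inl, Sum.elim_inr, mul_assoc]
    · exact coeff_eq_zero_of_natDegree_lt (lt_of_le_of_lt (hdeg m _) (lt_of_le_of_ne (hD m hm) h))

lemma shear_exists {k : ℕ} (P : MvPolynomial (Fin 2 ⊕ Fin (k+1)) ℝ) (hP : P ≠ 0) {ε : ℝ} (hε : 0 < ε) :
    ∃ (e : Fin (k+1) → ℝ) (D : ℕ) (c : MvPolynomial (Fin 2) ℝ), (1 < e 0 ∧ e 0 < 2) ∧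
      (∀ i : Fin k, 0 < e i.succ ∧ e i.succ < ε) ∧ c ≠ 0 ∧
      ∀ a ρ (z : Fin k → ℝ), MvPolynomial.eval ![a, ρ] c ≠ 0 →
        (spc (Phi e P) (pt a ρ z)).natDegree = D ∧ spc (Phi e P) (pt a ρ z) ≠ 0 := by
  let D := P.support.sup wt
  have hD : ∀ m ∈ P.support, wt m ≤ D := fun m hm => Finset.le_sup (f := wt) hm
  have hT : topP P D ≠ 0 := by
    obtain ⟨m, hm, hmD⟩ := Finset.exists_mem_eq_sup P.support (by simpa using hP) wt
    intro h
    have := congrArg (MvPolynomial.coeff m) h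
    rw [topP, MvPolynomial.coeff_sum] at this
    simp only [MvPolynomial.coeff_monomial, Finset.sum_ite_eq', MvPolynomial.coeff_zero] at this
    rw [if_pos (Finset.mem_filter.mpr ⟨hm, hmD.symm⟩)] at this
    exact (MvPolynomial.mem_support_iff.mp hm) this
  obtain ⟨y, hy, hy0⟩ : ∃ y : Fin 2 ⊕ Fin (k+1) → ℝ, y ∈ Set.pi Set.univ (Sum.elim (fun _ => Set.Ioo (0:ℝ) 1)
      (Fin.cons (Set.Ioo 1 2) fun _ => Set.Ioo 0 ε)) ∧ MvPolynomial.eval y (topP P D) ≠ 0 := by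
    by_contra hcon
    push Not at hcon
    apply hT
    refine MvPolynomial.funext_set (s := (Sum.elim (fun _ => Set.Ioo (0:ℝ) 1)
      (Fin.cons (Set.Ioo 1 2) fun _ => Set.Ioo 0 ε))) ?_ ?_
    · rintro (i | i)
      · exact Set.Ioo_infinite one_pos
      · refine Fin.cases ?_ (fun j => ?_) i
        · exact Set.Ioo_infinite (by norm_num)
        · exact Set.Ioo_infinite hε
    · intro x hx; rw [hcon x hx, map_zero]
  let e : Fin (k+1) → ℝ := fun i => y (Sum.inr i)
  let c : MvPolynomial (Fin 2) ℝ := MvPolynomial.aeval (Sum.elim MvPolynomial.X fun i => MvPolynomial.C (e i)) (topP P D)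
  have hc : ∀ w, MvPolynomial.eval w c = MvPolynomial.eval (Sum.elim w e) (topP P D) := by
    intro w
    simp only [c]
    rw [MvPolynomial.aeval_def, MvPolynomial.hom_eval₂ (topP P D), MvPolynomial.eval, MvPolynomial.coe_eval₂Hom]
    congr 1
    · ext; simp
    · funext i; rcases i with i | i <;> simp
  refine ⟨e, D, c, hy (Sum.inr 0) (Set.mem_univ _), fun i => hy (Sum.inr i.succ) (Set.mem_univ _), ?_, ?_⟩
  · intro h
    have := hc fun i => y (Sum.inl i)
    rw [h, map_zero] at this
    apply hy0
    rw [this]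
    congr 2
    funext i; rcases i with i | i <;> rfl
  · intro a ρ z h
    obtain ⟨h1, h2⟩ := spc_top e P D hD (pt a ρ z)
    have h3 : (spc (Phi e P) (pt a ρ z)).coeff D ≠ 0 := by rw [h2]; rw [hc] at h; exact h
    exact ⟨le_antisymm h1 (le_natDegree_of_ne_zero h3), fun h => h3 (by rw [h, coeff_zero])⟩
end

section
structure Triv {k : ℕ} (F : Finset (MvPolynomial (Fin 2 ⊕ Fin k) ℝ)) (a ρ1 ρ2 : ℝ)
    (W : Set (Fin k → ℝ)) (h : ℝ → ℝ → (Fin k → ℝ) → (Fin k → ℝ)) : Prop where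
  maps : ∀ ρ ∈ Set.Icc ρ1 ρ2, ∀ ρ' ∈ Set.Icc ρ1 ρ2, ∀ z ∈ W, h ρ ρ' z ∈ W
  id : ∀ ρ ∈ Set.Icc ρ1 ρ2, ∀ z ∈ W, h ρ ρ z = z
  coc : ∀ ρ ∈ Set.Icc ρ1 ρ2, ∀ ρ' ∈ Set.Icc ρ1 ρ2, ∀ ρ'' ∈ Set.Icc ρ1 ρ2, ∀ z ∈ W,
    h ρ' ρ'' (h ρ ρ' z) = h ρ ρ'' z
  cont : ContinuousOn (fun q : ℝ × ℝ × (Fin k → ℝ) => h q.1 q.2.1 q.2.2)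
    (Set.Icc ρ1 ρ2 ×ˢ Set.Icc ρ1 ρ2 ×ˢ W)
  sf : ∀ i, SF fun q : Fin 2 ⊕ Fin k → ℝ => h (q (Sum.inl 0)) (q (Sum.inl 1)) (fun j => q (Sum.inr j)) i
  sgn : ∀ ρ ∈ Set.Icc ρ1 ρ2, ∀ ρ' ∈ Set.Icc ρ1 ρ2, ∀ z ∈ W, SSign F (pt a ρ z) (pt a ρ' (h ρ ρ' z))

def tt {k : ℕ} (e : Fin (k+1) → ℝ) (z : Fin (k+1) → ℝ) : ℝ := z 0 / e 0
def zp {k : ℕ} (e : Fin (k+1) → ℝ) (z : Fin (k+1) → ℝ) : Fin k → ℝ := fun i => z i.succ - e i.succ * tt e z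

lemma shear_zp {k : ℕ} {e : Fin (k+1) → ℝ} (he : 1 < e 0) (z : Fin (k+1) → ℝ) :
    shear e (zp e z) (tt e z) = z := by
  funext i
  refine Fin.cases ?_ (fun j => ?_) i
  · simp [shear, tt]; field_simp
  · simp [shear, zp]

lemma tt_shear {k : ℕ} {e : Fin (k+1) → ℝ} (he : 1 < e 0) (z : Fin k → ℝ) (t : ℝ) :
    tt e (shear e z t) = t := by
  simp [shear, tt]; field_simp

lemma zp_shear {k : ℕ} {e : Fin (k+1) → ℝ} (he : 1 < e 0) (z : Fin k → ℝ) (t : ℝ) :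
    zp e (shear e z t) = z := by
  funext i
  rw [zp, tt_shear he]; simp [shear]

lemma tt_cont {k : ℕ} (e : Fin (k+1) → ℝ) : Continuous (tt e) := by
  unfold tt; fun_prop
lemma zp_cont {k : ℕ} (e : Fin (k+1) → ℝ) : Continuous (zp e) := by
  have := tt_cont e
  unfold zp; fun_prop
lemma shear_cont {k : ℕ} (e : Fin (k+1) → ℝ) : Continuous fun q : (Fin k → ℝ) × ℝ => shear e q.1 q.2 := by
  apply continuous_pi
  intro i
  refine Fin.cases ?_ (fun j => ?_) i
  · simp [shear]; fun_prop
  · simp [shear]; fun_prop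

def stepW {k : ℕ} (e : Fin (k+1) → ℝ) (M : ℝ) (W : Set (Fin k → ℝ)) : Set (Fin (k+1) → ℝ) :=
  {z | zp e z ∈ W ∧ -M ≤ tt e z ∧ tt e z ≤ M}

def stepH {k : ℕ} (e : Fin (k+1) → ℝ) (N : ℕ) (σ : (Fin 2 ⊕ Fin k → ℝ) → ℕ → ℝ) (a : ℝ)
    (h : ℝ → ℝ → (Fin k → ℝ) → (Fin k → ℝ)) (ρ ρ' : ℝ) (z : Fin (k+1) → ℝ) : Fin (k+1) → ℝ :=
  shear e (h ρ ρ' (zp e z)) (PL N (σ (pt a ρ (zp e z))) (σ (pt a ρ' (h ρ ρ' (zp e z)))) (tt e z))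

def full {k : ℕ} (e : Fin (k+1) → ℝ) (x : Fin 2 ⊕ Fin k → ℝ) (t : ℝ) : Fin 2 ⊕ Fin (k+1) → ℝ :=
  Sum.elim (fun i => x (Sum.inl i)) (shear e (fun j => x (Sum.inr j)) t)

structure StepData {k : ℕ} (F : Finset (MvPolynomial (Fin 2 ⊕ Fin (k+1)) ℝ))
    (F' : Finset (MvPolynomial (Fin 2 ⊕ Fin k) ℝ)) (a ρ1 ρ2 M : ℝ) (e : Fin (k+1) → ℝ) (N : ℕ)
    (σ : (Fin 2 ⊕ Fin k → ℝ) → ℕ → ℝ) : Prop where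
  he : 1 < e 0
  sf : ∀ j, SF fun x => σ x j
  cont : ∀ j, ContinuousOn (fun q : ℝ × (Fin k → ℝ) => σ (pt a q.1 q.2) j) (Set.Icc ρ1 ρ2 ×ˢ Set.univ)
  mono : ∀ x, Monotone (σ x)
  zero : ∀ x, σ x 0 = -M
  top : ∀ x, σ x N = M
  root : ∀ ρ ∈ Set.Icc ρ1 ρ2, ∀ z, ∀ p ∈ F, p = 0 ∨ ∀ t, -M ≤ t → t ≤ M →
    MvPolynomial.eval (full e (pt a ρ z) t) p = 0 → ∃ j, σ (pt a ρ z) j = t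
  coi : ∀ x y, SSign F' x y → Coi N (σ x) (σ y)
  mid : ∀ x y, SSign F' x y → ∀ i ≤ N, ∀ j ≤ N,
    SSign F (full e x ((σ x i + σ x j) / 2)) (full e y ((σ y i + σ y j) / 2))

lemma full_cont {k : ℕ} (e : Fin (k+1) → ℝ) (x : Fin 2 ⊕ Fin k → ℝ) (p : MvPolynomial (Fin 2 ⊕ Fin (k+1)) ℝ) :
    Continuous fun t => MvPolynomial.eval (full e x t) p := by
  refine (MvPolynomial.continuous_eval p).comp ?_
  apply continuous_pi
  rintro (i | i)
  · exact continuous_const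
  · exact (continuous_apply i).comp ((shear_cont e).comp (by fun_prop : Continuous fun t : ℝ => ((fun j => x (Sum.inr j)), t)))

/-- signs are constant on a gap -/
lemma StepData.gap {k : ℕ} {F : Finset (MvPolynomial (Fin 2 ⊕ Fin (k+1)) ℝ)}
    {F' : Finset (MvPolynomial (Fin 2 ⊕ Fin k) ℝ)} {a ρ1 ρ2 M : ℝ} {e : Fin (k+1) → ℝ} {N : ℕ}
    {σ : (Fin 2 ⊕ Fin k → ℝ) → ℕ → ℝ} (H : StepData F F' a ρ1 ρ2 M e N σ) {ρ : ℝ} (hρ : ρ ∈ Set.Icc ρ1 ρ2)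
    (z : Fin k → ℝ) {j : ℕ} (hj : j < N) {t s : ℝ} (h1 : σ (pt a ρ z) j < t) (h2 : t < σ (pt a ρ z) (j+1))
    (h1' : σ (pt a ρ z) j < s) (h2' : s < σ (pt a ρ z) (j+1)) :
    SSign F (full e (pt a ρ z) t) (full e (pt a ρ z) s) := by
  intro p hp
  rcases H.root ρ hρ z p hp with rfl | hr
  · simp
  refine sign_eq_of_no_root (q := fun t => MvPolynomial.eval (full e (pt a ρ z) t) p) (full_cont e _ p) ?_
  intro c hc h0
  have hc1 : σ (pt a ρ z) j < c := lt_of_lt_of_le (lt_min h1 h1') hc.1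
  have hc2 : c < σ (pt a ρ z) (j+1) := lt_of_le_of_lt hc.2 (max_lt h2 h2')
  have m0 := H.mono (pt a ρ z) (Nat.zero_le j)
  have m1 := H.mono (pt a ρ z) (show j + 1 ≤ N from hj)
  rw [H.zero] at m0
  rw [H.top] at m1
  obtain ⟨i, hi⟩ := hr c (by linarith) (by linarith) h0
  rcases le_or_gt i j with h | h
  · have := H.mono (pt a ρ z) h; linarith
  · have := H.mono (pt a ρ z) (show j + 1 ≤ i from h); linarith

lemma StepData.triv {k : ℕ} {F : Finset (MvPolynomial (Fin 2 ⊕ Fin (k+1)) ℝ)}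
    {F' : Finset (MvPolynomial (Fin 2 ⊕ Fin k) ℝ)} {a ρ1 ρ2 M : ℝ} {e : Fin (k+1) → ℝ} {N : ℕ}
    {σ : (Fin 2 ⊕ Fin k → ℝ) → ℕ → ℝ} (H : StepData F F' a ρ1 ρ2 M e N σ) {W : Set (Fin k → ℝ)}
    {h : ℝ → ℝ → (Fin k → ℝ) → (Fin k → ℝ)} (T : Triv F' a ρ1 ρ2 W h) :
    Triv F a ρ1 ρ2 (stepW e M W) (stepH e N σ a h) := by
  have hcoi : ∀ ρ ∈ Set.Icc ρ1 ρ2, ∀ ρ' ∈ Set.Icc ρ1 ρ2, ∀ z ∈ W,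
    Coi N (σ (pt a ρ z)) (σ (pt a ρ' (h ρ ρ' z))) := fun ρ hρ ρ' hρ' z hz => H.coi _ _ (T.sgn ρ hρ ρ' hρ' z hz)
  refine ⟨?_, ?_, ?_, ?_, ?_, ?_⟩
  · rintro ρ hρ ρ' hρ' z ⟨hz, hz1, hz2⟩
    have := PL_mem (H.mono _) (H.mono _) (hcoi ρ hρ ρ' hρ' _ hz) (t := tt e z) (by rwa [H.zero]) (by rwa [H.top])
    rw [H.zero, H.top] at this
    simp only [stepW, stepH, Set.mem_setOf_eq, zp_shear H.he, tt_shear H.he]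
    exact ⟨T.maps ρ hρ ρ' hρ' _ hz, this⟩
  · rintro ρ hρ z ⟨hz, hz1, hz2⟩
    rw [stepH, T.id ρ hρ _ hz, PL_id (H.mono _) (by rwa [H.zero]) (by rwa [H.top]), shear_zp H.he]
  · rintro ρ hρ ρ' hρ' ρ'' hρ'' z ⟨hz, hz1, hz2⟩
    simp only [stepH, zp_shear H.he, tt_shear H.he, T.coc ρ hρ ρ' hρ' ρ'' hρ'' _ hz]
    rw [PL_cocycle (H.mono _) (H.mono _) (hcoi ρ hρ ρ' hρ' _ hz)]
    · have := hcoi ρ' hρ' ρ'' hρ'' _ (T.maps ρ hρ ρ' hρ' _ hz)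
      rwa [T.coc ρ hρ ρ' hρ' ρ'' hρ'' _ hz] at this
    · rwa [H.zero]
    · rwa [H.top]
  · have ch : ContinuousOn (fun q : ℝ × ℝ × (Fin (k+1) → ℝ) => h q.1 q.2.1 (zp e q.2.2))
        (Set.Icc ρ1 ρ2 ×ˢ Set.Icc ρ1 ρ2 ×ˢ stepW e M W) := by
      have hz := zp_cont e
      refine T.cont.comp (f := fun q : ℝ × ℝ × (Fin (k+1) → ℝ) => (q.1, q.2.1, zp e q.2.2)) (by fun_prop) ?_
      rintro q ⟨h1, h2, h3⟩
      exact ⟨h1, h2, h3.1⟩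
    refine (shear_cont e).comp_continuousOn (f := fun q : ℝ × ℝ × (Fin (k+1) → ℝ) =>
      (h q.1 q.2.1 (zp e q.2.2), PL N (σ (pt a q.1 (zp e q.2.2))) (σ (pt a q.2.1 (h q.1 q.2.1 (zp e q.2.2)))) (tt e q.2.2))) ?_
    refine ch.prodMk (PL_cont ?_ ?_ ?_ (fun _ _ => H.mono _) (fun _ _ => H.mono _) ?_)
    · intro j
      have hz := zp_cont e
      refine (H.cont j).comp (f := fun q : ℝ × ℝ × (Fin (k+1) → ℝ) => (q.1, zp e q.2.2)) (by fun_prop) ?_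
      rintro q ⟨h1, h2, h3⟩
      exact ⟨h1, trivial⟩
    · intro j
      refine (H.cont j).comp (f := fun q : ℝ × ℝ × (Fin (k+1) → ℝ) => (q.2.1, h q.1 q.2.1 (zp e q.2.2)))
        ((by fun_prop : ContinuousOn (fun q : ℝ × ℝ × (Fin (k+1) → ℝ) => q.2.1) _).prodMk ch) ?_
      rintro q ⟨h1, h2, h3⟩
      exact ⟨h2, trivial⟩
    · have := tt_cont e
      exact (this.comp (by fun_prop : Continuous fun q : ℝ × ℝ × (Fin (k+1) → ℝ) => q.2.2)).continuousOn
    · rintro q ⟨h1, h2, h3⟩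
      exact hcoi _ h1 _ h2 _ h3.1
  · have stt : SF fun q : Fin 2 ⊕ Fin (k+1) → ℝ => tt e (fun j => q (Sum.inr j)) :=
      (SF.coord (Sum.inr 0)).div (SF.const _)
    have szp : ∀ i, SF fun q : Fin 2 ⊕ Fin (k+1) → ℝ => zp e (fun j => q (Sum.inr j)) i := fun i =>
      (SF.coord (Sum.inr i.succ)).sub ((SF.const _).mul stt)
    have sh : ∀ i, SF fun q : Fin 2 ⊕ Fin (k+1) → ℝ =>
        h (q (Sum.inl 0)) (q (Sum.inl 1)) (zp e (fun j => q (Sum.inr j))) i := fun i =>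
      (T.sf i).comp (u := Sum.elim (fun i q => q (Sum.inl i)) fun j q => zp e (fun j => q (Sum.inr j)) j)
        (by rintro (j | j); exacts [SF.coord _, szp j])
    have sσ : ∀ (r : (Fin 2 ⊕ Fin (k+1) → ℝ) → ℝ) (w : (Fin 2 ⊕ Fin (k+1) → ℝ) → Fin k → ℝ), SF r →
        (∀ i, SF fun q => w q i) → ∀ j, SF fun q => σ (pt a (r q) (w q)) j := by
      intro r w hr hw j
      refine ((H.sf j).comp (u := Sum.elim (![fun _ => a, r]) fun j q => w q j) ?_).congr ?_
      · rintro (j | j)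
        · fin_cases j
          · exact SF.const a
          · exact hr
        · exact hw j
      · intro q
        congr 1
        funext i
        rcases i with i | i
        · fin_cases i <;> rfl
        · rfl
    have sPL : SF fun q : Fin 2 ⊕ Fin (k+1) → ℝ =>
        PL N (σ (pt a (q (Sum.inl 0)) (zp e (fun j => q (Sum.inr j)))))
         (σ (pt a (q (Sum.inl 1)) (h (q (Sum.inl 0)) (q (Sum.inl 1)) (zp e (fun j => q (Sum.inr j))))))
         (tt e (fun j => q (Sum.inr j))) :=
      PL_SF (sσ _ _ (SF.coord _) szp) (sσ _ _ (SF.coord _) sh) stt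
    intro i
    refine Fin.cases ?_ (fun j => ?_) i
    · exact (SF.const 0).add ((SF.const (e 0)).mul sPL)
    · exact (sh j).add ((SF.const (e j.succ)).mul sPL)
  · rintro ρ hρ ρ' hρ' z ⟨hz, hz1, hz2⟩
    have hs := T.sgn ρ hρ ρ' hρ' _ hz
    have hc := hcoi ρ hρ ρ' hρ' _ hz
    have e1 : pt a ρ z = full e (pt a ρ (zp e z)) (tt e z) := by
      conv_lhs => rw [← shear_zp H.he z]
      rfl
    rw [e1]
    change SSign F _ (full e (pt a ρ' (h ρ ρ' (zp e z))) (PL N (σ (pt a ρ (zp e z))) (σ (pt a ρ' (h ρ ρ' (zp e z)))) (tt e z)))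
    rcases node_or_gap (H.mono (pt a ρ (zp e z))) (N := N) (t := tt e z) (by rwa [H.zero]) (by rwa [H.top]) with
      ⟨j, hj, ht⟩ | ⟨j, hj, h1, h2⟩
    · rw [ht, PL_node (H.mono _) hc hj]
      have := H.mid _ _ hs j hj j hj
      rwa [add_self_div_two, add_self_div_two] at this
    · obtain ⟨l, l0, l1, _, el⟩ := PL_ratio (H.mono _) hc hj h1 h2
      have hlt : σ (pt a ρ' (h ρ ρ' (zp e z))) j < σ (pt a ρ' (h ρ ρ' (zp e z))) (j+1) := by
        refine lt_of_le_of_ne (H.mono _ (Nat.le_succ _)) fun hh => ?_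
        have := (hc j hj).mpr hh
        linarith
      have A := H.gap hρ (zp e z) hj h1 h2 (s := (σ (pt a ρ (zp e z)) j + σ (pt a ρ (zp e z)) (j+1)) / 2)
        (by linarith) (by linarith)
      have B := H.mid _ _ hs j hj.le (j+1) hj
      have C := H.gap hρ' (h ρ ρ' (zp e z)) hj (t := (σ (pt a ρ' (h ρ ρ' (zp e z))) j + σ (pt a ρ' (h ρ ρ' (zp e z))) (j+1)) / 2)
        (by linarith) (by linarith) (s := PL N (σ (pt a ρ (zp e z))) (σ (pt a ρ' (h ρ ρ' (zp e z)))) (tt e z))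
        (by rw [el]; nlinarith) (by rw [el]; nlinarith)
      exact fun g hg => ((A g hg).trans (B g hg)).trans (C g hg)
end

section
lemma SSign.mono {ι : Type} {G G' : Finset (MvPolynomial ι ℝ)} {x y : ι → ℝ} (h : SSign G x y) (hG : G' ⊆ G) :
    SSign G' x y := fun g hg => h g (hG hg)

lemma dets {ι : Type} {α : Type*} [Finite α] {S : α → Set (ι → ℝ)} (h : ∀ i, IsRSA ι (S i)) :
    ∃ G : Finset (MvPolynomial ι ℝ), ∀ x y, SSign G x y → ∀ i, (x ∈ S i ↔ y ∈ S i) := by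
  cases nonempty_fintype α
  choose G hG using fun i => rsa_det (h i)
  exact ⟨Finset.univ.biUnion G, fun x y hxy i => hG i x y (hxy.mono (Finset.subset_biUnion_of_mem G (Finset.mem_univ i)))⟩

lemma step_exists {k : ℕ} (F : Finset (MvPolynomial (Fin 2 ⊕ Fin (k+1)) ℝ)) {ε M : ℝ} (hε : 0 < ε) (hM : 0 < M) :
    ∃ (e : Fin (k+1) → ℝ) (F' : Finset (MvPolynomial (Fin 2 ⊕ Fin k) ℝ)) (N : ℕ) (σ : (Fin 2 ⊕ Fin k → ℝ) → ℕ → ℝ),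
      (1 < e 0 ∧ e 0 < 2) ∧ (∀ i : Fin k, 0 < e i.succ ∧ e i.succ < ε) ∧
      Ev fun a ρ1 ρ2 => StepData F F' a ρ1 ρ2 M e N σ := by
  set P : MvPolynomial (Fin 2 ⊕ Fin (k+1)) ℝ := ∏ p ∈ F.filter (· ≠ 0), p with hPdef
  have hP : P ≠ 0 := Finset.prod_ne_zero_iff.mpr fun p hp => (Finset.mem_filter.mp hp).2
  obtain ⟨e, D, c, he0, hes, hc, hdeg⟩ := shear_exists P hP hε
  let σ : (Fin 2 ⊕ Fin k → ℝ) → ℕ → ℝ := fun x j => vr M D (spc (Phi e P) x) j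
  have hsf : ∀ j, SF fun x => σ x j := fun j => vr_SF M D _ j
  have hfull : ∀ (i j : ℕ) (l : Fin 2 ⊕ Fin (k+1)), SF fun x => full e x ((σ x i + σ x j) / 2) l := by
    intro i j l
    have hm : SF fun x => (σ x i + σ x j) / 2 := ((hsf i).add (hsf j)).div (SF.const 2)
    rcases l with l | l
    · exact SF.coord _
    · refine Fin.cases ?_ (fun l => ?_) l
      · exact (SF.const 0).add ((SF.const (e 0)).mul hm)
      · exact (SF.coord (Sum.inr l)).add ((SF.const (e l.succ)).mul hm)
  obtain ⟨G1, hG1⟩ := dets (S := fun j : Fin (D+1) => {x | σ x j = σ x (j+1)})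
    (fun j => Dfn.eq (hsf j) (hsf (j+1)))
  obtain ⟨G2, hG2⟩ := dets (S := fun j : Fin (D+2) × Fin (D+2) × F × SignType =>
      {x | SignType.sign (MvPolynomial.eval (full e x ((σ x j.1 + σ x j.2.1) / 2)) j.2.2.1.1) = j.2.2.2})
    (fun j => Dfn.subst (Dfn.sgn j.2.2.1.1 j.2.2.2) (hfull j.1 j.2.1))
  refine ⟨e, G1 ∪ G2, D+1, σ, he0, hes, (ev_ne c hc).mono fun a ρ1 ρ2 _ _ _ hne => ?_⟩
  refine ⟨he0.1, hsf, ?_, fun x => monotone_nat_of_le_succ fun j => (vr_mono_bd hM D _ j).1,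
    fun x => vr_zero _ _ _, fun x => vr_top D _ _ le_rfl hM, ?_, ?_, ?_⟩
  · intro j
    have := vr_cont hM D (Phi e P) {x | ∃ ρ ∈ Set.Icc ρ1 ρ2, ∃ z, x = pt a ρ z} (by
      rintro x ⟨ρ, hρ, z, rfl⟩
      exact (hdeg a ρ z (hne ρ hρ)).1) j
    refine this.comp (f := fun q : ℝ × (Fin k → ℝ) => pt a q.1 q.2) ?_ ?_
    · apply Continuous.continuousOn
      apply continuous_pi
      rintro (i | i)
      · fin_cases i
        · exact continuous_const
        · exact continuous_fst
      · exact (continuous_apply i).comp continuous_snd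
    · rintro q ⟨hq, _⟩
      exact ⟨q.1, hq, q.2, rfl⟩
  · intro ρ hρ z p hp
    by_cases h0 : p = 0
    · exact Or.inl h0
    refine Or.inr fun t h1 h2 hr => ?_
    have hd := hdeg a ρ z (hne ρ hρ)
    apply vr_root hM D _ hd.2 hd.1 t h1 h2
    rw [spc_Phi_eval, hPdef, map_prod]
    exact Finset.prod_eq_zero (Finset.mem_filter.mpr ⟨hp, h0⟩) hr
  · intro x y hxy j hj
    exact hG1 x y (hxy.mono Finset.subset_union_left) ⟨j, hj⟩
  · intro x y hxy i hi j hj p hp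
    have := hG2 x y (hxy.mono Finset.subset_union_right) ⟨⟨i, by omega⟩, ⟨j, by omega⟩, ⟨p, hp⟩,
      SignType.sign (MvPolynomial.eval (full e x ((σ x i + σ x j) / 2)) p)⟩
    exact (this.mp (Eq.refl _)).symm

lemma triv_zero (F : Finset (MvPolynomial (Fin 2 ⊕ Fin 0) ℝ)) :
    Ev fun a ρ1 ρ2 => Triv F a ρ1 ρ2 Set.univ fun _ _ z => z := by
  have : Ev fun a ρ1 ρ2 => ∀ i : F × SignType,
      (∀ ρ ∈ Set.Icc ρ1 ρ2, ![a, ρ] ∈ {x | SignType.sign (MvPolynomial.eval (Sum.elim x Fin.elim0 : Fin 2 ⊕ Fin 0 → ℝ) i.1.1) = i.2}) ∨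
      (∀ ρ ∈ Set.Icc ρ1 ρ2, ![a, ρ] ∉ {x | SignType.sign (MvPolynomial.eval (Sum.elim x Fin.elim0 : Fin 2 ⊕ Fin 0 → ℝ) i.1.1) = i.2}) := by
    apply Ev.allF
    intro i
    apply ev_dich
    exact Dfn.subst (κ := Fin 2 ⊕ Fin 0) (Dfn.sgn i.1.1 i.2) (u := fun j x => (Sum.elim x Fin.elim0 : Fin 2 ⊕ Fin 0 → ℝ) j) (by
      rintro (j | j)
      · exact SF.coord j
      · exact j.elim0)
  refine this.mono fun a ρ1 ρ2 _ _ _ H => ⟨fun _ _ _ _ _ _ => trivial, fun _ _ _ _ => rfl, fun _ _ _ _ _ _ _ _ => rfl,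
    by fun_prop, fun i => i.elim0, ?_⟩
  intro ρ hρ ρ' hρ' z _ p hp
  obtain rfl : z = Fin.elim0 := Subsingleton.elim _ _
  rcases H ⟨⟨p, hp⟩, SignType.sign (MvPolynomial.eval (Sum.elim ![a, ρ] Fin.elim0 : Fin 2 ⊕ Fin 0 → ℝ) p)⟩ with h | h
  · exact (h ρ' hρ').symm
  · exact absurd rfl (h ρ hρ)

lemma mono_ev {u : (Fin 2 → ℝ) → ℝ} (hu : SF u) :
    Ev fun a ρ1 ρ2 => ContinuousOn (fun ρ => u ![a, ρ]) (Set.Icc ρ1 ρ2) → u ![a, ρ1] < u ![a, ρ2] →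
      StrictMonoOn (fun ρ => u ![a, ρ]) (Set.Icc ρ1 ρ2) := by
  have hsub : ∀ {ι : Type} {x y : (ι → ℝ) → ℝ}, SF x → SF y → SF fun z => u ![x z, y z] := by
    intro ι x y hx hy
    refine (hu.comp (u := ![x, y]) ?_).congr ?_
    · intro j; fin_cases j <;> assumption
    · intro z; congr 1; funext j; fin_cases j <;> rfl
  have hR : IsRSA (Fin 2) {x | ∃ δ, 0 < δ ∧ ∀ s, x 1 < s → s < x 1 + δ → u ![x 0, x 1] < u ![x 0, s]} := by
    apply Dfn.ex (q := fun x δ => 0 < δ ∧ ∀ s, x 1 < s → s < x 1 + δ → u ![x 0, x 1] < u ![x 0, s])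
    refine (Dfn.lt (SF.const 0) (SF.coord none)).and ?_
    apply Dfn.all (q := fun (z : Option (Fin 2) → ℝ) s => z (some 1) < s → s < z (some 1) + z none →
      u ![z (some 0), z (some 1)] < u ![z (some 0), s])
    exact (Dfn.lt (SF.coord _) (SF.coord _)).imp ((Dfn.lt (SF.coord _) ((SF.coord _).add (SF.coord _))).imp
      (Dfn.lt (hsub (SF.coord _) (SF.coord _)) (hsub (SF.coord _) (SF.coord _))))
  refine (ev_dich hR).mono fun a ρ1 ρ2 _ _ hlt H hc hu12 => ?_
  rcases H with H | H
  · intro x hx y hy hxy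
    have key : ∀ m ∈ Set.Icc x y, m < y → ∃ s ∈ Set.Icc x y, u ![a, m] < u ![a, s] := by
      intro m hm hmy
      obtain ⟨δ, hδ, h⟩ := H m ⟨hx.1.trans hm.1, hm.2.trans hy.2⟩
      simp at h
      refine ⟨min y (m + δ/2), ⟨le_min hxy.le (by linarith [hm.1]), min_le_left _ _⟩, h _ (lt_min hmy (by linarith)) ?_⟩
      exact (min_le_right _ _).trans_lt (by linarith)
    obtain ⟨m, hm, hmax⟩ := isCompact_Icc.exists_isMaxOn (Set.nonempty_Icc.mpr hxy.le)
      (hc.mono (Set.Icc_subset_Icc hx.1 hy.2))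
    have hmy : m = y := by
      by_contra hne
      obtain ⟨s, hs, h⟩ := key m hm (lt_of_le_of_ne hm.2 hne)
      exact absurd (hmax hs) (not_le.mpr h)
    subst hmy
    obtain ⟨s, hs, h⟩ := key x ⟨le_rfl, hxy.le⟩ hxy
    exact h.trans_le (hmax hs)
  · exfalso
    have key : ∀ m ∈ Set.Icc ρ1 ρ2, ∀ᶠ s in 𝓝[>] m, u ![a, s] ≤ u ![a, m] := by
      intro m hm
      have hS : IsRSA (Fin 3) {x | x 2 < u ![x 0, x 1]} := Dfn.lt (SF.coord 2) (hsub (SF.coord 0) (SF.coord 1))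
      rcases right_dich hS ![Polynomial.C a, Polynomial.X, Polynomial.C (u ![a, m])] m with h | h
      · exfalso
        apply H m hm
        obtain ⟨b, hb, h⟩ := mem_nhdsGT_iff_exists_Ioo_subset.mp h
        refine ⟨b - m, sub_pos.mpr hb, fun s h1 h2 => ?_⟩
        have := h (show s ∈ Set.Ioo m b from ⟨h1, by simpa using h2⟩)
        simpa using this
      · filter_upwards [h] with s hs
        simpa using hs
    set η := (u ![a, ρ2] - u ![a, ρ1]) / (2 * (ρ2 - ρ1)) with hη
    have hη0 : 0 < η := div_pos (by linarith) (by linarith)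
    have hη1 : η * (ρ2 - ρ1) = (u ![a, ρ2] - u ![a, ρ1]) / 2 := by
      rw [hη]; field_simp [show ρ2 - ρ1 ≠ 0 by linarith]
    obtain ⟨m, hm, hmin⟩ := isCompact_Icc.exists_isMinOn (Set.nonempty_Icc.mpr hlt.le)
      (hc.sub (by fun_prop : ContinuousOn (fun s => η * s) (Set.Icc ρ1 ρ2)))
    have hmy : m = ρ2 := by
      by_contra hne
      have hlt := lt_of_le_of_ne hm.2 hne
      obtain ⟨s, hs, hs2⟩ := ((key m hm).and (Ioo_mem_nhdsGT hlt)).exists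
      have := hmin (show s ∈ Set.Icc ρ1 ρ2 from ⟨hm.1.trans hs2.1.le, hs2.2.le⟩)
      simp at this
      nlinarith [hs2.1]
    subst hmy
    have := hmin (show ρ1 ∈ Set.Icc ρ1 m from ⟨le_rfl, hlt.le⟩)
    simp at this
    nlinarith
end

section
lemma stepW_ball {k : ℕ} {e : Fin (k+1) → ℝ} {M : ℝ} {W : Set (Fin k → ℝ)} (hM : 0 < M) (he : 1 < e 0)
    (hes : ∀ i : Fin k, 0 < e i.succ ∧ e i.succ < 1) (hW : Metric.closedBall 0 (2 * M) ⊆ W) :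
    Metric.closedBall 0 M ⊆ stepW e M W := by
  intro z hz
  rw [mem_closedBall_zero_iff] at hz
  have ht : |tt e z| ≤ M := by
    rw [tt, abs_div, abs_of_pos (by linarith : 0 < e 0), div_le_iff₀ (by linarith)]
    have := (norm_le_pi_norm z 0).trans hz
    rw [Real.norm_eq_abs] at this
    nlinarith
  refine ⟨hW ?_, (abs_le.mp ht).1, (abs_le.mp ht).2⟩
  rw [mem_closedBall_zero_iff, pi_norm_le_iff_of_nonneg (by linarith)]
  intro i
  have h1 := (norm_le_pi_norm z i.succ).trans hz
  rw [Real.norm_eq_abs] at h1 ⊢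
  have h2 := abs_le.mp h1
  have h3 := abs_le.mp ht
  obtain ⟨h4, h5⟩ := hes i
  have h6 : |e i.succ * tt e z| ≤ M := by
    rw [abs_mul, abs_of_pos h4]; nlinarith [abs_nonneg (tt e z)]
  have h7 := abs_le.mp h6
  rw [zp, abs_le]; constructor <;> linarith

def MonoP {k : ℕ} (Rel : ℝ → ℝ → Prop) (v : (Fin k → ℝ) → ℝ) (ρ1 ρ2 : ℝ) (W : Set (Fin k → ℝ))
    (h : ℝ → ℝ → (Fin k → ℝ) → (Fin k → ℝ)) : Prop :=
  ∀ z ∈ W, ∀ ρ ∈ Set.Icc ρ1 ρ2, Rel ρ (v z) → StrictMonoOn (fun ρ' => v (h ρ ρ' z)) (Set.Icc ρ1 ρ2)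

lemma tower_zero (F : Finset (MvPolynomial (Fin 2 ⊕ Fin 1) ℝ)) {M : ℝ} (hM : 0 < M)
    {Rel : ℝ → ℝ → Prop} (hRel : Dfn fun x : Fin 2 → ℝ => Rel (x 0) (x 1)) (hcl : ∀ ρ, IsClosed {v | Rel ρ v}) :
    Ev fun a ρ1 ρ2 => (∀ u w, Rel ρ1 u → Rel ρ2 w → u < w) → ∃ W h, Metric.closedBall 0 M ⊆ W ∧
      Triv F a ρ1 ρ2 W h ∧ MonoP Rel (fun z : Fin 1 → ℝ => z 0) ρ1 ρ2 W h := by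
  obtain ⟨G, hG⟩ := rsa_det (Dfn.ren hRel (![Sum.inl 1, Sum.inr 0] : Fin 2 → Fin 2 ⊕ Fin 1))
  obtain ⟨e, F', N, σ, he0, hes, hE⟩ := step_exists (F ∪ G) one_pos hM
  by_cases hEE : ∀ j, SF fun x => σ x j
  swap
  · refine hE.mono fun a ρ1 ρ2 _ _ _ H => absurd H.sf hEE
  have hmono := Ev.allF (α := Fin (N+1)) fun j => mono_ev (u := fun x : Fin 2 → ℝ =>
    σ (Sum.elim x Fin.elim0 : Fin 2 ⊕ Fin 0 → ℝ) j) ((hEE j).comp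
      (u := fun j x => (Sum.elim x Fin.elim0 : Fin 2 ⊕ Fin 0 → ℝ) j) (by
      rintro (j | j)
      · exact SF.coord j
      · exact j.elim0))
  refine ((hE.and (triv_zero F')).and hmono).mono ?_
  rintro a ρ1 ρ2 - - hlt ⟨⟨H, T0⟩, hmono⟩ sep
  have T := H.triv T0
  refine ⟨_, _, stepW_ball hM he0.1 hes (Set.subset_univ _), ⟨T.maps, T.id, T.coc, T.cont, T.sf,
    fun ρ hρ ρ' hρ' z hz => (T.sgn ρ hρ ρ' hρ' z hz).mono Finset.subset_union_left⟩, ?_⟩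
  have m1 : ρ1 ∈ Set.Icc ρ1 ρ2 := ⟨le_rfl, hlt.le⟩
  have m2 : ρ2 ∈ Set.Icc ρ1 ρ2 := ⟨hlt.le, le_rfl⟩
  have hrel : ∀ (x y : Fin 2 ⊕ Fin 1 → ℝ), SSign (F ∪ G) x y →
      (Rel (x (Sum.inl 1)) (x (Sum.inr 0)) ↔ Rel (y (Sum.inl 1)) (y (Sum.inr 0))) := fun x y hxy =>
    hG x y (hxy.mono Finset.subset_union_right)
  set s : ℝ → ℕ → ℝ := fun ρ j => σ (pt a ρ Fin.elim0) j with hs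
  have hsm : ∀ ρ, Monotone (s ρ) := fun ρ => H.mono _
  have he : 0 < e 0 := by linarith [he0.1]
  have hfull : ∀ ρ t, (full e (pt a ρ Fin.elim0) t) (Sum.inr 0) = e 0 * t := by
    intro ρ t; simp [full, shear]
  -- nodes
  have hcoi : ∀ ρ ∈ Set.Icc ρ1 ρ2, ∀ ρ' ∈ Set.Icc ρ1 ρ2, Coi N (s ρ) (s ρ') := fun ρ hρ ρ' hρ' =>
    H.coi _ _ (T0.sgn ρ hρ ρ' hρ' Fin.elim0 trivial)
  have node : ∀ ρ ∈ Set.Icc ρ1 ρ2, ∀ j ≤ N, Rel ρ (e 0 * s ρ j) → StrictMonoOn (fun ρ' => s ρ' j) (Set.Icc ρ1 ρ2) := by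
    intro ρ hρ j hj hr
    have tr : ∀ ρ' ∈ Set.Icc ρ1 ρ2, Rel ρ' (e 0 * s ρ' j) := by
      intro ρ' hρ'
      have := H.mid _ _ (T0.sgn ρ hρ ρ' hρ' Fin.elim0 trivial) j hj j hj
      rw [add_self_div_two, add_self_div_two] at this
      have := hrel _ _ this
      rw [hfull, hfull] at this
      exact this.mp hr
    have hlt2 : s ρ1 j < s ρ2 j := lt_of_mul_lt_mul_left (sep _ _ (tr ρ1 m1) (tr ρ2 m2)) he.le
    refine hmono ⟨j, by omega⟩ ?_ hlt2
    exact (H.cont j).comp (f := fun ρ : ℝ => (ρ, (Fin.elim0 : Fin 0 → ℝ))) (by fun_prop) fun ρ hρ => ⟨hρ, trivial⟩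
  rintro z ⟨_, hz1, hz2⟩ ρ hρ hr
  have e1 : ∀ ρ', stepH e N σ a (fun _ _ z => z) ρ ρ' z 0 = e 0 * PL N (s ρ) (s ρ') (tt e z) := by
    intro ρ'
    have : zp e z = Fin.elim0 := Subsingleton.elim _ _
    simp [stepH, shear, this, hs]
  simp only [e1]
  have hz0 : z 0 = e 0 * tt e z := by rw [tt]; field_simp
  simp only [hz0] at hr
  rcases node_or_gap (hsm ρ) (N := N) (t := tt e z) (by rw [hs]; simpa only [H.zero] using hz1)
      (by rw [hs]; simpa only [H.top] using hz2) with ⟨j, hj, ht⟩ | ⟨j, hj, h1, h2⟩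
  · rw [ht] at hr ⊢
    intro x hx y hy hxy
    simp only
    rw [PL_node (hsm ρ) (hcoi ρ hρ x hx) hj, PL_node (hsm ρ) (hcoi ρ hρ y hy) hj]
    exact mul_lt_mul_of_pos_left (node ρ hρ j hj hr hx hy hxy) he
  · have gap : ∀ t, s ρ j < t → t < s ρ (j+1) → Rel ρ (e 0 * t) := by
      intro t t1 t2
      have := hrel _ _ (H.gap hρ Fin.elim0 hj h1 h2 t1 t2)
      rw [hfull, hfull] at this
      exact this.mp hr
    have hclos : ∀ t ∈ Set.Icc (s ρ j) (s ρ (j+1)), Rel ρ (e 0 * t) := by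
      have hc : IsClosed {t | Rel ρ (e 0 * t)} := (hcl ρ).preimage (by fun_prop : Continuous fun t => e 0 * t)
      rw [← closure_Ioo (by linarith : s ρ j ≠ s ρ (j+1))]
      exact closure_minimal (fun t ht => gap t ht.1 ht.2) hc
    have n1 := node ρ hρ j hj.le (hclos _ ⟨le_rfl, by linarith⟩)
    have n2 := node ρ hρ (j+1) hj (hclos _ ⟨by linarith, le_rfl⟩)
    intro x hx y hy hxy
    have a1 := n1 hx hy hxy
    have a2 := n2 hx hy hxy
    simp only at a1 a2 ⊢
    apply mul_lt_mul_of_pos_left _ he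
    rw [PL_gap (hsm ρ) (hcoi ρ hρ x hx) hj h1.le h2.le, PL_gap (hsm ρ) (hcoi ρ hρ y hy) hj h1.le h2.le]
    have hd : 0 < s ρ (j+1) - s ρ j := by linarith
    set l := (tt e z - s ρ j) / (s ρ (j+1) - s ρ j) with hl
    have l0 : 0 < l := div_pos (by linarith) hd
    have l1 : l < 1 := (div_lt_one hd).mpr (by linarith)
    have r1 : ∀ w, w / (s ρ (j+1) - s ρ j) * (tt e z - s ρ j) = w * l := by intro w; rw [hl]; ring
    rw [r1, r1]
    nlinarith

theorem tower (k : ℕ) : ∀ (F : Finset (MvPolynomial (Fin 2 ⊕ Fin (k+1)) ℝ)) (ε M : ℝ), 0 < ε → 0 < M →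
    ∀ (Rel : ℝ → ℝ → Prop), (Dfn fun x : Fin 2 → ℝ => Rel (x 0) (x 1)) → (∀ ρ, IsClosed {v | Rel ρ v}) →
    ∃ v : (Fin (k+1) → ℝ) → ℝ, Continuous v ∧ SF v ∧ (∀ z, |v z - z (Fin.last k)| ≤ ε * ‖z‖) ∧
    Ev fun a ρ1 ρ2 => (∀ u w, Rel ρ1 u → Rel ρ2 w → u < w) → ∃ W h, Metric.closedBall 0 M ⊆ W ∧
      Triv F a ρ1 ρ2 W h ∧ MonoP Rel v ρ1 ρ2 W h := by
  induction k with
  | zero =>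
    intro F ε M hε hM Rel hRel hcl
    refine ⟨fun z => z 0, by fun_prop, SF.coord 0, ?_, tower_zero F hM hRel hcl⟩
    intro z
    have : Fin.last 0 = 0 := rfl
    rw [this, sub_self, abs_zero]; positivity
  | succ k ih =>
    intro F ε M hε hM Rel hRel hcl
    obtain ⟨e, F', N, σ, he0, hes, hE⟩ := step_exists F (lt_min one_pos (by linarith : 0 < ε/4)) hM
    obtain ⟨v, vc, vsf, vb, hv⟩ := ih F' (ε/4) (2*M) (by linarith) (by linarith) Rel hRel hcl
    refine ⟨fun z => v (zp e z), vc.comp (zp_cont e), ?_, ?_, ?_⟩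
    · exact vsf.comp (u := fun i z => zp e z i) fun i =>
        (SF.coord i.succ).sub ((SF.const _).mul ((SF.coord 0).div (SF.const _)))
    · intro z
      have hes' : ∀ i : Fin (k+1), 0 < e i.succ ∧ e i.succ < 1 := fun i => ⟨(hes i).1, (hes i).2.trans_le (min_le_left _ _)⟩
      have ht : |tt e z| ≤ ‖z‖ := by
        rw [tt, abs_div, abs_of_pos (by linarith : 0 < e 0), div_le_iff₀ (by linarith)]
        have := norm_le_pi_norm z 0
        rw [Real.norm_eq_abs] at this
        nlinarith [norm_nonneg z]
      have h6 : ∀ i : Fin (k+1), |e i.succ * tt e z| ≤ e i.succ * ‖z‖ := by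
        intro i
        rw [abs_mul, abs_of_pos (hes i).1]; exact mul_le_mul_of_nonneg_left ht (hes i).1.le
      have hzp : ‖zp e z‖ ≤ 2 * ‖z‖ := by
        rw [pi_norm_le_iff_of_nonneg (by positivity)]
        intro i
        have h1 := norm_le_pi_norm z i.succ
        rw [Real.norm_eq_abs] at h1 ⊢
        have h7 := h6 i
        have := abs_sub (z i.succ) (e i.succ * tt e z)
        rw [zp]
        nlinarith [norm_nonneg z, (hes' i).2]
      have b1 := vb (zp e z)
      have b2 : zp e z (Fin.last k) - z (Fin.last (k+1)) = - (e (Fin.last k).succ * tt e z) := by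
        rw [zp, Fin.succ_last]; ring
      have b3 := h6 (Fin.last k)
      have b4 : e (Fin.last k).succ < ε / 4 := (hes _).2.trans_le (min_le_right _ _)
      have b5 := abs_add_le (v (zp e z) - zp e z (Fin.last k)) (zp e z (Fin.last k) - z (Fin.last (k+1)))
      rw [b2, abs_neg] at b5
      have b6 : v (zp e z) - z (Fin.last (k+1)) = v (zp e z) - zp e z (Fin.last k) + -(e (Fin.last k).succ * tt e z) := by
        rw [← b2]; ring
      rw [b6]
      nlinarith [norm_nonneg z]
    · refine (hE.and hv).mono ?_
      rintro a ρ1 ρ2 - - hlt ⟨H, hv⟩ sep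
      obtain ⟨W, h, hW, T, hm⟩ := hv sep
      refine ⟨_, _, stepW_ball hM he0.1 (fun i => ⟨(hes i).1, (hes i).2.trans_le (min_le_left _ _)⟩) hW, H.triv T, ?_⟩
      rintro z ⟨hz, _⟩ ρ hρ hr
      have := hm _ hz ρ hρ hr
      simpa only [stepH, zp_shear H.he] using this
end

section
lemma glue {T E : Type*} [TopologicalSpace T] [TopologicalSpace E] {A : Set T} {d : T → ℝ} {c : ℝ}
    (hd : ContinuousOn d A) {g1 g2 : T → E} (h1 : ContinuousOn g1 (A ∩ {x | d x ≤ c}))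
    (h2 : ContinuousOn g2 (A ∩ {x | c ≤ d x})) (heq : ∀ x ∈ A, d x = c → g1 x = g2 x) :
    ContinuousOn (fun x => if d x ≤ c then g1 x else g2 x) A := by
  rw [continuousOn_iff_continuous_restrict] at hd ⊢
  refine continuous_if_le (f := fun x : A => d x) (g := fun _ => c) (f' := fun x : A => g1 x) (g' := fun x : A => g2 x)
    hd continuous_const ?_ ?_ fun x hx => heq x x.2 hx
  · exact h1.comp (continuous_subtype_val.continuousOn) fun x hx => ⟨x.2, hx⟩
  · exact h2.comp (continuous_subtype_val.continuousOn) fun x hx => ⟨x.2, hx⟩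

lemma graph_dfn {n : ℕ} {φ : (Fin n → ℝ) → (Fin n → ℝ)} {A : Set (Fin n → ℝ)} (hφ : ∀ j, SF fun x => φ x j)
    (hA : IsRSA (Fin n) A) : IsRSA (Fin n ⊕ Fin n) (graphMapOn φ A) := by
  have h1 : Dfn fun z : Fin n ⊕ Fin n → ℝ => (fun i => z (Sum.inl i)) ∈ A := Dfn.ren hA Sum.inl
  have h2 : Dfn fun z : Fin n ⊕ Fin n → ℝ => ∀ j, z (Sum.inr j) = φ (fun i => z (Sum.inl i)) j :=
    Dfn.allF fun j => Dfn.eq (SF.coord _) ((hφ j).ren Sum.inl)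
  refine (h1.and h2).congr fun z => ?_
  simp only [funext_iff]

lemma IsSemialgHomeo.symm {n : ℕ} {A B : Set (Fin n → ℝ)} (h : IsSemialgHomeo A B) : IsSemialgHomeo B A := by
  obtain ⟨φ, ψ, h1, h2, h3, h4, h5, h6, h7, h8⟩ := h
  exact ⟨ψ, φ, h2, h1, h4, h3, h6, h5, h8, h7⟩

lemma graph_comp {n : ℕ} {A B : Set (Fin n → ℝ)} {φ φ' : (Fin n → ℝ) → (Fin n → ℝ)} (hm : Set.MapsTo φ A B)
    (h : IsRSA (Fin n ⊕ Fin n) (graphMapOn φ A)) (h' : IsRSA (Fin n ⊕ Fin n) (graphMapOn φ' B)) :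
    IsRSA (Fin n ⊕ Fin n) (graphMapOn (φ' ∘ φ) A) := by
  have := Dfn.exs (ι := Fin n ⊕ Fin n) (κ := Fin n) (q := fun z y =>
    (Sum.elim (fun i => z (Sum.inl i)) y : Fin n ⊕ Fin n → ℝ) ∈ graphMapOn φ A ∧
    (Sum.elim y (fun i => z (Sum.inr i)) : Fin n ⊕ Fin n → ℝ) ∈ graphMapOn φ' B) (by
    refine Dfn.and ?_ ?_
    · refine (Dfn.ren h (Sum.elim (fun i => Sum.inl (Sum.inl i)) Sum.inr : Fin n ⊕ Fin n → (Fin n ⊕ Fin n) ⊕ Fin n)).congr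
        fun z => ?_
      rw [iff_iff_eq]; congr 1; funext i; rcases i with i | i <;> rfl
    · refine (Dfn.ren h' (Sum.elim Sum.inr (fun i => Sum.inl (Sum.inr i)) : Fin n ⊕ Fin n → (Fin n ⊕ Fin n) ⊕ Fin n)).congr
        fun z => ?_
      rw [iff_iff_eq]; congr 1; funext i; rcases i with i | i <;> rfl)
  refine Dfn.congr this fun z => ?_
  constructor
  · rintro ⟨h1, h2⟩
    exact ⟨φ (fun i => z (Sum.inl i)), ⟨h1, rfl⟩, ⟨hm h1, h2⟩⟩
  · rintro ⟨y, ⟨h1, h2⟩, ⟨h3, h4⟩⟩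
    refine ⟨h1, ?_⟩
    have h2' : y = φ (fun i => z (Sum.inl i)) := h2
    rw [Function.comp, ← h2']
    exact h4

lemma IsSemialgHomeo.trans {n : ℕ} {A B C : Set (Fin n → ℝ)} (h : IsSemialgHomeo A B) (h' : IsSemialgHomeo B C) :
    IsSemialgHomeo A C := by
  obtain ⟨φ, ψ, h1, h2, h3, h4, h5, h6, h7, h8⟩ := h
  obtain ⟨φ', ψ', h1', h2', h3', h4', h5', h6', h7', h8'⟩ := h'
  refine ⟨φ' ∘ φ, ψ ∘ ψ', h1'.comp h1, h2.comp h2', ?_, ?_, h5'.comp h5 h1, h6.comp h6' h2', graph_comp h1 h7 h7',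
    graph_comp h2' h8' h8⟩
  · intro x hx; simp only [Function.comp]; rw [h3' _ (h1 hx), h3 _ hx]
  · intro x hx; simp only [Function.comp]; rw [h4 _ (h2' hx), h4' _ hx]

/-- trajectories of the function `d` on `Y` over `[ρ1, ρ2]` along which `v` increases -/
structure Flow {n : ℕ} (Y : Set (Fin n → ℝ)) (d v : (Fin n → ℝ) → ℝ) (ρ1 ρ2 r : ℝ)
    (H : ℝ → (Fin n → ℝ) → (Fin n → ℝ)) : Prop where
  hY : IsRSA (Fin n) Y
  dc : ContinuousOn d Y
  vc : ContinuousOn v Y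
  ds : SF d
  vs : SF v
  hlt : ρ1 < r ∧ r < ρ2
  mem : ∀ x ∈ Y, d x ∈ Set.Icc ρ1 ρ2 → ∀ ρ ∈ Set.Icc ρ1 ρ2, H ρ x ∈ Y ∧ d (H ρ x) = ρ
  id : ∀ x ∈ Y, d x ∈ Set.Icc ρ1 ρ2 → H (d x) x = x
  coc : ∀ x ∈ Y, d x ∈ Set.Icc ρ1 ρ2 → ∀ ρ ∈ Set.Icc ρ1 ρ2, ∀ ρ' ∈ Set.Icc ρ1 ρ2, H ρ' (H ρ x) = H ρ' x
  cont : ContinuousOn (fun q : ℝ × (Fin n → ℝ) => H q.1 q.2) (Set.Icc ρ1 ρ2 ×ˢ {x | x ∈ Y ∧ d x ∈ Set.Icc ρ1 ρ2})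
  sf : ∀ i, SF fun q : Option (Fin n) → ℝ => H (q none) (fun j => q (some j)) i
  mono : ∀ x ∈ Y, d x ∈ Set.Icc ρ1 ρ2 → StrictMonoOn (fun ρ => v (H ρ x)) (Set.Icc ρ1 ρ2)
  lo : ∀ x ∈ Y, d x ≤ ρ1 → v x < r
  hi : ∀ x ∈ Y, ρ2 ≤ d x → r < v x

section
variable {n : ℕ} {Y : Set (Fin n → ℝ)} {d v : (Fin n → ℝ) → ℝ} {ρ1 ρ2 r : ℝ} {H : ℝ → (Fin n → ℝ) → (Fin n → ℝ)}

def mv (d : (Fin n → ℝ) → ℝ) (ρ1 : ℝ) (H : ℝ → (Fin n → ℝ) → (Fin n → ℝ)) (u : (Fin n → ℝ) → ℝ) (x : Fin n → ℝ) :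
    Fin n → ℝ := if d x ≤ ρ1 then x else H (ρ1 + (d x - ρ1) * u x) x

lemma Flow.mv_sf (K : Flow Y d v ρ1 ρ2 r H) {u : (Fin n → ℝ) → ℝ} (hu : SF u) (j : Fin n) :
    SF fun x => mv d ρ1 H u x j := by
  have h1 : SF fun x => H (ρ1 + (d x - ρ1) * u x) x j :=
    (K.sf j).comp (u := fun o x => o.elim (ρ1 + (d x - ρ1) * u x) x) (by
      rintro (_ | i)
      · exact (SF.const _).add ((K.ds.sub (SF.const _)).mul hu)
      · exact SF.coord i)
  refine (SF.ite (Dfn.le K.ds (SF.const ρ1)) (SF.coord j) h1).congr fun x => ?_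
  rw [mv]; split_ifs <;> rfl

lemma Flow.mv_cont (K : Flow Y d v ρ1 ρ2 r H) {u : (Fin n → ℝ) → ℝ} {A : Set (Fin n → ℝ)} (hA : A ⊆ Y)
    (hu : ContinuousOn u {x | x ∈ Y ∧ d x ∈ Set.Icc ρ1 ρ2})
    (hA2 : ∀ x ∈ A, ρ1 ≤ d x → d x ≤ ρ2 ∧ ρ1 + (d x - ρ1) * u x ∈ Set.Icc ρ1 ρ2) :
    ContinuousOn (mv d ρ1 H u) A := by
  refine glue (K.dc.mono hA) continuousOn_id ?_ ?_
  · have s : A ∩ {x | ρ1 ≤ d x} ⊆ {x | x ∈ Y ∧ d x ∈ Set.Icc ρ1 ρ2} := fun x hx => ⟨hA hx.1, hx.2, (hA2 x hx.1 hx.2).1⟩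
    refine K.cont.comp (f := fun x => (ρ1 + (d x - ρ1) * u x, x)) ?_ ?_
    · have c1 := K.dc.mono (s.trans fun x hx => hx.1)
      have c2 := hu.mono s
      exact (continuousOn_const.add ((c1.sub continuousOn_const).mul c2)).prodMk continuousOn_id
    · intro x hx
      exact ⟨(hA2 x hx.1 hx.2).2, s hx⟩
  · intro x hx hd
    have hI : d x ∈ Set.Icc ρ1 ρ2 := ⟨hd.ge, by rw [hd]; linarith [K.hlt.1, K.hlt.2]⟩
    have := K.id x (hA hx) hI
    rw [hd] at this ⊢
    simp [this]

/-- crossing parameter -/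
def crs (Y : Set (Fin n → ℝ)) (d v : (Fin n → ℝ) → ℝ) (ρ1 ρ2 r : ℝ) (H : ℝ → (Fin n → ℝ) → (Fin n → ℝ))
    (x : Fin n → ℝ) : ℝ :=
  if h : (x ∈ Y ∧ d x ∈ Set.Icc ρ1 ρ2) ∧ ∃ s ∈ Set.Icc ρ1 ρ2, v (H s x) = r then h.2.choose else 0

lemma Flow.ex_crs (K : Flow Y d v ρ1 ρ2 r H) {x : Fin n → ℝ} (hx : x ∈ Y) (hd : d x ∈ Set.Icc ρ1 ρ2) :
    ∃ s ∈ Set.Icc ρ1 ρ2, v (H s x) = r := by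
  have hle : ρ1 ≤ ρ2 := by linarith [K.hlt.1, K.hlt.2]
  have hc : ContinuousOn (fun s => v (H s x)) (Set.Icc ρ1 ρ2) := by
    refine K.vc.comp (K.cont.comp (f := fun s => (s, x)) (by fun_prop) fun s hs => ⟨hs, hx, hd⟩)
      fun s hs => (K.mem x hx hd s hs).1
  have m1 : ρ1 ∈ Set.Icc ρ1 ρ2 := ⟨le_rfl, hle⟩
  have m2 : ρ2 ∈ Set.Icc ρ1 ρ2 := ⟨hle, le_rfl⟩
  have := intermediate_value_Icc hle hc
  obtain ⟨s, hs, h⟩ := this ⟨(K.lo _ (K.mem x hx hd _ m1).1 (K.mem x hx hd _ m1).2.le).le,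
    (K.hi _ (K.mem x hx hd _ m2).1 (K.mem x hx hd _ m2).2.ge).le⟩
  exact ⟨s, hs, h⟩

lemma Flow.crs_spec (K : Flow Y d v ρ1 ρ2 r H) {x : Fin n → ℝ} (hx : x ∈ Y) (hd : d x ∈ Set.Icc ρ1 ρ2) :
    crs Y d v ρ1 ρ2 r H x ∈ Set.Icc ρ1 ρ2 ∧ v (H (crs Y d v ρ1 ρ2 r H x) x) = r := by
  have h : (x ∈ Y ∧ d x ∈ Set.Icc ρ1 ρ2) ∧ ∃ s ∈ Set.Icc ρ1 ρ2, v (H s x) = r := ⟨⟨hx, hd⟩, K.ex_crs hx hd⟩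
  rw [crs, dif_pos h]
  exact h.2.choose_spec

lemma Flow.crs_uniq (K : Flow Y d v ρ1 ρ2 r H) {x : Fin n → ℝ} (hx : x ∈ Y) (hd : d x ∈ Set.Icc ρ1 ρ2) {s : ℝ}
    (hs : s ∈ Set.Icc ρ1 ρ2) (h : v (H s x) = r) : s = crs Y d v ρ1 ρ2 r H x := by
  obtain ⟨h1, h2⟩ := K.crs_spec hx hd
  exact (K.mono x hx hd).injOn hs h1 (h.trans h2.symm)

lemma Flow.crs_sf (K : Flow Y d v ρ1 ρ2 r H) : SF (crs Y d v ρ1 ρ2 r H) := by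
  have hI : ∀ {ι : Type} {w : (ι → ℝ) → ℝ}, SF w → Dfn fun z => w z ∈ Set.Icc ρ1 ρ2 := fun hw =>
    (Dfn.le (SF.const ρ1) hw).and (Dfn.le hw (SF.const ρ2))
  have hYI : Dfn fun x => x ∈ Y ∧ d x ∈ Set.Icc ρ1 ρ2 := Dfn.and K.hY (hI K.ds)
  refine SF.of_iff (T := fun x t => ((x ∈ Y ∧ d x ∈ Set.Icc ρ1 ρ2) ∧ t ∈ Set.Icc ρ1 ρ2 ∧ v (H t x) = r) ∨
    (¬ (x ∈ Y ∧ d x ∈ Set.Icc ρ1 ρ2) ∧ t = 0)) ?_ ?_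
  · exact (hYI.some'.and ((hI (SF.coord none)).and (Dfn.eq (K.vs.comp K.sf) (SF.const r)))).or
      (hYI.some'.not.and (Dfn.eq (SF.coord none) (SF.const 0)))
  · intro x t
    by_cases h : x ∈ Y ∧ d x ∈ Set.Icc ρ1 ρ2
    · simp only [h, true_and, not_true, false_and, or_false]
      constructor
      · rintro rfl; exact K.crs_spec h.1 h.2
      · rintro ⟨h1, h2⟩; exact K.crs_uniq h.1 h.2 h1 h2
    · have : crs Y d v ρ1 ρ2 r H x = 0 := by rw [crs, dif_neg (fun hh => h hh.1)]
      rw [this]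
      simp only [h, false_and, not_false_eq_true, true_and, false_or]

lemma Flow.crs_cont (K : Flow Y d v ρ1 ρ2 r H) :
    ContinuousOn (crs Y d v ρ1 ρ2 r H) {x | x ∈ Y ∧ d x ∈ Set.Icc ρ1 ρ2} := by
  intro x0 hx0
  refine tendsto_of_ultra (A := ρ1) (B := ρ2) ?_ ?_
  · filter_upwards [self_mem_nhdsWithin] with x hx using (K.crs_spec hx.1 hx.2).1
  · intro U hU y hy
    have hmem : ∀ᶠ x in (U : Filter _), x ∈ {x | x ∈ Y ∧ d x ∈ Set.Icc ρ1 ρ2} := hU self_mem_nhdsWithin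
    have hyI : y ∈ Set.Icc ρ1 ρ2 := isClosed_Icc.mem_of_tendsto hy (hmem.mono fun x hx => (K.crs_spec hx.1 hx.2).1)
    apply K.crs_uniq hx0.1 hx0.2 hyI
    have hV : ContinuousOn (fun q : ℝ × (Fin n → ℝ) => v (H q.1 q.2)) (Set.Icc ρ1 ρ2 ×ˢ {x | x ∈ Y ∧ d x ∈ Set.Icc ρ1 ρ2}) :=
      K.vc.comp K.cont fun q hq => (K.mem _ hq.2.1 hq.2.2 _ hq.1).1
    have hid : Tendsto (fun x : Fin n → ℝ => x) (U : Filter _) (𝓝 x0) := hU.trans nhdsWithin_le_nhds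
    have ht : Tendsto (fun x => (crs Y d v ρ1 ρ2 r H x, x)) (U : Filter _)
        (𝓝[Set.Icc ρ1 ρ2 ×ˢ {x | x ∈ Y ∧ d x ∈ Set.Icc ρ1 ρ2}] (y, x0)) := by
      apply tendsto_nhdsWithin_of_tendsto_nhds_of_eventually_within
      · exact hy.prodMk_nhds hid
      · exact hmem.mono fun x hx => ⟨(K.crs_spec hx.1 hx.2).1, hx⟩
    have h1 := (hV (y, x0) ⟨hyI, hx0⟩).tendsto.comp ht
    refine tendsto_nhds_unique h1 (Tendsto.congr' ?_ tendsto_const_nhds)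
    exact hmem.mono fun x hx => (K.crs_spec hx.1 hx.2).2.symm

lemma Flow.homeo (K : Flow Y d v ρ1 ρ2 r H) : IsSemialgHomeo {x | x ∈ Y ∧ d x ≤ r} {x | x ∈ Y ∧ v x ≤ r} := by
  obtain ⟨hr1, hr2⟩ := K.hlt
  set s := crs Y d v ρ1 ρ2 r H with hs
  have m1 : ρ1 ∈ Set.Icc ρ1 ρ2 := ⟨le_rfl, by linarith⟩
  have m2 : ρ2 ∈ Set.Icc ρ1 ρ2 := ⟨by linarith, le_rfl⟩
  have slo : ∀ x ∈ Y, d x ∈ Set.Icc ρ1 ρ2 → ρ1 < s x ∧ s x ≤ ρ2 := by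
    intro x hx hd
    obtain ⟨h1, h2⟩ := K.crs_spec hx hd
    refine ⟨lt_of_le_of_ne h1.1 fun hh => ?_, h1.2⟩
    have := K.lo _ (K.mem x hx hd _ m1).1 (K.mem x hx hd _ m1).2.le
    rw [hh] at this
    exact absurd h2 this.ne
  have sinv : ∀ x ∈ Y, d x ∈ Set.Icc ρ1 ρ2 → ∀ ρ ∈ Set.Icc ρ1 ρ2, s (H ρ x) = s x := by
    intro x hx hd ρ hρ
    obtain ⟨h1, h2⟩ := K.crs_spec hx hd
    obtain ⟨a, b⟩ := K.mem x hx hd ρ hρ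
    refine (K.crs_uniq a (by rw [b]; exact hρ) h1 ?_).symm
    rw [K.coc x hx hd ρ hρ _ h1, h2]
  have vle : ∀ x ∈ Y, d x ∈ Set.Icc ρ1 ρ2 → ∀ ρ ∈ Set.Icc ρ1 ρ2, (v (H ρ x) ≤ r ↔ ρ ≤ s x) := by
    intro x hx hd ρ hρ
    obtain ⟨h1, h2⟩ := K.crs_spec hx hd
    have := (K.mono x hx hd).le_iff_le hρ h1
    simp only [h2] at this
    exact this
  have vle' : ∀ x ∈ Y, d x ∈ Set.Icc ρ1 ρ2 → (v x ≤ r ↔ d x ≤ s x) := by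
    intro x hx hd
    have := vle x hx hd _ hd
    rwa [K.id x hx hd] at this
  have vd : ∀ x ∈ Y, v x ≤ r → d x ≤ ρ2 := fun x hx h => by
    by_contra hh
    exact absurd (K.hi x hx (not_le.mp hh).le) (not_lt.mpr h)
  set u1 : (Fin n → ℝ) → ℝ := fun x => (s x - ρ1) / (r - ρ1) with hu1
  set u2 : (Fin n → ℝ) → ℝ := fun x => (r - ρ1) / (s x - ρ1) with hu2
  have hrp : 0 < r - ρ1 := by linarith
  have t1 : ∀ x ∈ Y, ρ1 ≤ d x → d x ≤ r → ρ1 ≤ ρ1 + (d x - ρ1) * u1 x ∧ ρ1 + (d x - ρ1) * u1 x ≤ s x := by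
    intro x hx h1 h2
    have := (slo x hx ⟨h1, by linarith⟩).1
    have e : s x - ρ1 = (r - ρ1) * u1 x := by rw [hu1]; field_simp
    have : 0 < u1 x := div_pos (by linarith) hrp
    constructor <;> nlinarith
  have t2 : ∀ x ∈ Y, ρ1 ≤ d x → d x ≤ ρ2 → d x ≤ s x → ρ1 ≤ ρ1 + (d x - ρ1) * u2 x ∧ ρ1 + (d x - ρ1) * u2 x ≤ r := by
    intro x hx h1 h2 h3
    have := (slo x hx ⟨h1, h2⟩).1
    have hsp : 0 < s x - ρ1 := by linarith
    have e : r - ρ1 = (s x - ρ1) * u2 x := by rw [hu2]; field_simp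
    have : 0 < u2 x := div_pos hrp hsp
    constructor <;> nlinarith
  have u12 : ∀ x ∈ Y, d x ∈ Set.Icc ρ1 ρ2 → u1 x * u2 x = 1 ∧ 0 < u1 x ∧ 0 < u2 x := by
    intro x hx hd
    have := (slo x hx hd).1
    have hsp : 0 < s x - ρ1 := by linarith
    refine ⟨?_, div_pos hsp hrp, div_pos hrp hsp⟩
    rw [hu1, hu2]; field_simp
  have hmv : ∀ u x, ρ1 < d x → mv d ρ1 H u x = H (ρ1 + (d x - ρ1) * u x) x := fun u x h => by
    rw [mv, if_neg (not_le.mpr h)]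
  have hmv' : ∀ u x, d x ≤ ρ1 → mv d ρ1 H u x = x := fun u x h => by rw [mv, if_pos h]
  have inv : ∀ u u' : (Fin n → ℝ) → ℝ, ∀ x ∈ Y, d x ∈ Set.Icc ρ1 ρ2 → ρ1 < d x → ρ1 + (d x - ρ1) * u x ∈ Set.Icc ρ1 ρ2 →
      0 < u x → u x * u' x = 1 → u' (H (ρ1 + (d x - ρ1) * u x) x) = u' x → mv d ρ1 H u' (mv d ρ1 H u x) = x := by
    intro u u' x hx hd hlt hI hu huu he
    obtain ⟨a, b⟩ := K.mem x hx hd _ hI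
    rw [hmv u x hlt, hmv u' _ (by rw [b]; nlinarith), he, b]
    have : ρ1 + (ρ1 + (d x - ρ1) * u x - ρ1) * u' x = d x := by
      have : (d x - ρ1) * (u x * u' x) = d x - ρ1 := by rw [huu, mul_one]
      linarith
    rw [this, K.coc x hx hd _ hI _ hd, K.id x hx hd]
  have ss := K.crs_sf
  have sc := K.crs_cont
  refine ⟨mv d ρ1 H u1, mv d ρ1 H u2, ?_, ?_, ?_, ?_, ?_, ?_, ?_, ?_⟩
  · rintro x ⟨hx, hd⟩
    rcases le_or_gt (d x) ρ1 with h | h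
    · rw [hmv' _ _ h]; exact ⟨hx, (K.lo x hx h).le⟩
    · rw [hmv _ _ h]
      have hI : d x ∈ Set.Icc ρ1 ρ2 := ⟨h.le, by linarith⟩
      have ht := t1 x hx h.le hd
      have hI' : ρ1 + (d x - ρ1) * u1 x ∈ Set.Icc ρ1 ρ2 := ⟨ht.1, ht.2.trans (slo x hx hI).2⟩
      exact ⟨(K.mem x hx hI _ hI').1, (vle x hx hI _ hI').mpr ht.2⟩
  · rintro x ⟨hx, hv⟩
    rcases le_or_gt (d x) ρ1 with h | h
    · rw [hmv' _ _ h]; exact ⟨hx, by linarith⟩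
    · rw [hmv _ _ h]
      have hI : d x ∈ Set.Icc ρ1 ρ2 := ⟨h.le, vd x hx hv⟩
      have ht := t2 x hx hI.1 hI.2 ((vle' x hx hI).mp hv)
      have hI' : ρ1 + (d x - ρ1) * u2 x ∈ Set.Icc ρ1 ρ2 := ⟨ht.1, by linarith⟩
      have := K.mem x hx hI _ hI'
      exact ⟨this.1, by rw [this.2]; exact ht.2⟩
  · rintro x ⟨hx, hd⟩
    rcases le_or_gt (d x) ρ1 with h | h
    · rw [hmv' _ _ h, hmv' _ _ h]
    · have hI : d x ∈ Set.Icc ρ1 ρ2 := ⟨h.le, by linarith⟩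
      have ht := t1 x hx h.le hd
      have hI' : ρ1 + (d x - ρ1) * u1 x ∈ Set.Icc ρ1 ρ2 := ⟨ht.1, ht.2.trans (slo x hx hI).2⟩
      refine inv u1 u2 x hx hI h hI' (u12 x hx hI).2.1 (u12 x hx hI).1 ?_
      simp only [hu2]; rw [sinv x hx hI _ hI']
  · rintro x ⟨hx, hv⟩
    rcases le_or_gt (d x) ρ1 with h | h
    · rw [hmv' _ _ h, hmv' _ _ h]
    · have hI : d x ∈ Set.Icc ρ1 ρ2 := ⟨h.le, vd x hx hv⟩
      have ht := t2 x hx hI.1 hI.2 ((vle' x hx hI).mp hv)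
      have hI' : ρ1 + (d x - ρ1) * u2 x ∈ Set.Icc ρ1 ρ2 := ⟨ht.1, by linarith⟩
      refine inv u2 u1 x hx hI h hI' (u12 x hx hI).2.2 (by rw [mul_comm]; exact (u12 x hx hI).1) ?_
      simp only [hu1]; rw [sinv x hx hI _ hI']
  · refine K.mv_cont (fun x hx => hx.1) ((sc.sub continuousOn_const).div_const _) ?_
    rintro x ⟨hx, hd⟩ h
    have ht := t1 x hx h hd
    exact ⟨by linarith, ht.1, ht.2.trans (slo x hx ⟨h, by linarith⟩).2⟩
  · refine K.mv_cont (fun x hx => hx.1) (continuousOn_const.div (sc.sub continuousOn_const) ?_) ?_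
    · intro x hx
      have := (slo x hx.1 hx.2).1
      exact (sub_pos.mpr this).ne'
    rintro x ⟨hx, hv⟩ h
    have hI : d x ∈ Set.Icc ρ1 ρ2 := ⟨h, vd x hx hv⟩
    have ht := t2 x hx hI.1 hI.2 ((vle' x hx hI).mp hv)
    exact ⟨hI.2, ht.1, by linarith⟩
  · exact graph_dfn (K.mv_sf ((ss.sub (SF.const _)).div (SF.const _))) (Dfn.and K.hY (Dfn.le K.ds (SF.const r)))
  · exact graph_dfn (K.mv_sf ((SF.const _).div (ss.sub (SF.const _)))) (Dfn.and K.hY (Dfn.le K.vs (SF.const r)))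
end
end

section
lemma cmp_lem {n : ℕ} {X : Set (Fin n → ℝ)} (hX : IsCompact X) {g h : (Fin n → ℝ) → ℝ} (hg : ContinuousOn g X)
    (hh : ContinuousOn h X) (h0 : ∀ x ∈ X, 0 ≤ h x) (hz : ∀ x ∈ X, h x = 0 → g x = 0) {ρ : ℝ} (hρ : 0 < ρ) :
    ∃ m > 0, ∀ x ∈ X, ρ ≤ g x → m ≤ h x := by
  have hK : IsCompact {x | x ∈ X ∧ ρ ≤ g x} := by
    have : IsClosed (X ∩ g ⁻¹' Set.Ici ρ) := hg.preimage_isClosed_of_isClosed hX.isClosed isClosed_Ici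
    exact hX.of_isClosed_subset this Set.inter_subset_left
  rcases Set.eq_empty_or_nonempty {x | x ∈ X ∧ ρ ≤ g x} with he | hne
  · refine ⟨1, one_pos, fun x hx hx' => ?_⟩
    have : x ∈ {x | x ∈ X ∧ ρ ≤ g x} := ⟨hx, hx'⟩
    rw [he] at this
    exact absurd this (Set.notMem_empty _)
  · obtain ⟨y, hy, hmin⟩ := hK.exists_isMinOn hne (hh.mono fun x hx => hx.1)
    refine ⟨h y, lt_of_le_of_ne (h0 y hy.1) fun hh => ?_, fun x hx hx' => hmin ⟨hx, hx'⟩⟩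
    have := hz y hy.1 hh.symm
    have := hy.2
    linarith

def wn {n : ℕ} (x : Fin n → ℝ) : ℝ := ∑ i, |x i|
def zz {n : ℕ} (x : Fin n → ℝ) : Fin (n+1) → ℝ := Fin.snoc (α := fun _ => ℝ) x (wn x)

lemma wn_cont {n : ℕ} : Continuous (wn (n := n)) := by unfold wn; fun_prop
lemma wn_nonneg {n : ℕ} (x : Fin n → ℝ) : 0 ≤ wn x := Finset.sum_nonneg fun _ _ => abs_nonneg _
lemma wn_zero {n : ℕ} {x : Fin n → ℝ} (h : wn x = 0) : x = 0 := by
  funext i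
  have := (Finset.sum_eq_zero_iff_of_nonneg (fun i _ => abs_nonneg (x i))).mp h i (Finset.mem_univ _)
  simpa using this
lemma wn_sf {n : ℕ} : SF (wn (n := n)) := SF.sum _ fun i _ => (SF.coord i).abs
lemma zz_sf {n : ℕ} (i : Fin (n+1)) : SF fun x : Fin n → ℝ => zz x i := by
  refine Fin.lastCases ?_ (fun j => ?_) i
  · simpa only [zz, Fin.snoc_last] using wn_sf
  · simpa only [zz, Fin.snoc_castSucc] using SF.coord j
lemma zz_cont {n : ℕ} : Continuous (zz (n := n)) := by
  apply continuous_pi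
  intro i
  refine Fin.lastCases ?_ (fun j => ?_) i
  · simpa only [zz, Fin.snoc_last] using wn_cont
  · simpa only [zz, Fin.snoc_castSucc] using continuous_apply j
lemma zz_norm {n : ℕ} (x : Fin n → ℝ) : ‖zz x‖ ≤ wn x := by
  rw [pi_norm_le_iff_of_nonneg (wn_nonneg x)]
  intro i
  refine Fin.lastCases ?_ (fun j => ?_) i
  · simp only [zz, Fin.snoc_last]; rw [Real.norm_eq_abs, abs_of_nonneg (wn_nonneg x)]
  · simp only [zz, Fin.snoc_castSucc]
    exact Finset.single_le_sum (f := fun i => |x i|) (fun i _ => abs_nonneg _) (Finset.mem_univ j)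

/-- the graph carrying the pair `(f, d)` -/
def Zs {n : ℕ} (X : Set (Fin n → ℝ)) (f d : (Fin n → ℝ) → ℝ) : Set (Fin 2 ⊕ Fin (n+1) → ℝ) :=
  {q | (fun i : Fin n => q (Sum.inr i.castSucc)) ∈ X ∧ q (Sum.inl 0) = f (fun i : Fin n => q (Sum.inr i.castSucc)) ∧
    q (Sum.inl 1) = d (fun i : Fin n => q (Sum.inr i.castSucc)) ∧
    q (Sum.inr (Fin.last n)) = wn (fun i : Fin n => q (Sum.inr i.castSucc))}

lemma Zs_rsa {n : ℕ} {X : Set (Fin n → ℝ)} {f d : (Fin n → ℝ) → ℝ} (hX : IsRSA (Fin n) X) (hf : SF f) (hd : SF d) :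
    IsRSA (Fin 2 ⊕ Fin (n+1)) (Zs X f d) :=
  (Dfn.ren hX fun i : Fin n => Sum.inr i.castSucc).and ((Dfn.eq (SF.coord _) (hf.ren fun i : Fin n => Sum.inr i.castSucc)).and
    ((Dfn.eq (SF.coord _) (hd.ren fun i : Fin n => Sum.inr i.castSucc)).and
      (Dfn.eq (SF.coord _) (wn_sf.ren fun i : Fin n => Sum.inr i.castSucc))))

lemma Zs_zz {n : ℕ} {X : Set (Fin n → ℝ)} {f d : (Fin n → ℝ) → ℝ} {x : Fin n → ℝ} (hx : x ∈ X) :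
    pt (f x) (d x) (zz x) ∈ Zs X f d := by
  simp [Zs, zz, hx]

lemma Zs_inv {n : ℕ} {X : Set (Fin n → ℝ)} {f d : (Fin n → ℝ) → ℝ} {a ρ : ℝ} {z : Fin (n+1) → ℝ}
    (h : pt a ρ z ∈ Zs X f d) : (fun i : Fin n => z i.castSucc) ∈ X ∧ f (fun i : Fin n => z i.castSucc) = a ∧
      d (fun i : Fin n => z i.castSucc) = ρ ∧ z = zz (fun i : Fin n => z i.castSucc) := by
  obtain ⟨h1, h2, h3, h4⟩ := h
  refine ⟨h1, h2.symm, h3.symm, ?_⟩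
  funext i
  refine Fin.lastCases ?_ (fun j => ?_) i
  · simp only [zz, Fin.snoc_last]; exact h4
  · simp only [zz, Fin.snoc_castSucc]

def RelX {n : ℕ} (X : Set (Fin n → ℝ)) (d₁ d₂ : (Fin n → ℝ) → ℝ) (ρ v : ℝ) : Prop :=
  ∃ x : Fin n → ℝ, (x ∈ X ∧ (d₁ x = ρ ∨ d₂ x = ρ)) ∧ 1/2 * wn x ≤ v ∧ v ≤ 3/2 * wn x

lemma RelX_dfn {n : ℕ} {X : Set (Fin n → ℝ)} {d₁ d₂ : (Fin n → ℝ) → ℝ} (hX : IsRSA (Fin n) X) (h1 : SF d₁)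
    (h2 : SF d₂) : Dfn fun x : Fin 2 → ℝ => RelX X d₁ d₂ (x 0) (x 1) := by
  refine Dfn.exs (q := fun (z : Fin 2 → ℝ) (x : Fin n → ℝ) => (x ∈ X ∧ (d₁ x = z 0 ∨ d₂ x = z 0)) ∧
    1/2 * wn x ≤ z 1 ∧ z 1 ≤ 3/2 * wn x) ?_
  exact ((Dfn.ren hX Sum.inr).and ((Dfn.eq (h1.ren Sum.inr) (SF.coord _)).or (Dfn.eq (h2.ren Sum.inr) (SF.coord _)))).and
    ((Dfn.le ((SF.const _).mul (wn_sf.ren Sum.inr)) (SF.coord _)).and (Dfn.le (SF.coord _) ((SF.const _).mul (wn_sf.ren Sum.inr))))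

lemma RelX_closed {n : ℕ} {X : Set (Fin n → ℝ)} {d₁ d₂ : (Fin n → ℝ) → ℝ} (hX : IsCompact X) (h1 : ContinuousOn d₁ X)
    (h2 : ContinuousOn d₂ X) (ρ : ℝ) : IsClosed {v | RelX X d₁ d₂ ρ v} := by
  have hK : IsCompact {x | x ∈ X ∧ (d₁ x = ρ ∨ d₂ x = ρ)} := by
    have a1 : IsClosed (X ∩ d₁ ⁻¹' {ρ}) := h1.preimage_isClosed_of_isClosed hX.isClosed isClosed_singleton
    have a2 : IsClosed (X ∩ d₂ ⁻¹' {ρ}) := h2.preimage_isClosed_of_isClosed hX.isClosed isClosed_singleton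
    refine hX.of_isClosed_subset (?_ : IsClosed _) fun x hx => hx.1
    convert a1.union a2 using 1
    rw [← Set.inter_union_distrib_left]; rfl
  have hw := wn_cont (n := n)
  have := ((hK.prod (isCompact_Icc (a := (1/2:ℝ)) (b := 3/2))).image
    (by fun_prop : Continuous fun q : (Fin n → ℝ) × ℝ => q.2 * wn q.1)).isClosed
  convert this using 1
  ext v
  constructor
  · rintro ⟨x, hx, ha, hb⟩
    rcases (wn_nonneg x).eq_or_lt with h | h
    · rw [← h] at ha hb
      refine ⟨(x, 1), ⟨hx, by norm_num, by norm_num⟩, ?_⟩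
      simp only [← h]; linarith
    · refine ⟨(x, v / wn x), ⟨hx, ?_, ?_⟩, ?_⟩
      · exact (le_div_iff₀ h).mpr ha
      · exact (div_le_iff₀ h).mpr hb
      · simp only; field_simp
  · rintro ⟨⟨x, t⟩, ⟨hx, ht1, ht2⟩, rfl⟩
    exact ⟨x, hx, mul_le_mul_of_nonneg_right ht1 (wn_nonneg x), mul_le_mul_of_nonneg_right ht2 (wn_nonneg x)⟩

lemma mk_flow {n : ℕ} {X : Set (Fin n → ℝ)} {f d : (Fin n → ℝ) → ℝ} (hX : IsRSA (Fin n) X)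
    (hf : SF f) (hd : SF d) (hdc : ContinuousOn d X) {v : (Fin (n+1) → ℝ) → ℝ} (vc : Continuous v) (vs : SF v)
    {Rel : ℝ → ℝ → Prop} {F : Finset (MvPolynomial (Fin 2 ⊕ Fin (n+1)) ℝ)}
    (hF : ∀ x y, SSign F x y → (x ∈ Zs X f d ↔ y ∈ Zs X f d))
    {a ρ1 ρ2 r : ℝ} {W : Set (Fin (n+1) → ℝ)} {h : ℝ → ℝ → (Fin (n+1) → ℝ) → (Fin (n+1) → ℝ)}
    (T : Triv F a ρ1 ρ2 W h) (hm : MonoP Rel v ρ1 ρ2 W h) (hW : ∀ x ∈ X, zz x ∈ W)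
    (hrel : ∀ x ∈ X, Rel (d x) (v (zz x))) (hlt : ρ1 < r ∧ r < ρ2)
    (lo : ∀ x ∈ X, d x ≤ ρ1 → v (zz x) < r) (hi : ∀ x ∈ X, ρ2 ≤ d x → r < v (zz x)) :
    Flow {x | x ∈ X ∧ f x = a} d (fun x => v (zz x)) ρ1 ρ2 r (fun ρ x i => h (d x) ρ (zz x) i.castSucc) := by
  have key : ∀ x, x ∈ X ∧ f x = a → d x ∈ Set.Icc ρ1 ρ2 → ∀ ρ ∈ Set.Icc ρ1 ρ2,
      (fun i : Fin n => h (d x) ρ (zz x) i.castSucc) ∈ X ∧ f (fun i : Fin n => h (d x) ρ (zz x) i.castSucc) = a ∧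
      d (fun i : Fin n => h (d x) ρ (zz x) i.castSucc) = ρ ∧
      h (d x) ρ (zz x) = zz (fun i : Fin n => h (d x) ρ (zz x) i.castSucc) := by
    rintro x ⟨hx, rfl⟩ hdx ρ hρ
    exact Zs_inv ((hF _ _ (T.sgn (d x) hdx ρ hρ (zz x) (hW x hx))).mp (Zs_zz hx))
  refine ⟨Dfn.and hX (Dfn.eq hf (SF.const a)), hdc.mono fun x hx => hx.1, (vc.comp zz_cont).continuousOn, hd,
    vs.comp zz_sf, hlt, ?_, ?_, ?_, ?_, ?_, ?_, fun x hx => lo x hx.1, fun x hx => hi x hx.1⟩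
  · intro x hx hdx ρ hρ
    obtain ⟨h1, h2, h3, _⟩ := key x hx hdx ρ hρ
    exact ⟨⟨h1, h2⟩, h3⟩
  · intro x hx hdx
    funext i
    show h (d x) (d x) (zz x) i.castSucc = x i
    rw [T.id _ hdx _ (hW x hx.1)]
    simp only [zz, Fin.snoc_castSucc]
  · intro x hx hdx ρ hρ ρ' hρ'
    obtain ⟨h1, h2, h3, h4⟩ := key x hx hdx ρ hρ
    funext i
    rw [h3, ← h4, T.coc _ hdx _ hρ _ hρ' _ (hW x hx.1)]
  · refine continuousOn_pi.mpr fun i => ?_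
    refine (continuous_apply i.castSucc).comp_continuousOn ?_
    refine T.cont.comp (f := fun q : ℝ × (Fin n → ℝ) => (d q.2, q.1, zz q.2)) ?_ ?_
    · refine ContinuousOn.prodMk (hdc.comp continuousOn_snd ?_) (continuousOn_fst.prodMk
        (zz_cont.comp continuous_snd).continuousOn)
      intro q hq; exact hq.2.1.1
    · intro q hq
      exact ⟨hq.2.2, hq.1, hW _ hq.2.1.1⟩
  · intro i
    refine ((T.sf i.castSucc).comp (u := Sum.elim ![fun q : Option (Fin n) → ℝ => d fun j => q (some j), fun q => q none]
      fun j q => zz (fun j => q (some j)) j) ?_).congr fun q => rfl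
    rintro (j | j)
    · fin_cases j
      · exact hd.some'
      · exact SF.coord none
    · exact (zz_sf j).some'
  · intro x hx hdx ρ hρ ρ' hρ' hlt
    have := hm _ (hW x hx.1) _ hdx (hrel x hx.1) hρ hρ' hlt
    simp only at this ⊢
    rwa [← (key x hx hdx ρ hρ).2.2.2, ← (key x hx hdx ρ' hρ').2.2.2]

theorem core {n : ℕ} {X : Set (Fin n → ℝ)} (hXc : IsCompact X) (hX : IsRSA (Fin n) X)
    {f d₁ d₂ : (Fin n → ℝ) → ℝ} (hf : SF f)
    (s1 : SF d₁) (s2 : SF d₂) (c1 : ContinuousOn d₁ X) (c2 : ContinuousOn d₂ X)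
    (n1 : ∀ x ∈ X, 0 ≤ d₁ x) (n2 : ∀ x ∈ X, 0 ≤ d₂ x)
    (z1 : ∀ x ∈ X, d₁ x = 0 ↔ x = 0) (z2 : ∀ x ∈ X, d₂ x = 0 ↔ x = 0) :
    ∃ r₀ > (0:ℝ), ∀ r ∈ Set.Ioc 0 r₀, ∃ a₀ > (0:ℝ), ∀ a ∈ Set.Ioc 0 a₀,
      IsSemialgHomeo {x | (x ∈ X ∧ f x = a) ∧ d₁ x ≤ r} {x | (x ∈ X ∧ f x = a) ∧ d₂ x ≤ r} := by
  obtain ⟨F1, hF1⟩ := rsa_det (Zs_rsa hX hf s1)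
  obtain ⟨F2, hF2⟩ := rsa_det (Zs_rsa hX hf s2)
  obtain ⟨R, hR⟩ := (hXc.image zz_cont).isBounded.subset_closedBall 0
  have hR' : zz '' X ⊆ Metric.closedBall 0 (max R 1) := hR.trans (Metric.closedBall_subset_closedBall (le_max_left _ _))
  obtain ⟨v, vc, vs, vb, r0, hr0, hE⟩ := tower n (F1 ∪ F2) (1/2) (max R 1) (by norm_num)
    (lt_of_lt_of_le one_pos (le_max_right _ _)) (RelX X d₁ d₂) (RelX_dfn hX s1 s2) (RelX_closed hXc c1 c2)
  have vb' : ∀ x : Fin n → ℝ, 1/2 * wn x ≤ v (zz x) ∧ v (zz x) ≤ 3/2 * wn x := by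
    intro x
    have h1 := vb (zz x)
    have h2 := zz_norm x
    have h3 : zz x (Fin.last n) = wn x := by simp [zz]
    rw [h3] at h1
    have := abs_le.mp h1
    constructor <;> linarith
  have wc : ContinuousOn (wn (n := n)) X := wn_cont.continuousOn
  obtain ⟨m1, hm1, k1⟩ := cmp_lem hXc c1 wc (fun x _ => wn_nonneg x) (fun x hx h => (z1 x hx).mpr (wn_zero h)) hr0
  obtain ⟨m2, hm2, k2⟩ := cmp_lem hXc c2 wc (fun x _ => wn_nonneg x) (fun x hx h => (z2 x hx).mpr (wn_zero h)) hr0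
  have w0 : wn (0 : Fin n → ℝ) = 0 := by simp [wn]
  refine ⟨min (r0/2) (min (m1/4) (m2/4)), lt_min (by linarith) (lt_min (by linarith) (by linarith)), ?_⟩
  rintro r ⟨hr, hrle⟩
  have hra : r ≤ r0/2 := hrle.trans (min_le_left _ _)
  have hrb : r ≤ m1/4 := hrle.trans ((min_le_right _ _).trans (min_le_left _ _))
  have hrc : r ≤ m2/4 := hrle.trans ((min_le_right _ _).trans (min_le_right _ _))
  obtain ⟨l1, hl1, q1⟩ := cmp_lem hXc wc c1 n1 (fun x hx h => by rw [(z1 x hx).mp h, w0]) (half_pos hr)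
  obtain ⟨l2, hl2, q2⟩ := cmp_lem hXc wc c2 n2 (fun x hx h => by rw [(z2 x hx).mp h, w0]) (half_pos hr)
  obtain ⟨ρ1, hρ0, hρr, hρ1, hρ2⟩ : ∃ ρ1 : ℝ, 0 < ρ1 ∧ ρ1 < r ∧ ρ1 < l1 ∧ ρ1 < l2 := by
    have : 0 < min r (min l1 l2) := lt_min hr (lt_min hl1 hl2)
    have a1 := min_le_left r (min l1 l2)
    have a2 := min_le_right r (min l1 l2)
    have a3 := min_le_left l1 l2
    have a4 := min_le_right l1 l2
    exact ⟨min r (min l1 l2) / 2, by linarith, by linarith, by linarith, by linarith⟩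
  have lo1 : ∀ x ∈ X, d₁ x ≤ ρ1 → 3/2 * wn x < r := by
    intro x hx h
    have : ¬ r/2 ≤ wn x := fun hh => by linarith [q1 x hx hh]
    linarith
  have lo2 : ∀ x ∈ X, d₂ x ≤ ρ1 → 3/2 * wn x < r := by
    intro x hx h
    have : ¬ r/2 ≤ wn x := fun hh => by linarith [q2 x hx hh]
    linarith
  have hi1 : ∀ x ∈ X, r0 ≤ d₁ x → r < 1/2 * wn x := fun x hx h => by linarith [k1 x hx h]
  have hi2 : ∀ x ∈ X, r0 ≤ d₂ x → r < 1/2 * wn x := fun x hx h => by linarith [k2 x hx h]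
  obtain ⟨a0, ha0, hA⟩ := hE ρ1 r0 hρ0 (by linarith) le_rfl
  refine ⟨a0, ha0, fun a ha => ?_⟩
  have sep : ∀ u w, RelX X d₁ d₂ ρ1 u → RelX X d₁ d₂ r0 w → u < w := by
    rintro u w ⟨x, ⟨hx, hx'⟩, _, hxu⟩ ⟨y, ⟨hy, hy'⟩, hyw, _⟩
    have A : 3/2 * wn x < r := hx'.elim (fun h => lo1 x hx h.le) (fun h => lo2 x hx h.le)
    have B : r < 1/2 * wn y := hy'.elim (fun h => hi1 y hy h.ge) (fun h => hi2 y hy h.ge)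
    linarith
  obtain ⟨W, h, hW, T, hm⟩ := hA a ha.1 ha.2 sep
  have hWX : ∀ x ∈ X, zz x ∈ W := fun x hx => hW (hR' ⟨x, hx, rfl⟩)
  have f1 := (mk_flow hX hf s1 c1 vc vs (fun x y hxy => hF1 x y (hxy.mono Finset.subset_union_left)) T hm hWX
    (fun x hx => ⟨x, ⟨hx, Or.inl rfl⟩, vb' x⟩) (⟨hρr, by linarith⟩ : ρ1 < r ∧ r < r0)
    (fun x hx hh => (vb' x).2.trans_lt (lo1 x hx hh)) (fun x hx hh => (hi1 x hx hh).trans_le (vb' x).1)).homeo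
  have f2 := (mk_flow hX hf s2 c2 vc vs (fun x y hxy => hF2 x y (hxy.mono Finset.subset_union_right)) T hm hWX
    (fun x hx => ⟨x, ⟨hx, Or.inr rfl⟩, vb' x⟩) (⟨hρr, by linarith⟩ : ρ1 < r ∧ r < r0)
    (fun x hx hh => (vb' x).2.trans_lt (lo2 x hx hh)) (fun x hx hh => (hi2 x hx hh).trans_le (vb' x).1)).homeo
  exact f1.trans f2.symm

lemma sf_ext {n : ℕ} {X : Set (Fin n → ℝ)} (hX : IsRSA (Fin n) X) {f : (Fin n → ℝ) → ℝ}
    (hf : IsRSA (Option (Fin n)) (graphFunOn f X)) : SF fun x => if x ∈ X then f x else 0 := by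
  have h1 : Dfn fun z : Option (Fin n) → ℝ => z ∈ graphFunOn f X := hf
  have h2 : Dfn fun z : Option (Fin n) → ℝ => (fun i => z (some i)) ∉ X ∧ z none = 0 :=
    (Dfn.not (Dfn.ren hX some)).and (Dfn.eq (SF.coord none) (SF.const 0))
  refine (h1.or h2).congr fun z => ?_
  by_cases h : (fun i => z (some i)) ∈ X
  · simp [graphFunOn, h]
  · simp [graphFunOn, h]
end

/-- Proposition `prop-key`. Let `X ⊆ ℝⁿ` be a compact semialgebraic
set with `0 ∈ X`, `f` a continuous semialgebraic function on `X` with `f(0) = 0`, and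
`d₁, d₂` nonnegative continuous semialgebraic functions on `X` with zero set `{0}`.
Then `N₁(a,r)` and `N₂(a,r)` are semialgebraically homeomorphic for `0 < a ≪ r ≪ 1`. -/
theorem statement13 {n : ℕ} (X : Set (Fin n → ℝ)) (hXc : IsCompact X)
    (hXsa : IsRSA (Fin n) X) (hX0 : (0 : Fin n → ℝ) ∈ X)
    (f : (Fin n → ℝ) → ℝ) (hfC : ContinuousOn f X)
    (hfSA : IsRSA (Option (Fin n)) (graphFunOn f X)) (hf0 : f 0 = 0)
    (d₁ d₂ : (Fin n → ℝ) → ℝ)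
    (hd₁C : ContinuousOn d₁ X) (hd₂C : ContinuousOn d₂ X)
    (hd₁SA : IsRSA (Option (Fin n)) (graphFunOn d₁ X))
    (hd₂SA : IsRSA (Option (Fin n)) (graphFunOn d₂ X))
    (hd₁0 : ∀ x ∈ X, 0 ≤ d₁ x) (hd₂0 : ∀ x ∈ X, 0 ≤ d₂ x)
    (hd₁z : ∀ x ∈ X, (d₁ x = 0 ↔ x = 0)) (hd₂z : ∀ x ∈ X, (d₂ x = 0 ↔ x = 0)) :
    ∃ r₀ > (0 : ℝ), ∀ r ∈ Set.Ioc (0 : ℝ) r₀, ∃ a₀ > (0 : ℝ), ∀ a ∈ Set.Ioc (0 : ℝ) a₀,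
      IsSemialgHomeo {x ∈ X | d₁ x ≤ r ∧ f x = a} {x ∈ X | d₂ x ≤ r ∧ f x = a} := by
  obtain ⟨r₀, hr₀, H⟩ := core hXc hXsa (sf_ext hXsa hfSA) (sf_ext hXsa hd₁SA) (sf_ext hXsa hd₂SA)
    (hd₁C.congr fun x hx => if_pos hx) (hd₂C.congr fun x hx => if_pos hx)
    (fun x hx => by simp only [if_pos hx]; exact hd₁0 x hx)
    (fun x hx => by simp only [if_pos hx]; exact hd₂0 x hx)
    (fun x hx => by simp only [if_pos hx]; exact hd₁z x hx)
    (fun x hx => by simp only [if_pos hx]; exact hd₂z x hx)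
  have conv : ∀ (d : (Fin n → ℝ) → ℝ) (r a : ℝ), {x ∈ X | d x ≤ r ∧ f x = a} =
      {x | (x ∈ X ∧ (if x ∈ X then f x else 0) = a) ∧ (if x ∈ X then d x else 0) ≤ r} := by
    intro d r a
    ext x
    by_cases hx : x ∈ X
    · simp [hx, and_comm]
    · simp [hx]
  refine ⟨r₀, hr₀, fun r hr => ?_⟩
  obtain ⟨a₀, ha₀, H'⟩ := H r hr
  refine ⟨a₀, ha₀, fun a ha => ?_⟩
  rw [conv d₁, conv d₂]
  exact H' a ha

end RealMilnor
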